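/- arXiv:math/0305427 — 6 statements merged into one kernel-verified Lean document; each statement's English description precedes it below -/
import Mathlib

section
/- Let H be a real Hilbert space, f₁ : H → ℝ a lower semicontinuous function, and f₂ : H → ℝ a uniformly continuous function. Let p ∈ H, ζ ∈ D⁻(f₁ + f₂)(p), and ε > 0. Then there exist points p₁, p₂ ∈ H and functionals ζ₁ ∈ D⁻f₁(p₁), ζ₂ ∈ D⁻f₂(p₂) such that: ‖pᵢ − p‖ < ε for i = 1,2 (in particular ‖p₁ − p₂‖ < 2ε); ‖ζ₁ + ζ₂ − ζ‖ < ε; and |fᵢ(pᵢ) − fᵢ(p)| < ε for i = 1,2. -/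
open Filter Topology

/-- The viscosity subdifferential of `f : H → ℝ` at `p`. -/
def subdiffR {H : Type*} [NormedAddCommGroup H] [InnerProductSpace ℝ H]
    (f : H → ℝ) (p : H) : Set (H →L[ℝ] ℝ) :=
  {ζ | ∃ φ : H → ℝ, ContDiff ℝ 1 φ ∧ fderiv ℝ φ p = ζ ∧
    IsLocalMin (fun x => f x - φ x) p}

/-- A variational principle: if a family of lower semicontinuous functions on a closed set is
stable under arbitrarily small quadratic bumps, then densely many members attain their minimum. -/
theorem dense_exists_isMinOn {E X : Type*} [MetricSpace E] [CompleteSpace E] [MetricSpace X]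
    [CompleteSpace X] {C : Set X} (hC : IsClosed C) (hne : C.Nonempty) (G : E → X → ℝ)
    (hlsc : ∀ q, LowerSemicontinuousOn (G q) C) (hbdd : ∀ q, BddBelow (G q '' C))
    {B : ℝ} (hB : 0 < B) (hG : ∀ q q', ∀ x ∈ C, |G q x - G q' x| ≤ B * dist q q')
    (hbump : ∀ τ > 0, ∃ l > 0, ∀ q, ∀ x₀ ∈ C, ∃ q', dist q' q < τ ∧
      ∀ x ∈ C, G q x - G q x₀ + l * dist x x₀ ^ 2 ≤ G q' x - G q' x₀) :
    Dense {q | ∃ x ∈ C, IsMinOn (G q) C x} := by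
  have hnear : ∀ q, ∀ r > 0, ∃ x ∈ C, ∀ y ∈ C, G q x ≤ G q y + r := by
    intro q r hr
    obtain ⟨_, ⟨x, hx, rfl⟩, hxr⟩ := Real.lt_sInf_add_pos (hne.image (G q)) hr
    refine ⟨x, hx, fun y hy => ?_⟩
    linarith [csInf_le (hbdd q) (Set.mem_image_of_mem (G q) hy)]
  let U : ℕ → Set E := fun n => {q | ∃ r > 0, ∃ c : X, ∀ x ∈ C,
    (∀ y ∈ C, G q x ≤ G q y + r) → dist x c ≤ 1 / ((n : ℝ) + 1)}
  have hopen : ∀ n, IsOpen (U n) := by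
    intro n
    refine Metric.isOpen_iff.2 ?_
    rintro q ⟨r, hr, c, hc⟩
    refine ⟨r / (4 * B), by positivity, fun q' hq' => ⟨r / 2, by positivity, c, ?_⟩⟩
    intro x hx h
    refine hc x hx fun y hy => ?_
    have hd : B * dist q' q ≤ r / 4 := by
      have := mul_le_mul_of_nonneg_left (Metric.mem_ball.1 hq').le hB.le
      calc _ ≤ _ := this
        _ = _ := by field_simp
    have h1 := (abs_le.1 (hG q' q x hx)).1
    have h2 := (abs_le.1 (hG q' q y hy)).2
    linarith [h y hy]
  have hdense : ∀ n, Dense (U n) := by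
    intro n
    refine Metric.dense_iff.2 fun q τ hτ => ?_
    obtain ⟨l, hl, hl'⟩ := hbump τ hτ
    set k : ℝ := 1 / ((n : ℝ) + 1) with hk
    have hk0 : 0 < k := by positivity
    obtain ⟨x₀, hx₀, hmin⟩ := hnear q (l * k ^ 2 / 2) (by positivity)
    obtain ⟨q', hq', hb⟩ := hl' q x₀ hx₀
    refine ⟨q', hq', l * k ^ 2 / 2, by positivity, x₀, fun x hx h => ?_⟩
    have h1 : l * dist x x₀ ^ 2 ≤ l * k ^ 2 := by
      linarith [hb x hx, h x₀ hx₀, hmin x hx]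
    exact (sq_le_sq₀ dist_nonneg hk0.le).1 (le_of_mul_le_mul_left h1 hl)
  refine (dense_iInter_of_isOpen_nat hopen hdense).mono fun q hq => ?_
  choose x hxC hx using fun k : ℕ => hnear q (1 / ((k : ℝ) + 1)) (by positivity)
  have hcau : CauchySeq x := by
    refine Metric.cauchySeq_iff'.2 fun ε hε => ?_
    obtain ⟨n, hn⟩ := exists_nat_one_div_lt (half_pos hε)
    obtain ⟨r, hr, c, hc⟩ := Set.mem_iInter.1 hq n
    obtain ⟨N, hN⟩ := exists_nat_one_div_lt hr
    have key : ∀ k ≥ N, dist (x k) c < ε / 2 := by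
      intro k hk
      refine (hc (x k) (hxC k) fun y hy => (hx k y hy).trans ?_).trans_lt hn
      linarith [Nat.one_div_le_one_div (α := ℝ) hk]
    refine ⟨N, fun k hk => ?_⟩
    linarith [dist_triangle_right (x k) (x N) c, key k hk, key N le_rfl]
  obtain ⟨z, hz⟩ := cauchySeq_tendsto_of_complete hcau
  have hzC : z ∈ C := hC.mem_of_tendsto hz (Eventually.of_forall hxC)
  refine ⟨z, hzC, fun y hy => ?_⟩
  show G q z ≤ G q y
  refine le_of_forall_lt fun a ha => ?_
  obtain ⟨b, hab, hbz⟩ := exists_between ha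
  have hz' : Tendsto x atTop (𝓝[C] z) :=
    tendsto_nhdsWithin_iff.2 ⟨hz, Eventually.of_forall hxC⟩
  have h1 := hz'.eventually (hlsc q z hzC b hbz)
  obtain ⟨N, hN⟩ := exists_nat_one_div_lt (sub_pos.2 hab)
  obtain ⟨k, hkb, hkN⟩ := (h1.and (eventually_ge_atTop N)).exists
  linarith [hx k y hy, Nat.one_div_le_one_div (α := ℝ) hkN]

section

variable {H : Type*} [NormedAddCommGroup H] [InnerProductSpace ℝ H]

/-- The quadratic function on `H × H` with linear part `(q.1, q.2.1)` and leading
coefficient `q.2.2`. -/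
def quadraticPerturbation (q : H × H × ℝ) (z : H × H) : ℝ :=
  inner ℝ q.1 z.1 + inner ℝ q.2.1 z.2 + q.2.2 * (‖z.1‖ ^ 2 + ‖z.2‖ ^ 2)

theorem continuous_quadraticPerturbation (q : H × H × ℝ) :
    Continuous (quadraticPerturbation q) := by
  unfold quadraticPerturbation
  fun_prop

theorem quadraticPerturbation_sub (q q' : H × H × ℝ) (z : H × H) :
    quadraticPerturbation q z - quadraticPerturbation q' z = quadraticPerturbation (q - q') z := by
  simp only [quadraticPerturbation, Prod.fst_sub, Prod.snd_sub, inner_sub_left]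
  ring

theorem abs_quadraticPerturbation_le (q : H × H × ℝ) {z : H × H} (hz : ‖z‖ ≤ 1) :
    |quadraticPerturbation q z| ≤ 4 * ‖q‖ := by
  have h1 : ‖z.1‖ ≤ 1 := (norm_fst_le z).trans hz
  have h2 : ‖z.2‖ ≤ 1 := (norm_snd_le z).trans hz
  have q1 : ‖q.1‖ ≤ ‖q‖ := norm_fst_le q
  have q2 : ‖q.2.1‖ ≤ ‖q‖ := (norm_fst_le q.2).trans (norm_snd_le q)
  have q3 : |q.2.2| ≤ ‖q‖ := (norm_snd_le q.2).trans (norm_snd_le q)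
  have i1 : |inner ℝ q.1 z.1| ≤ ‖q‖ := (abs_real_inner_le_norm _ _).trans
    ((mul_le_of_le_one_right (norm_nonneg _) h1).trans q1)
  have i2 : |inner ℝ q.2.1 z.2| ≤ ‖q‖ := (abs_real_inner_le_norm _ _).trans
    ((mul_le_of_le_one_right (norm_nonneg _) h2).trans q2)
  have i3 : |q.2.2 * (‖z.1‖ ^ 2 + ‖z.2‖ ^ 2)| ≤ ‖q‖ * 2 := by
    rw [abs_mul, abs_of_nonneg (a := ‖z.1‖ ^ 2 + ‖z.2‖ ^ 2) (by positivity)]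
    have s1 := pow_le_one₀ (n := 2) (norm_nonneg z.1) h1
    have s2 := pow_le_one₀ (n := 2) (norm_nonneg z.2) h2
    gcongr
    linarith
  calc _ ≤ |inner ℝ q.1 z.1| + |inner ℝ q.2.1 z.2| + |q.2.2 * (‖z.1‖ ^ 2 + ‖z.2‖ ^ 2)| :=
        abs_add_three _ _ _
    _ ≤ _ := by linarith

theorem exists_small_quadraticPerturbation_isMinOn [CompleteSpace H] {R : ℝ} (hR : 0 < R)
    (hR1 : R ≤ 1) {F : H × H → ℝ} (hF : LowerSemicontinuous F)
    (hbdd : BddBelow (F '' Metric.closedBall 0 R)) {δ : ℝ} (hδ : 0 < δ) :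
    ∃ q : H × H × ℝ, ‖q‖ < δ ∧ ∃ z : H × H, ‖z‖ ≤ R ∧
      ∀ z', ‖z'‖ ≤ R →
        F z + quadraticPerturbation q z ≤ F z' + quadraticPerturbation q z' := by
  have hd := dense_exists_isMinOn (E := H × H × ℝ) (X := H × H)
    (C := Metric.closedBall 0 R) Metric.isClosed_closedBall
    ⟨0, Metric.mem_closedBall_self hR.le⟩ (fun q z => F z + quadraticPerturbation q z)
    (fun q => (hF.add
      (continuous_quadraticPerturbation q).lowerSemicontinuous).lowerSemicontinuousOn _)
    ?_ (B := 4) (by norm_num) ?_ ?_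
  · obtain ⟨q, hq, z, hz, hmin⟩ := Metric.dense_iff.1 hd 0 δ hδ
    refine ⟨q, mem_ball_zero_iff.1 hq, z, mem_closedBall_zero_iff.1 hz, fun z' hz' => ?_⟩
    exact hmin (mem_closedBall_zero_iff.2 hz')
  · intro q
    obtain ⟨b, hb⟩ := hbdd
    refine ⟨b - 4 * ‖q‖, ?_⟩
    rintro _ ⟨z, hz, rfl⟩
    have h1 := hb (Set.mem_image_of_mem F hz)
    have h2 := (abs_le.1
      (abs_quadraticPerturbation_le q ((mem_closedBall_zero_iff.1 hz).trans hR1))).1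
    show _ ≤ F z + quadraticPerturbation q z
    linarith
  · intro q q' z hz
    rw [add_sub_add_left_eq_sub, quadraticPerturbation_sub, dist_eq_norm]
    exact abs_quadraticPerturbation_le _ ((mem_closedBall_zero_iff.1 hz).trans hR1)
  · intro τ hτ
    refine ⟨τ / 3, by positivity, fun q z₀ hz₀ => ?_⟩
    have hz₀' : ‖z₀‖ ≤ 1 := (mem_closedBall_zero_iff.1 hz₀).trans hR1
    refine ⟨q + (τ / 3) • ((-2 : ℝ) • z₀.1, (-2 : ℝ) • z₀.2, 1), ?_, fun z _ => ?_⟩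
    · rw [dist_eq_norm, add_sub_cancel_left, norm_smul, Real.norm_of_nonneg (by positivity)]
      have : ‖((-2 : ℝ) • z₀.1, (-2 : ℝ) • z₀.2, (1 : ℝ))‖ ≤ 2 := by
        refine norm_prod_le_iff.2 ⟨?_, norm_prod_le_iff.2 ⟨?_, by norm_num⟩⟩
        · rw [norm_smul]; norm_num; exact (norm_fst_le z₀).trans hz₀'
        · rw [norm_smul]; norm_num; exact (norm_snd_le z₀).trans hz₀'
      nlinarith
    · have hdist : dist z z₀ ^ 2 ≤ ‖z.1 - z₀.1‖ ^ 2 + ‖z.2 - z₀.2‖ ^ 2 := by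
        rw [Prod.dist_eq, dist_eq_norm, dist_eq_norm]
        rcases max_choice ‖z.1 - z₀.1‖ ‖z.2 - z₀.2‖ with h | h <;> rw [h] <;>
          nlinarith [sq_nonneg ‖z.1 - z₀.1‖, sq_nonneg ‖z.2 - z₀.2‖]
      have hm := mul_le_mul_of_nonneg_left hdist (by positivity : 0 ≤ τ / 3)
      rw [norm_sub_sq_real, norm_sub_sq_real] at hm
      simp only [quadraticPerturbation, Prod.fst_add, Prod.snd_add, Prod.smul_fst, Prod.smul_snd,
        inner_add_left, real_inner_smul_left, smul_eq_mul, real_inner_self_eq_norm_sq]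
      rw [real_inner_comm z₀.1, real_inner_comm z₀.2] at hm
      linarith

theorem hasFDerivAt_norm_sub_sq (c x : H) :
    HasFDerivAt (fun y => ‖y - c‖ ^ 2) ((2 : ℝ) • innerSL ℝ (x - c)) x := by
  refine ((hasFDerivAt_id (𝕜 := ℝ) x).sub_const c).norm_sq.congr_fderiv ?_
  ext y
  simp

theorem contDiff_norm_sub_sq (c : H) : ContDiff ℝ 1 (fun y : H => ‖y - c‖ ^ 2) :=
  (contDiff_id.sub contDiff_const).norm_sq ℝ

theorem mem_subdiffR_of_isLocalMin {f ψ : H → ℝ} {x : H} {ξ : H →L[ℝ] ℝ} (hψ : ContDiff ℝ 1 ψ)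
    (hξ : HasFDerivAt ψ ξ x) (hmin : IsLocalMin (fun y => f y - ψ y) x) : ξ ∈ subdiffR f x :=
  ⟨ψ, hψ, hξ.fderiv, hmin⟩

end

/-- Fuzzy rule for the subdifferential of a sum in a real Hilbert space: if `f₁` is lower
semicontinuous, `f₂` is uniformly continuous and `ζ ∈ D⁻(f₁ + f₂)(p)`, then for every `ε > 0`
there are `pᵢ` near `p` and `ζᵢ ∈ D⁻fᵢ(pᵢ)` with `‖ζ₁ + ζ₂ − ζ‖ < ε` and
`|fᵢ(pᵢ) − fᵢ(p)| < ε`. -/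
theorem subdifferential_fuzzy_sum_rule
    {H : Type*} [NormedAddCommGroup H] [InnerProductSpace ℝ H] [CompleteSpace H]
    (f₁ f₂ : H → ℝ) (h₁ : LowerSemicontinuous f₁) (h₂ : UniformContinuous f₂)
    (p : H) (ζ : H →L[ℝ] ℝ) (hζ : ζ ∈ subdiffR (fun x => f₁ x + f₂ x) p)
    (ε : ℝ) (hε : 0 < ε) :
    ∃ (p₁ p₂ : H) (ζ₁ ζ₂ : H →L[ℝ] ℝ),
      ζ₁ ∈ subdiffR f₁ p₁ ∧ ζ₂ ∈ subdiffR f₂ p₂ ∧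
      ‖p₁ - p‖ < ε ∧ ‖p₂ - p‖ < ε ∧ ‖ζ₁ + ζ₂ - ζ‖ < ε ∧
      |f₁ p₁ - f₁ p| < ε ∧ |f₂ p₂ - f₂ p| < ε := by
  obtain ⟨φ, hφ, rfl, hmin⟩ := hζ
  have hloc : ∀ᶠ x in 𝓝 p, (f₁ p - ε / 2 < f₁ x ∧ |f₂ x - f₂ p| < ε / 4 ∧
      |φ x - φ p| < ε / 4 ∧ ‖fderiv ℝ φ x - fderiv ℝ φ p‖ < ε / 4 ∧
      f₁ p + f₂ p - φ p ≤ f₁ x + f₂ x - φ x) := by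
    have e4 : 0 < ε / 4 := by positivity
    refine (h₁ p _ (by linarith)).and (Eventually.and ?_ (Eventually.and ?_
      (Eventually.and ?_ hmin)))
    · exact Metric.continuousAt_iff'.1 h₂.continuous.continuousAt _ e4
    · exact Metric.continuousAt_iff'.1 hφ.continuous.continuousAt _ e4
    · simpa only [dist_eq_norm] using Metric.continuousAt_iff'.1
        (hφ.continuous_fderiv one_ne_zero).continuousAt _ e4
  obtain ⟨R₀, hR₀, hball⟩ := Metric.eventually_nhds_iff.1 hloc
  obtain ⟨R, hR, hRle⟩ : ∃ R > 0, R ≤ min (R₀ / 2) (min (ε / 2) 1) :=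
    ⟨_, by positivity, le_rfl⟩
  obtain ⟨hRR₀, hRε, hR1⟩ : R ≤ R₀ / 2 ∧ R ≤ ε / 2 ∧ R ≤ 1 := by
    simpa only [le_min_iff] using hRle
  replace hball : ∀ u : H, ‖u‖ ≤ R → f₁ p - ε / 2 < f₁ (p + u) ∧
      |f₂ (p + u) - f₂ p| < ε / 4 ∧ |φ (p + u) - φ p| < ε / 4 ∧
      ‖fderiv ℝ φ (p + u) - fderiv ℝ φ p‖ < ε / 4 ∧
      f₁ p + f₂ p - φ p ≤ f₁ (p + u) + f₂ (p + u) - φ (p + u) := by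
    intro u hu
    refine hball ?_
    rw [dist_eq_norm, add_sub_cancel_left]
    linarith
  obtain ⟨ρ₀, hρ₀, hunif⟩ := Metric.uniformContinuous_iff.1 h₂ (ε / 16 * R ^ 2 / 16) (by positivity)
  obtain ⟨ρ, hρ, hρρ₀, hρR⟩ : ∃ ρ > 0, ρ ≤ ρ₀ ∧ ρ ≤ R / 2 :=
    ⟨min ρ₀ (R / 2), by positivity, min_le_left _ _, min_le_right _ _⟩
  obtain ⟨δ, hδ, hδε, hδR⟩ : ∃ δ > 0, δ ≤ ε / 64 ∧ δ ≤ ε / 16 * R ^ 2 / 64 :=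
    ⟨min (ε / 64) (ε / 16 * R ^ 2 / 64), by positivity, min_le_left _ _, min_le_right _ _⟩
  obtain ⟨n, hn, hnρ⟩ : ∃ n : ℝ, 0 < n ∧ n * ρ ^ 2 = ε :=
    ⟨ε / ρ ^ 2, by positivity, by field_simp⟩
  obtain ⟨q, hq, ⟨u, w⟩, hz, hqmin⟩ := exists_small_quadraticPerturbation_isMinOn hR hR1
    (F := fun z : H × H => f₁ (p + z.1) + (f₂ (p + z.2) - φ (p + z.1) + ε / 16 * ‖z.1‖ ^ 2
      + n * ‖z.1 - z.2‖ ^ 2))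
    ((LowerSemicontinuous.comp h₁ (by fun_prop : Continuous fun z : H × H => p + z.1)).add
      (Continuous.lowerSemicontinuous (by
        have := h₂.continuous
        have := hφ.continuous
        fun_prop)))
    (by
      refine ⟨f₁ p + f₂ p - φ p - ε, ?_⟩
      rintro _ ⟨z, hz, rfl⟩
      have hz := mem_closedBall_zero_iff.1 hz
      obtain ⟨a1, -, a3, -, -⟩ := hball z.1 ((norm_fst_le z).trans hz)
      obtain ⟨-, b2, -, -, -⟩ := hball z.2 ((norm_snd_le z).trans hz)
      have := (abs_lt.1 a3).2
      have := (abs_lt.1 b2).1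
      have : 0 ≤ ε / 16 * ‖z.1‖ ^ 2 := by positivity
      have : 0 ≤ n * ‖z.1 - z.2‖ ^ 2 := by positivity
      dsimp only
      linarith) hδ
  obtain ⟨v, v', s⟩ := q
  have huR : ‖u‖ ≤ R := (norm_fst_le (u, w)).trans hz
  have hwR : ‖w‖ ≤ R := (norm_snd_le (u, w)).trans hz
  have hv : ‖v‖ < δ := (norm_fst_le (v, v', s)).trans_lt hq
  have hv' : ‖v'‖ < δ := ((norm_fst_le (v', s)).trans (norm_snd_le (v, v', s))).trans_lt hq
  have hs : |s| < δ := ((norm_snd_le (v', s)).trans (norm_snd_le (v, v', s))).trans_lt hq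
  obtain ⟨a1, a2, a3, a4, a5⟩ := hball u huR
  obtain ⟨-, b2, -, -, -⟩ := hball w hwR
  have hQ := (abs_le.1 (abs_quadraticPerturbation_le (v, v', s) (hz.trans hR1))).1
  have h0 := hqmin 0 (by simpa using hR.le)
  simp only [quadraticPerturbation, Prod.fst_zero, Prod.snd_zero, add_zero, norm_zero, sub_zero,
    inner_zero_right] at h0 hQ
  norm_num at h0
  have hsq1 : 0 ≤ ε / 16 * ‖u‖ ^ 2 := by positivity
  have hsq2 : 0 ≤ n * ‖u - w‖ ^ 2 := by positivity
  rw [abs_lt] at a2 a3 b2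
  have huw : ‖u - w‖ < ρ := by
    refine lt_of_pow_lt_pow_left₀ 2 hρ.le (lt_of_mul_lt_mul_left ?_ hn.le)
    linarith
  have hf₂ : f₂ (p + u) - f₂ (p + w) < ε / 16 * R ^ 2 / 16 := by
    refine (abs_lt.1 (hunif (a := p + u) (b := p + w) ?_)).2
    rw [dist_eq_norm, add_sub_add_left_eq_sub]
    linarith
  have hu : ‖u‖ < R / 2 := by
    refine lt_of_pow_lt_pow_left₀ 2 (by positivity)
      (lt_of_mul_lt_mul_left ?_ (by positivity : 0 ≤ ε / 16))
    have : 0 < ε / 16 * R ^ 2 := by positivity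
    linarith
  have hw : ‖w‖ < R := by
    have := norm_sub_norm_le w u
    rw [norm_sub_rev] at this
    linarith
  have near : ∀ a : H, ‖a‖ < R → ∀ᶠ x in 𝓝 (p + a), ‖x - p‖ ≤ R := by
    intro a ha
    have : Tendsto (fun x => ‖x - p‖) (𝓝 (p + a)) (𝓝 ‖p + a - p‖) :=
      Continuous.tendsto (by fun_prop) _
    rw [add_sub_cancel_left] at this
    exact this.eventually_le_const ha
  refine ⟨p + u, p + w,
    fderiv ℝ φ (p + u) - ((ε / 16 + s) • ((2 : ℝ) • innerSL ℝ (p + u - p))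
      + n • ((2 : ℝ) • innerSL ℝ (p + u - (p + w))) + innerSL ℝ v),
    -(n • ((2 : ℝ) • innerSL ℝ (p + w - (p + u))) + s • ((2 : ℝ) • innerSL ℝ (p + w - p))
      + innerSL ℝ v'), ?_, ?_, ?_, ?_, ?_, ?_, ?_⟩
  · refine mem_subdiffR_of_isLocalMin (ψ := fun x => φ x - ((ε / 16 + s) * ‖x - p‖ ^ 2
      + n * ‖x - (p + w)‖ ^ 2 + innerSL ℝ v x)) ?_ ?_ ?_
    · exact hφ.sub (((contDiff_const.mul (contDiff_norm_sub_sq p)).add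
        (contDiff_const.mul (contDiff_norm_sub_sq _))).add (innerSL ℝ v).contDiff)
    · exact (hφ.differentiable one_ne_zero _).hasFDerivAt.sub
        ((((hasFDerivAt_norm_sub_sq p _).const_mul _).add
          ((hasFDerivAt_norm_sub_sq _ _).const_mul _)).add (innerSL ℝ v).hasFDerivAt)
    · filter_upwards [near u (by linarith)] with x hx
      have h := hqmin (x - p, w) (norm_prod_le_iff.2 ⟨hx, hwR⟩)
      simp only [quadraticPerturbation, add_sub_cancel, inner_sub_right] at h
      simp only [innerSL_apply_apply, add_sub_cancel_left, add_sub_add_left_eq_sub,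
        inner_add_right, ← sub_sub x p w]
      linarith
  · refine mem_subdiffR_of_isLocalMin (ψ := fun x => -(n * ‖x - (p + u)‖ ^ 2 + s * ‖x - p‖ ^ 2
      + innerSL ℝ v' x)) ?_ ?_ ?_
    · exact (((contDiff_const.mul (contDiff_norm_sub_sq _)).add
        (contDiff_const.mul (contDiff_norm_sub_sq _))).add (innerSL ℝ v').contDiff).neg
    · exact ((((hasFDerivAt_norm_sub_sq _ _).const_mul _).add
          ((hasFDerivAt_norm_sub_sq _ _).const_mul _)).add (innerSL ℝ v').hasFDerivAt).neg
    · filter_upwards [near w hw] with x hx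
      have h := hqmin (u, x - p) (norm_prod_le_iff.2 ⟨huR, hx⟩)
      simp only [quadraticPerturbation, add_sub_cancel, inner_sub_right] at h
      simp only [innerSL_apply_apply, add_sub_cancel_left, add_sub_add_left_eq_sub,
        inner_add_right, ← sub_sub x p u]
      rw [norm_sub_rev u w, norm_sub_rev u (x - p)] at h
      linarith
  · rw [add_sub_cancel_left]; linarith
  · rw [add_sub_cancel_left]; linarith
  · have heq : fderiv ℝ φ (p + u) - ((ε / 16 + s) • ((2 : ℝ) • innerSL ℝ (p + u - p))
        + n • ((2 : ℝ) • innerSL ℝ (p + u - (p + w))) + innerSL ℝ v)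
        + -(n • ((2 : ℝ) • innerSL ℝ (p + w - (p + u))) + s • ((2 : ℝ) • innerSL ℝ (p + w - p))
          + innerSL ℝ v') - fderiv ℝ φ p
        = (fderiv ℝ φ (p + u) - fderiv ℝ φ p)
          - innerSL ℝ ((2 * (ε / 16 + s)) • u + (2 * s) • w + v + v') := by
      ext y
      simp
      ring
    rw [heq]
    have e1 : ‖(2 * (ε / 16 + s)) • u‖ ≤ 2 * (ε / 16 + δ) := by
      rw [norm_smul, Real.norm_eq_abs]
      refine (mul_le_of_le_one_right (abs_nonneg _) (huR.trans hR1)).trans (abs_le.2 ?_)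
      constructor <;> linarith [(abs_lt.1 hs).1, (abs_lt.1 hs).2]
    have e2 : ‖(2 * s) • w‖ ≤ 2 * δ := by
      rw [norm_smul, Real.norm_eq_abs]
      refine (mul_le_of_le_one_right (abs_nonneg _) (hwR.trans hR1)).trans (abs_le.2 ?_)
      constructor <;> linarith [(abs_lt.1 hs).1, (abs_lt.1 hs).2]
    have e3 := norm_add₄_le (a := (2 * (ε / 16 + s)) • u) (b := (2 * s) • w) (c := v) (d := v')
    refine (norm_sub_le _ _).trans_lt ?_
    rw [innerSL_apply_norm]
    linarith
  · rw [abs_lt]; constructor <;> linarith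
  · rw [abs_lt]; constructor <;> linarith
end

section
/- Let H be a real Hilbert space and f : H → ℝ a lower semicontinuous function. Assume there exists a constant K > 0 such that ‖ζ‖ ≤ K for every p ∈ H and every ζ ∈ D⁻f(p). Then |f(p) − f(q)| ≤ K‖p − q‖ for all p, q ∈ H. -/
open Filter Topology

/-- A lower semicontinuous function has `g x ≤ r` at a limit of points `u n` along which `g` is
bounded by a sequence converging to `r`. -/
theorem LowerSemicontinuous.le_of_tendsto_of_le {X : Type*} [TopologicalSpace X] {g : X → ℝ}
    (hg : LowerSemicontinuous g) {u : ℕ → X} {x : X} (hu : Tendsto u atTop (𝓝 x))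
    {b : ℕ → ℝ} {r : ℝ} (hb : Tendsto b atTop (𝓝 r)) (h : ∀ᶠ n in atTop, g (u n) ≤ b n) :
    g x ≤ r := by
  refine le_of_forall_lt fun c hc => ?_
  obtain ⟨c', hc', hc''⟩ := exists_between hc
  have h1 : ∀ᶠ n in atTop, c' < g (u n) := hu.eventually (hg x c' hc'')
  refine hc'.trans_le (ge_of_tendsto hb ?_)
  filter_upwards [h, h1] with n hn hn1
  linarith

/-- A convex combination of squared distances to points of a closed ball is, up to a constant,
the squared distance to another point of the ball. -/
theorem exists_hasSum_geometric_norm_sub_sq {H : Type*} [NormedAddCommGroup H]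
    [InnerProductSpace ℝ H] [CompleteSpace H] (c : H) {R : ℝ} {u : ℕ → H}
    (hu : ∀ n, u n ∈ Metric.closedBall c R) :
    ∃ a ∈ Metric.closedBall c R, ∃ b : ℝ, ∀ x : H,
      HasSum (fun n : ℕ => 1 / 2 / 2 ^ n * ‖x - u n‖ ^ 2) (‖x - a‖ ^ 2 + b) := by
  have hun : ∀ n, ‖u n - c‖ ≤ R := fun n => by simpa [dist_eq_norm] using hu n
  have hbound : ∀ n : ℕ, ‖(1 / 2 / 2 ^ n : ℝ) • (u n - c)‖ ≤ R / 2 / 2 ^ n := fun n => by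
    rw [norm_smul, Real.norm_of_nonneg (by positivity)]
    calc (1 / 2 / 2 ^ n : ℝ) * ‖u n - c‖ ≤ 1 / 2 / 2 ^ n * R := by gcongr; exact hun n
      _ = R / 2 / 2 ^ n := by ring
  have hvs : Summable fun n : ℕ => (1 / 2 / 2 ^ n : ℝ) • (u n - c) :=
    Summable.of_norm_bounded (summable_geometric_two' R) hbound
  have hsq : Summable fun n : ℕ => (1 / 2 / 2 ^ n : ℝ) * ‖u n - c‖ ^ 2 := by
    refine Summable.of_norm_bounded (summable_geometric_two' (R ^ 2)) fun n => ?_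
    rw [Real.norm_of_nonneg (by positivity)]
    calc (1 / 2 / 2 ^ n : ℝ) * ‖u n - c‖ ^ 2 ≤ 1 / 2 / 2 ^ n * R ^ 2 := by gcongr; exact hun n
      _ = R ^ 2 / 2 / 2 ^ n := by ring
  obtain ⟨v, hv⟩ := hvs
  obtain ⟨b, hb⟩ := hsq
  have hvR : ‖v‖ ≤ R := hv.norm_le_of_bounded (hasSum_geometric_two' R) hbound
  refine ⟨c + v, by simpa [dist_eq_norm] using hvR, b - ‖v‖ ^ 2, fun x => ?_⟩
  have h1 := (hasSum_geometric_two' (‖x - c‖ ^ 2)).sub ((hv.mapL (innerSL ℝ (x - c))).mul_left 2)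
  convert! h1.add hb using 1
  · ext n
    rw [show x - u n = (x - c) - (u n - c) by abel, norm_sub_sq_real]
    simp only [innerSL_apply_apply, inner_smul_right]
    ring
  · rw [show x - (c + v) = (x - c) - v by abel, norm_sub_sq_real]
    simp only [innerSL_apply_apply]
    ring

/-- A smooth variational principle of Borwein–Preiss type: on a closed ball of a Hilbert space, a
lower semicontinuous function which is bounded below attains its minimum after adding a small
multiple of the squared distance to a suitable point of the ball. -/
theorem LowerSemicontinuous.exists_isMinOn_add_norm_sub_sq {H : Type*} [NormedAddCommGroup H]
    [InnerProductSpace ℝ H] [CompleteSpace H] {g : H → ℝ} (hg : LowerSemicontinuous g) (c : H)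
    {R : ℝ} (hR : 0 ≤ R) {m : ℝ} (hm : ∀ x ∈ Metric.closedBall c R, m ≤ g x)
    {δ : ℝ} (hδ : 0 < δ) :
    ∃ x ∈ Metric.closedBall c R, ∃ a ∈ Metric.closedBall c R,
      IsMinOn (fun y => g y + δ * ‖y - a‖ ^ 2) (Metric.closedBall c R) x := by
  set A := Metric.closedBall c R with hA
  have hcA : c ∈ A := Metric.mem_closedBall_self hR
  have hpick : ∀ (G : H → ℝ) (ε : ℝ), ∃ x ∈ A, 0 < ε → (∀ y ∈ A, m ≤ G y) →
      ∀ y ∈ A, G x ≤ G y + ε := by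
    intro G ε
    by_cases h : 0 < ε ∧ ∀ y ∈ A, m ≤ G y
    · have hbdd : BddBelow (G '' A) := ⟨m, by rintro _ ⟨y, hy, rfl⟩; exact h.2 y hy⟩
      obtain ⟨_, ⟨x, hx, rfl⟩, hlt⟩ :=
        Real.lt_sInf_add_pos (Set.Nonempty.image G ⟨c, hcA⟩) h.1
      refine ⟨x, hx, fun _ _ y hy => ?_⟩
      linarith [csInf_le hbdd ⟨y, hy, rfl⟩]
    · exact ⟨c, hcA, fun h1 h2 => absurd ⟨h1, h2⟩ h⟩
  choose pick hpickA hpick using hpick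
  let G : ℕ → H → ℝ := fun n => Nat.rec g
    (fun n F x => F x + δ * (1 / 2 / 2 ^ n * ‖x - pick F (δ / 4 / 8 ^ n)‖ ^ 2)) n
  let u : ℕ → H := fun n => pick (G n) (δ / 4 / 8 ^ n)
  have hG : ∀ n x, G (n + 1) x = G n x + δ * (1 / 2 / 2 ^ n * ‖x - u n‖ ^ 2) :=
    fun n x => rfl
  have huA : ∀ n, u n ∈ A := fun n => hpickA _ _
  have hGsum : ∀ n x, G n x = g x + δ * ∑ k ∈ Finset.range n, 1 / 2 / 2 ^ k * ‖x - u k‖ ^ 2 := by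
    intro n x
    induction n with
    | zero => simp [G]
    | succ n ih => rw [hG, ih, Finset.sum_range_succ]; ring
  have hGmono : ∀ x, Monotone fun n => G n x := fun x =>
    monotone_nat_of_le_succ fun n => by
      rw [hG]
      have : 0 ≤ δ * (1 / 2 / 2 ^ n * ‖x - u n‖ ^ 2) := by positivity
      linarith
  have hmin : ∀ n, ∀ y ∈ A, G n (u n) ≤ G n y + δ / 4 / 8 ^ n := fun n =>
    hpick (G n) _ (by positivity) fun y hy => (hm y hy).trans (hGmono y (Nat.zero_le n))
  have hdist : ∀ n, dist (u n) (u (n + 1)) ≤ 2 / 2 / 2 ^ n := by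
    intro n
    have h1 := hmin (n + 1) (u n) (huA n)
    have h2 := hmin n (u (n + 1)) (huA (n + 1))
    rw [hG, hG, sub_self, norm_zero] at h1
    have h3 : δ / 4 / 8 ^ (n + 1) ≤ δ / 4 / 8 ^ n := by
      gcongr
      · norm_num
      · omega
    have h4 : δ * (1 / 2 / 2 ^ n * ‖u (n + 1) - u n‖ ^ 2) ≤ 2 * (δ / 4 / 8 ^ n) := by
      norm_num at h1
      linarith
    have h5 : 2 * (δ / 4 / 8 ^ n) = δ * (1 / 2 / 2 ^ n * (1 / 2 ^ n) ^ 2) := by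
      rw [show (8 : ℝ) = 2 * 2 * 2 by norm_num, mul_pow, mul_pow]
      field_simp
      norm_num
    rw [h5] at h4
    have h6 := le_of_mul_le_mul_left (le_of_mul_le_mul_left h4 hδ) (by positivity)
    rw [dist_comm, dist_eq_norm, show (2 / 2 : ℝ) = 1 by norm_num]
    exact (sq_le_sq₀ (norm_nonneg _) (by positivity)).1 h6
  obtain ⟨x, hx⟩ := cauchySeq_tendsto_of_complete (cauchySeq_of_le_geometric_two hdist)
  have hxA : x ∈ A := Metric.isClosed_closedBall.mem_of_tendsto hx (Eventually.of_forall huA)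
  obtain ⟨a, haA, b, hab⟩ := exists_hasSum_geometric_norm_sub_sq c huA
  have hlim : ∀ y, Tendsto (fun n => G n y) atTop (𝓝 (g y + δ * (‖y - a‖ ^ 2 + b))) := by
    intro y
    simp only [hGsum]
    exact ((hab y).tendsto_sum_nat.const_mul δ).const_add _
  refine ⟨x, hxA, a, haA, fun y hy => ?_⟩
  have hε : Tendsto (fun n : ℕ => δ / 4 / 8 ^ n) atTop (𝓝 0) :=
    tendsto_const_nhds.div_atTop (tendsto_pow_atTop_atTop_of_one_lt (by norm_num))
  have hle : ∀ k, G k x ≤ g y + δ * (‖y - a‖ ^ 2 + b) := by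
    intro k
    have hcont : Continuous fun z : H =>
        δ * ∑ i ∈ Finset.range k, 1 / 2 / 2 ^ i * ‖z - u i‖ ^ 2 := by fun_prop
    have := hg.le_of_tendsto_of_le hx
      (((hlim y).add hε).sub ((hcont.tendsto x).comp hx)) ?_
    · rw [hGsum]
      linarith
    · filter_upwards [eventually_ge_atTop k] with n hn
      have h1 := hmin n y hy
      have h2 := hGmono (u n) hn
      simp only at h2
      rw [hGsum k] at h2
      simp only [Function.comp]
      linarith
  have := le_of_tendsto' (hlim x) hle
  show g x + δ * ‖x - a‖ ^ 2 ≤ g y + δ * ‖y - a‖ ^ 2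
  linarith

/-- At a point `x ≠ c` where `f + L ‖· - c‖ + M (‖· - c‖ / R) ^ (2 n) + δ ‖· - a‖ ^ 2` has a local
minimum, a bound on the subgradients of `f` bounds `L`. -/
theorem le_add_of_isLocalMin_of_subdiffR_bound {H : Type*} [NormedAddCommGroup H]
    [InnerProductSpace ℝ H] {f : H → ℝ} {K : ℝ} {c x a : H}
    (hb : ∀ ζ ∈ subdiffR f x, ‖ζ‖ ≤ K) (hxc : x ≠ c) {L M R δ : ℝ} (hL : 0 ≤ L) (hM : 0 ≤ M)
    (hδ : 0 ≤ δ) (n : ℕ)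
    (hmin : IsLocalMin
      (fun y => f y + L * ‖y - c‖ + M * (‖y - c‖ ^ 2 / R ^ 2) ^ n + δ * ‖y - a‖ ^ 2) x) :
    L ≤ K + 2 * δ * ‖x - a‖ := by
  set d := ‖x - c‖ with hd
  have hd0 : 0 < d := norm_pos_iff.2 (sub_ne_zero.2 hxc)
  let φ : H → ℝ := fun y => -(L * ((‖y - c‖ ^ 2 + d ^ 2) / (2 * d)) +
    M * (‖y - c‖ ^ 2 / R ^ 2) ^ n + δ * ‖y - a‖ ^ 2)
  have hφ : ContDiff ℝ 1 φ := by
    have h1 : ∀ z : H, ContDiff ℝ 1 fun y : H => ‖y - z‖ ^ 2 := fun z =>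
      (contDiff_id.sub contDiff_const).norm_sq ℝ
    exact (((contDiff_const.mul (((h1 c).add contDiff_const).div_const _)).add
      (contDiff_const.mul (((h1 c).div_const _).pow n))).add (contDiff_const.mul (h1 a))).neg
  have hloc : IsLocalMin (fun y => f y - φ y) x := by
    filter_upwards [hmin] with y hy
    have h1 : ‖y - c‖ ≤ (‖y - c‖ ^ 2 + d ^ 2) / (2 * d) := by
      rw [le_div_iff₀ (by positivity)]
      nlinarith [sq_nonneg (‖y - c‖ - d)]
    have h2 : (d ^ 2 + d ^ 2) / (2 * d) = d := by field_simp; ring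
    have h3 := mul_le_mul_of_nonneg_left h1 hL
    simp only [φ, ← hd, h2] at hy ⊢
    linarith
  have hnorm := hb _ ⟨φ, hφ, rfl, hloc⟩
  have hsq : ∀ z : H, HasFDerivAt (fun y : H => ‖y - z‖ ^ 2)
      (2 • (innerSL ℝ (x - z)).comp (ContinuousLinearMap.id ℝ H)) x := fun z =>
    ((hasFDerivAt_id x).sub_const z).norm_sq
  have hder := ((((((hsq c).add_const (d ^ 2)).mul_const (2 * d)⁻¹).const_mul L).add
    ((((hsq c).mul_const (R ^ 2)⁻¹).pow n).const_mul M)).add ((hsq a).const_mul δ)).neg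
  have hval : fderiv ℝ φ x (x - c) = -(L * d + M * (n * (d ^ 2 / R ^ 2) ^ (n - 1) *
      (2 * d ^ 2 / R ^ 2)) + 2 * δ * inner ℝ (x - a) (x - c)) := by
    have : fderiv ℝ φ x = _ := HasFDerivAt.fderiv (f := φ) hder
    rw [this]
    simp only [neg_apply, add_apply, smul_apply, ContinuousLinearMap.comp_apply,
      ContinuousLinearMap.id_apply, innerSL_apply_apply, real_inner_self_eq_norm_sq, smul_eq_mul,
      nsmul_eq_mul, ← hd]
    field_simp
    push_cast
    ring
  have hop := (fderiv ℝ φ x).le_opNorm (x - c)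
  rw [hval, Real.norm_eq_abs, abs_neg, ← hd] at hop
  have h1 := (le_abs_self _).trans (hop.trans (mul_le_mul_of_nonneg_right hnorm hd0.le))
  have h2 : 0 ≤ M * (n * (d ^ 2 / R ^ 2) ^ (n - 1) * (2 * d ^ 2 / R ^ 2)) := by positivity
  have h3 : -(‖x - a‖ * d) ≤ inner ℝ (x - a) (x - c) :=
    (abs_le.1 (abs_real_inner_le_norm _ _)).1
  have h4 := mul_le_mul_of_nonneg_left h3 (by positivity : 0 ≤ 2 * δ)
  refine le_of_mul_le_mul_right ?_ hd0
  linarith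

/-- Deville's inequality on a ball on which `f` is bounded below. -/
theorem sub_le_of_subdiffR_bound_of_le {H : Type*} [NormedAddCommGroup H] [InnerProductSpace ℝ H]
    [CompleteSpace H] {f : H → ℝ} (hf : LowerSemicontinuous f) {K : ℝ} (hK : 0 ≤ K)
    (hb : ∀ p : H, ∀ ζ ∈ subdiffR f p, ‖ζ‖ ≤ K) {c : H} {R m : ℝ}
    (hm : ∀ x ∈ Metric.closedBall c R, m ≤ f x) {y : H} (hy : y ∈ Metric.ball c R) :
    f c - f y ≤ K * ‖c - y‖ := by
  have hR : 0 < R := Metric.pos_of_mem_ball hy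
  have hyR : ‖y - c‖ < R := by simpa [dist_eq_norm] using hy
  by_contra! hlt
  rw [norm_sub_rev] at hlt
  obtain ⟨η, hη, hηR⟩ : ∃ η > 0, η * R < f c - f y - K * ‖y - c‖ :=
    ⟨(f c - f y - K * ‖y - c‖) / (2 * R), div_pos (by linarith) (by positivity), by
      field_simp; linarith⟩
  set L := K + η with hL
  set γ := f c - f y - L * ‖y - c‖ with hγ
  have hγ0 : 0 < γ := by
    have : η * ‖y - c‖ ≤ η * R := by gcongr
    rw [hγ, hL]
    linarith
  set M := f c - m + 1 with hM
  have hmc : m ≤ f c := hm c (Metric.mem_closedBall_self hR.le)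
  have hM0 : 0 < M := by linarith
  have hρ : ‖y - c‖ ^ 2 / R ^ 2 < 1 := by
    rw [div_lt_one (by positivity)]
    gcongr
  obtain ⟨n, hn⟩ : ∃ n : ℕ, (‖y - c‖ ^ 2 / R ^ 2) ^ (n + 1) < γ / 2 / M := by
    obtain ⟨n, hn⟩ := exists_pow_lt_of_lt_one (show 0 < γ / 2 / M by positivity) hρ
    exact ⟨n, (pow_le_pow_of_le_one (by positivity) hρ.le n.le_succ).trans_lt hn⟩
  rw [lt_div_iff₀' hM0] at hn
  obtain ⟨δ, hδ, hδγ, hδη⟩ : ∃ δ > 0, δ * (2 * R) ^ 2 ≤ γ / 2 ∧ 2 * δ * (2 * R) < η := by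
    refine ⟨min (γ / 2 / (2 * R) ^ 2) (η / (8 * R)), by positivity, ?_, ?_⟩
    · rw [← le_div_iff₀ (by positivity)]
      exact min_le_left _ _
    · have := min_le_right (γ / 2 / (2 * R) ^ 2) (η / (8 * R))
      rw [le_div_iff₀ (by positivity)] at this
      linarith
  let g : H → ℝ := fun x => f x + (L * ‖x - c‖ + M * (‖x - c‖ ^ 2 / R ^ 2) ^ (n + 1))
  have hg : LowerSemicontinuous g :=
    hf.add (Continuous.lowerSemicontinuous (by fun_prop))
  have hL0 : 0 ≤ L := by positivity
  have hgf : ∀ x, f x ≤ g x := fun x => le_add_of_nonneg_right (by positivity)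
  obtain ⟨x, hx, a, ha, hmin⟩ := hg.exists_isMinOn_add_norm_sub_sq c hR.le
    (fun x hx => (hm x hx).trans (hgf x)) hδ
  have hdiam : ∀ z ∈ Metric.closedBall c R, ‖z - a‖ ≤ 2 * R := fun z hz => by
    rw [← dist_eq_norm]
    linarith [dist_triangle_right z a c, Metric.mem_closedBall.1 hz, Metric.mem_closedBall.1 ha]
  have hyA := Metric.ball_subset_closedBall hy
  have hgx : g x < f c := by
    have h1 : g x + δ * ‖x - a‖ ^ 2 ≤ g y + δ * ‖y - a‖ ^ 2 := hmin hyA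
    have h2 : δ * ‖y - a‖ ^ 2 ≤ δ * (2 * R) ^ 2 := by
      gcongr
      exact hdiam y hyA
    have h3 : 0 ≤ δ * ‖x - a‖ ^ 2 := by positivity
    have h4 : g y = f y + (L * ‖y - c‖ + M * (‖y - c‖ ^ 2 / R ^ 2) ^ (n + 1)) := rfl
    linarith
  have hxc : x ≠ c := by
    rintro rfl
    simp [g] at hgx
  have hxR : x ∈ Metric.ball c R := by
    refine lt_of_le_of_ne (Metric.mem_closedBall.1 hx) fun h => ?_
    have h1 : ‖x - c‖ = R := by rw [← dist_eq_norm, h]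
    have h2 : g x = f x + (L * R + M) := by
      simp only [g, h1]
      rw [div_self (by positivity), one_pow, mul_one]
    have h3 : 0 ≤ L * R := by positivity
    linarith [hm x hx]
  have hloc := hmin.isLocalMin
    (mem_of_superset (Metric.isOpen_ball.mem_nhds hxR) Metric.ball_subset_closedBall)
  have hle := le_add_of_isLocalMin_of_subdiffR_bound (hb x) hxc hL0 hM0.le hδ.le (n + 1)
    (a := a) (R := R) (by simpa only [g, add_assoc] using hloc)
  have : 2 * δ * ‖x - a‖ ≤ 2 * δ * (2 * R) := by
    gcongr
    exact hdiam x hx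
  linarith

/-- A lower semicontinuous function with subgradients bounded by `K` is locally `K`-Lipschitz. -/
theorem eventually_sub_le_of_subdiffR_bound {H : Type*} [NormedAddCommGroup H]
    [InnerProductSpace ℝ H] [CompleteSpace H] {f : H → ℝ} (hf : LowerSemicontinuous f) {K : ℝ}
    (hK : 0 ≤ K) (hb : ∀ p : H, ∀ ζ ∈ subdiffR f p, ‖ζ‖ ≤ K) (p : H) :
    ∀ᶠ x in 𝓝 p, |f x - f p| ≤ K * ‖x - p‖ := by
  obtain ⟨r, hr, hball⟩ := Metric.eventually_nhds_iff_ball.1 (hf p (f p - 1) (by linarith))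
  filter_upwards [Metric.ball_mem_nhds p (show 0 < r / 3 by positivity)] with x hx
  have hbound : ∀ z ∈ Metric.ball p (r / 3), ∀ y ∈ Metric.closedBall z (2 * r / 3 : ℝ),
      f p - 1 ≤ f y := fun z hz y hy => by
    refine (hball y ?_).le
    rw [Metric.mem_ball] at hz ⊢
    linarith [dist_triangle y z p, Metric.mem_closedBall.1 hy]
  rw [Metric.mem_ball] at hx
  have h1 := sub_le_of_subdiffR_bound_of_le hf hK hb (hbound x hx) (y := p)
    (by rw [Metric.mem_ball, dist_comm]; linarith)
  have h2 := sub_le_of_subdiffR_bound_of_le hf hK hb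
    (hbound p (Metric.mem_ball_self (by positivity))) (y := x)
    (by rw [Metric.mem_ball]; linarith)
  rw [norm_sub_rev] at h2
  exact abs_le.2 ⟨by linarith, h1⟩

/-- A function on a real normed space satisfying a Lipschitz estimate at each point, with a fixed
constant, satisfies it globally. -/
theorem sub_le_of_eventually_abs_sub_le {E : Type*} [NormedAddCommGroup E] [NormedSpace ℝ E]
    {f : E → ℝ} {K : ℝ} (h : ∀ p, ∀ᶠ x in 𝓝 p, |f x - f p| ≤ K * ‖x - p‖) (p q : E) :
    f p - f q ≤ K * ‖p - q‖ := by
  have hcont : Continuous f := continuous_iff_continuousAt.2 fun x => by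
    rw [ContinuousAt, tendsto_iff_dist_tendsto_zero]
    refine squeeze_zero' (Eventually.of_forall fun _ => dist_nonneg) (h x) ?_
    have : Continuous fun y => K * ‖y - x‖ := by fun_prop
    simpa using this.tendsto x
  let γ : ℝ → E := fun t => q + t • (p - q)
  have hγ : Continuous γ := by fun_prop
  have key := image_le_of_liminf_slope_right_le_deriv_boundary (f := f ∘ γ) (a := 0) (b := 1)
    (hcont.comp hγ).continuousOn (B := fun t => f q + t * (K * ‖p - q‖))
    (B' := fun _ => K * ‖p - q‖) (by simp [γ]) (by fun_prop)
    (fun x _ => by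
      simpa using (((hasDerivAt_id x).mul_const (K * ‖p - q‖)).const_add (f q)).hasDerivWithinAt)
    (fun x _ r hr => by
      refine Eventually.frequently ?_
      filter_upwards [self_mem_nhdsWithin,
        nhdsWithin_le_nhds (hγ.continuousAt.eventually (h (γ x)))] with z hz hz'
      have hzx : 0 < z - x := sub_pos.2 hz
      have hn : γ z - γ x = (z - x) • (p - q) := by simp only [γ]; module
      rw [hn, norm_smul, Real.norm_of_nonneg hzx.le] at hz'
      refine lt_of_le_of_lt ?_ hr
      rw [slope_def_field, div_le_iff₀ hzx]
      simp only [Function.comp]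
      linarith [le_abs_self (f (γ z) - f (γ x))])
    (Set.right_mem_Icc.2 zero_le_one)
  simp only [Function.comp, γ, one_smul, one_mul, add_sub_cancel] at key
  linarith

/-- Deville's mean value inequality in a real Hilbert space: if `f` is lower semicontinuous
and all its viscosity subgradients have norm at most `K`, then `f` is `K`-Lipschitz. -/
theorem deville_mean_value_inequality
    {H : Type*} [NormedAddCommGroup H] [InnerProductSpace ℝ H] [CompleteSpace H]
    (f : H → ℝ) (hlsc : LowerSemicontinuous f)
    (K : ℝ) (hK : 0 < K) (hb : ∀ p : H, ∀ ζ ∈ subdiffR f p, ‖ζ‖ ≤ K) :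
    ∀ p q : H, |f p - f q| ≤ K * ‖p - q‖ := by
  intro p q
  have h := sub_le_of_eventually_abs_sub_le
    (eventually_sub_le_of_subdiffR_bound hlsc hK.le hb)
  have hqp := h q p
  rw [norm_sub_rev] at hqp
  exact abs_le.2 ⟨by linarith, h p q⟩
end

section
/- Let H be a real Hilbert space and f : H → ℝ a continuous convex function. Then: (1) f is subdifferentiable at every point, i.e. D⁻f(p) ≠ ∅ for every p ∈ H; and (2) the set of points at which f is Fréchet differentiable is dense in H. -/
open Filter Topology

/-- A continuous convex function on a normed space has a subgradient at every point. -/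
theorem ConvexOn.exists_subgradient {E : Type*} [NormedAddCommGroup E] [NormedSpace ℝ E]
    {f : E → ℝ} (hconv : ConvexOn ℝ Set.univ f) (hcont : Continuous f) (p : E) :
    ∃ ζ : E →L[ℝ] ℝ, ∀ y, f p + ζ (y - p) ≤ f y := by
  have hopen : IsOpen {q : E × ℝ | f q.1 < q.2} :=
    isOpen_lt (hcont.comp continuous_fst) continuous_snd
  have hcvx : Convex ℝ {q : E × ℝ | f q.1 < q.2} := by
    simpa using hconv.convex_strict_epigraph
  obtain ⟨F, hF⟩ := geometric_hahn_banach_open_point (x := (p, f p)) hcvx hopen (by simp)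
  have hsplit : ∀ x t, F (x, t) = F (x, 0) + t * F (0, 1) := fun x t => by
    rw [← smul_eq_mul, ← map_smul, ← map_add]
    simp
  have hc : F (0, 1) < 0 := by
    have := hF (p, f p + 1) (by simp)
    rw [hsplit p (f p + 1), hsplit p (f p)] at this
    linarith
  refine ⟨(-(F (0, 1))⁻¹) • F.comp (ContinuousLinearMap.inl ℝ E ℝ), fun y => ?_⟩
  refine le_of_forall_gt_imp_ge_of_dense fun t ht => ?_
  have h := hF (y, t) ht
  rw [hsplit y t, hsplit p (f p)] at h
  have hsub : F (y - p, 0) = F (y, 0) - F (p, 0) := by rw [← map_sub]; simp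
  have key : -(F (0, 1))⁻¹ * F (y - p, 0) ≤ t - f p := by
    rw [hsub, neg_mul, ← div_eq_inv_mul, neg_le, le_div_iff_of_neg hc]
    linarith
  have : f p + -(F (0, 1))⁻¹ * F (y - p, 0) ≤ t := by linarith
  simpa using this

/-- Points near which the symmetric second differences of `f` at some scale `δ` are at most
`ε * δ`. -/
def smallSecondDifferenceSet {E : Type*} [NormedAddCommGroup E] (f : E → ℝ) (ε : ℝ) : Set E :=
  {x | ∃ δ > 0, ∀ᶠ y in 𝓝 x, ∀ h : E, ‖h‖ ≤ δ → f (y + h) + f (y - h) - 2 * f y ≤ ε * δ}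

theorem isOpen_smallSecondDifferenceSet {E : Type*} [NormedAddCommGroup E] (f : E → ℝ) (ε : ℝ) :
    IsOpen (smallSecondDifferenceSet f ε) := by
  refine isOpen_iff_eventually.2 ?_
  rintro x ⟨δ, hδ, hx⟩
  filter_upwards [hx.eventually_nhds] with y hy
  exact ⟨δ, hδ, hy⟩

/-- Near-maximizers of `f - k * ‖· - p‖ ^ 2` on a small ball have small second differences, by
the parallelogram law. -/
theorem dense_smallSecondDifferenceSet {H : Type*} [NormedAddCommGroup H] [InnerProductSpace ℝ H]
    {f : H → ℝ} (hcont : Continuous f) {ε : ℝ} (hε : 0 < ε) :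
    Dense (smallSecondDifferenceSet f ε) := by
  refine Metric.dense_iff.2 fun p R hR => ?_
  obtain ⟨s, hs, hfs⟩ := Metric.continuousAt_iff.1 (hcont.continuousAt (x := p)) 1 one_pos
  obtain ⟨r, hr, hrs, hrR⟩ : ∃ r > 0, r ≤ s ∧ r ≤ R :=
    ⟨min s R, lt_min hs hR, min_le_left _ _, min_le_right _ _⟩
  obtain ⟨k, hk, hkr⟩ : ∃ k : ℝ, 0 < k ∧ k * r ^ 2 = 8 :=
    ⟨8 / r ^ 2, by positivity, by field_simp⟩
  obtain ⟨δ, hδ, hδk, hδr⟩ : ∃ δ > 0, 4 * k * δ ≤ ε ∧ δ ≤ r / 2 := by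
    refine ⟨min (ε / (4 * k)) (r / 2), by positivity, ?_, min_le_right _ _⟩
    rw [mul_comm, ← le_div_iff₀ (by positivity)]
    exact min_le_left _ _
  obtain ⟨η, hη, hη1, hηδ⟩ : ∃ η > 0, η ≤ 1 ∧ η ≤ ε * δ / 4 :=
    ⟨min 1 (ε * δ / 4), by positivity, min_le_left _ _, min_le_right _ _⟩
  have hf1 : ∀ y ∈ Metric.ball p r, f y < f p + 1 := fun y hy => by
    have := hfs ((Metric.mem_ball.1 hy).trans_le hrs)
    rw [Real.dist_eq, abs_lt] at this
    linarith
  let g : H → ℝ := fun y => f y - k * ‖y - p‖ ^ 2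
  have hg : Continuous g := by fun_prop
  have hbdd : BddAbove (g '' Metric.ball p r) := by
    refine ⟨f p + 1, ?_⟩
    rintro _ ⟨y, hy, rfl⟩
    have : 0 ≤ k * ‖y - p‖ ^ 2 := by positivity
    linarith [hf1 y hy]
  have hp : p ∈ Metric.ball p r := Metric.mem_ball_self hr
  obtain ⟨_, ⟨x, hx, rfl⟩, hxS⟩ :=
    exists_lt_of_lt_csSup (Set.Nonempty.image g ⟨p, hp⟩) (sub_lt_self _ hη)
  have hle : ∀ y ∈ Metric.ball p r, g y ≤ sSup (g '' Metric.ball p r) := fun y hy =>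
    le_csSup hbdd ⟨y, hy, rfl⟩
  have hnear : ∀ᶠ y in 𝓝 x, y ∈ Metric.ball p r ∧ sSup (g '' Metric.ball p r) - η < g y :=
    (Metric.isOpen_ball.eventually_mem hx).and (hg.continuousAt.eventually_const_lt hxS)
  refine ⟨x, Metric.ball_subset_ball hrR hx, δ, hδ, ?_⟩
  filter_upwards [hnear] with y ⟨hyr, hyS⟩ h hh
  have hyp : ‖y - p‖ < r / 2 := by
    have h1 := hle p hp
    have h2 := hf1 y hyr
    simp only [g, sub_self, norm_zero] at h1 hyS
    have : k * ‖y - p‖ ^ 2 < k * (r / 2) ^ 2 := by nlinarith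
    exact lt_of_pow_lt_pow_left₀ 2 (by positivity) (lt_of_mul_lt_mul_left this hk.le)
  have hplus := hle (y + h) <| by
    rw [mem_ball_iff_norm, add_sub_right_comm]
    linarith [norm_add_le (y - p) h]
  have hminus := hle (y - h) <| by
    rw [mem_ball_iff_norm, sub_right_comm]
    linarith [norm_sub_le (y - p) h]
  have hpar := parallelogram_law_with_norm ℝ (y - p) h
  simp only [g] at hplus hminus hyS
  rw [add_sub_right_comm] at hplus
  rw [sub_right_comm] at hminus
  have hkh : k * ‖h‖ ^ 2 ≤ ε * δ / 4 := by
    have : ‖h‖ ^ 2 ≤ δ ^ 2 := by gcongr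
    nlinarith
  have hpar' : k * ‖y - p + h‖ ^ 2 + k * ‖y - p - h‖ ^ 2 =
      2 * (k * ‖y - p‖ ^ 2) + 2 * (k * ‖h‖ ^ 2) := by
    linear_combination k * hpar
  linarith

/-- A continuous convex function is Fréchet differentiable wherever its symmetric second
differences are small at arbitrarily fine slopes. -/
theorem ConvexOn.differentiableAt_of_smallSecondDifferenceSet {E : Type*} [NormedAddCommGroup E]
    [NormedSpace ℝ E] {f : E → ℝ} (hconv : ConvexOn ℝ Set.univ f) (hcont : Continuous f) {x : E}
    (hx : ∀ ε > 0, x ∈ smallSecondDifferenceSet f ε) : DifferentiableAt ℝ f x := by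
  obtain ⟨ζ, hζ⟩ := hconv.exists_subgradient hcont x
  refine HasFDerivAt.differentiableAt (f' := ζ) ?_
  rw [hasFDerivAt_iff_isLittleO_nhds_zero, Asymptotics.isLittleO_iff]
  intro ε hε
  obtain ⟨δ, hδ, hev⟩ := hx ε hε
  have hsec := hev.self_of_nhds
  filter_upwards [Metric.ball_mem_nhds (0 : E) hδ] with h hh
  rw [mem_ball_zero_iff] at hh
  have hlow : 0 ≤ f (x + h) - f x - ζ h := by
    have := hζ (x + h)
    rw [add_sub_cancel_left] at this
    linarith
  rw [Real.norm_of_nonneg hlow]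
  rcases eq_or_ne h 0 with rfl | h0
  · simp
  have hn : 0 < ‖h‖ := norm_pos_iff.2 h0
  set t := ‖h‖ / δ
  have ht0 : 0 < t := by positivity
  have ht1 : t ≤ 1 := (div_le_one hδ).2 hh.le
  have htδ : t * δ = ‖h‖ := div_mul_cancel₀ _ hδ.ne'
  have hv := hsec (t⁻¹ • h) <| by
    rw [norm_smul, norm_inv, Real.norm_of_nonneg ht0.le, ← htδ, inv_mul_cancel_left₀ ht0.ne']
  have hneg := hζ (x - t⁻¹ • h)
  have hcv := hconv.2 (Set.mem_univ x) (Set.mem_univ (x + t⁻¹ • h)) (sub_nonneg.2 ht1) ht0.le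
    (sub_add_cancel 1 t)
  rw [show (1 - t) • x + t • (x + t⁻¹ • h) = x + h by
    rw [smul_add, smul_inv_smul₀ ht0.ne', sub_smul, one_smul]; abel] at hcv
  rw [sub_sub_cancel_left, map_neg, map_smul, smul_eq_mul] at hneg
  simp only [smul_eq_mul] at hcv
  have hlin : t * (t⁻¹ * ζ h) = ζ h := mul_inv_cancel_left₀ ht0.ne' _
  have hmul : t * (f (x + t⁻¹ • h) - f x - t⁻¹ * ζ h) ≤ t * (ε * δ) := by
    gcongr
    linarith
  linarith [show t * (ε * δ) = ε * ‖h‖ by rw [← htδ]; ring]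

/-- A continuous convex function on a real Hilbert space is subdifferentiable everywhere and
Fréchet differentiable on a dense set. -/
theorem convex_subdifferentiable_and_densely_differentiable
    {H : Type*} [NormedAddCommGroup H] [InnerProductSpace ℝ H] [CompleteSpace H]
    (f : H → ℝ) (hconv : ConvexOn ℝ Set.univ f) (hcont : Continuous f) :
    (∀ p : H, (subdiffR f p).Nonempty) ∧
    Dense {x : H | DifferentiableAt ℝ f x} := by
  refine ⟨fun p => ?_, ?_⟩
  · obtain ⟨ζ, hζ⟩ := hconv.exists_subgradient hcont p
    refine ⟨ζ, ζ, ζ.contDiff, ζ.fderiv, Eventually.of_forall fun y => ?_⟩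
    have := hζ y
    rw [map_sub] at this
    linarith
  · have hdense : Dense (⋂ n : ℕ, smallSecondDifferenceSet f (1 / ((n : ℝ) + 1))) :=
      dense_iInter_of_isOpen (fun _ => isOpen_smallSecondDifferenceSet f _)
        fun _ => dense_smallSecondDifferenceSet hcont Nat.one_div_pos_of_nat
    refine hdense.mono fun x hx => ?_
    refine hconv.differentiableAt_of_smallSecondDifferenceSet hcont fun ε hε => ?_
    obtain ⟨n, hn⟩ := exists_nat_one_div_lt hε
    obtain ⟨δ, hδ, hev⟩ := Set.mem_iInter.1 hx n
    refine ⟨δ, hδ, hev.mono fun y hy h hh => (hy h hh).trans ?_⟩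
    gcongr
end

section
/- Let H be a real Hilbert space, u : H → ℝ a bounded upper semicontinuous function, and v : H → ℝ a bounded lower semicontinuous function. Then for every ε > 0 there exist points x₀, y₀ ∈ H and functionals ζ ∈ D⁺u(x₀), ξ ∈ D⁻v(y₀) such that: (i) ‖x₀ − y₀‖ < ε; (ii) ‖ζ − ξ‖ < ε; (iii) v(z) − u(z) ≥ v(y₀) − u(x₀) − ε for every z ∈ H. -/
open Filter Topology

/-- The viscosity superdifferential of `f : H → ℝ` at `p`. -/
def superdiffR {H : Type*} [NormedAddCommGroup H] [InnerProductSpace ℝ H]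
    (f : H → ℝ) (p : H) : Set (H →L[ℝ] ℝ) :=
  {ζ | ∃ φ : H → ℝ, ContDiff ℝ 1 φ ∧ fderiv ℝ φ p = ζ ∧
    IsLocalMax (fun x => f x - φ x) p}

/-- A smooth variational principle of Borwein–Preiss type: a lower semicontinuous function that is
bounded below is supported from below, at an almost minimizing point, by a small concave quadratic. -/
theorem exists_quadratic_support {X : Type*} [NormedAddCommGroup X] [InnerProductSpace ℝ X]
    [CompleteSpace X] (F : X → ℝ) (hF : LowerSemicontinuous F) (hb : BddBelow (Set.range F))
    {δ : ℝ} (hδ : 0 < δ) :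
    ∃ z p : X, ‖p‖ ≤ 8 * δ ∧ (∀ x, F z ≤ F x + 2 * δ) ∧
      ∀ x, F z ≤ F x + δ * ‖x - z‖ ^ 2 + inner ℝ p (x - z) := by
  have hpick : ∀ (g : X → ℝ) (n : ℕ), ∃ z, BddBelow (Set.range g) →
      ∀ x, g z ≤ g x + δ / 8 ^ n := by
    intro g n
    by_cases hg : BddBelow (Set.range g)
    · obtain ⟨_, ⟨z, rfl⟩, hz⟩ := Real.lt_sInf_add_pos (Set.range_nonempty g)
        (show 0 < δ / 8 ^ n by positivity)
      exact ⟨z, fun _ x => hz.le.trans (by linarith [csInf_le hg (Set.mem_range_self x)])⟩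
    · exact ⟨0, fun h => absurd h hg⟩
  choose pick hpick using hpick
  let G : ℕ → X → ℝ := fun n => Nat.rec F
    (fun n g x => g x + δ / 2 ^ (n + 1) * ‖x - pick g n‖ ^ 2) n
  set z : ℕ → X := fun n => pick (G n) n with hz
  have hG0 : G 0 = F := rfl
  have hGs : ∀ n x, G (n + 1) x = G n x + δ / 2 ^ (n + 1) * ‖x - z n‖ ^ 2 := fun _ _ => rfl
  have hGmono : ∀ x, Monotone fun n => G n x := fun x => monotone_nat_of_le_succ fun n => by
    rw [hGs]
    exact le_add_of_nonneg_right (by positivity)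
  have hGbdd : ∀ n, BddBelow (Set.range (G n)) := fun n => by
    obtain ⟨c, hc⟩ := hb
    refine ⟨c, ?_⟩
    rintro _ ⟨x, rfl⟩
    exact (hc (Set.mem_range_self x)).trans (hGmono x (Nat.zero_le n))
  have hmin : ∀ n x, G n (z n) ≤ G n x + δ / 8 ^ n := fun n x => hpick (G n) n (hGbdd n) x
  have hGlsc : ∀ n, LowerSemicontinuous (G n) := fun n => by
    induction n with
    | zero => exact hF
    | succ n ih =>
      exact ih.add (Continuous.lowerSemicontinuous (by fun_prop))
  have he : ∀ n : ℕ, δ / 8 ^ (n + 1) = δ / 8 ^ n / 8 := fun n => by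
    rw [pow_succ]; field_simp
  have hepos : ∀ n : ℕ, 0 < δ / 8 ^ n := fun n => by positivity
  have hnext : ∀ n, G (n + 1) (z (n + 1)) ≤ G n (z n) + δ / 8 ^ (n + 1) := fun n => by
    simpa [hGs] using hmin (n + 1) (z n)
  have hanti : Antitone fun n => G n (z n) + δ / 8 ^ n := antitone_nat_of_succ_le fun n => by
    linarith [hnext n, he n, hepos n]
  have hdist : ∀ n, dist (z n) (z (n + 1)) ≤ 4 / 2 / 2 ^ n := fun n => by
    have h1 : δ / 2 ^ (n + 1) * ‖z (n + 1) - z n‖ ^ 2 ≤ 2 * (δ / 8 ^ n) := by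
      linarith [hnext n, hmin n (z (n + 1)), hGs n (z (n + 1)), he n, hepos n]
    have h8 : (8 : ℝ) ^ n = 2 ^ n * (2 ^ n * 2 ^ n) := by
      rw [← mul_pow, ← mul_pow]; norm_num
    have h2 : ‖z (n + 1) - z n‖ ^ 2 ≤ (4 / 2 / 2 ^ n) ^ 2 := by
      have h3 : 2 * (δ / 8 ^ n) = δ / 2 ^ (n + 1) * (4 / 2 / 2 ^ n) ^ 2 := by
        rw [h8, pow_succ]; field_simp; norm_num
      rw [h3] at h1
      exact le_of_mul_le_mul_left h1 (by positivity)
    rw [dist_comm, dist_eq_norm]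
    exact le_of_sq_le_sq h2 (by positivity)
  obtain ⟨w, hw⟩ := cauchySeq_tendsto_of_complete (cauchySeq_of_le_geometric_two hdist)
  have hwdist : ∀ n, ‖w - z n‖ ≤ 4 := fun n => by
    rw [← dist_eq_norm, dist_comm]
    refine (dist_le_of_le_geometric_two_of_tendsto hdist hw n).trans ?_
    exact div_le_self (by norm_num) (one_le_pow₀ (by norm_num))
  have hwmin : ∀ n x, G n w ≤ G n x + 2 * (δ / 8 ^ n) := fun n x => by
    have hev : ∀ᶠ m in atTop, G n (z m) ≤ G n x + 2 * (δ / 8 ^ n) := by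
      filter_upwards [eventually_ge_atTop n] with m hm
      have h1 : G n (z m) ≤ G m (z m) := hGmono _ hm
      have h2 : G m (z m) + δ / 8 ^ m ≤ G n (z n) + δ / 8 ^ n := hanti hm
      linarith [hmin n x, hepos m]
    exact ((hGlsc n).isClosed_preimage _).mem_of_tendsto hw hev
  let q : ℕ → X := fun k => (δ / 2 ^ k) • (w - z k)
  have hqnorm : ∀ k, ‖q k‖ ≤ 8 * δ / 2 / 2 ^ k := fun k => by
    rw [norm_smul, Real.norm_of_nonneg (by positivity)]
    calc δ / 2 ^ k * ‖w - z k‖ ≤ δ / 2 ^ k * 4 := by gcongr; exact hwdist k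
      _ = 8 * δ / 2 / 2 ^ k := by ring
  have hqsum : Summable q := Summable.of_norm_bounded (summable_geometric_two' (8 * δ)) hqnorm
  have hdiff : ∀ n x, G n x - G n w ≤ F x - F w + δ * (1 - 1 / 2 ^ n) * ‖x - w‖ ^ 2
      + inner ℝ (∑ k ∈ Finset.range n, q k) (x - w) := fun n x => by
    induction n with
    | zero => simp [hG0]
    | succ n ih =>
      have h1 : ‖x - z n‖ ^ 2 = ‖x - w‖ ^ 2 + 2 * inner ℝ (w - z n) (x - w) + ‖w - z n‖ ^ 2 := by
        rw [← sub_add_sub_cancel x w (z n), norm_add_sq_real, real_inner_comm]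
      rw [Finset.sum_range_succ, inner_add_left, hGs, hGs, h1, real_inner_smul_left]
      have h2 : δ / 2 ^ (n + 1) * (2 * inner ℝ (w - z n) (x - w))
          = δ / 2 ^ n * inner ℝ (w - z n) (x - w) := by
        rw [pow_succ]; field_simp
      have h3 : δ * (1 - 1 / 2 ^ (n + 1)) = δ * (1 - 1 / 2 ^ n) + δ / 2 ^ (n + 1) := by
        rw [pow_succ]; field_simp; ring
      rw [h3]
      linarith
  refine ⟨w, ∑' k, q k, tsum_of_norm_bounded (hasSum_geometric_two' (8 * δ)) hqnorm,
    fun x => by simpa [hG0] using hwmin 0 x, fun x => ?_⟩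
  have hlim : Tendsto (fun n : ℕ => F x + δ * ‖x - w‖ ^ 2
      + inner ℝ (∑ k ∈ Finset.range n, q k) (x - w) + 2 * (δ / 8 ^ n)) atTop
      (𝓝 (F x + δ * ‖x - w‖ ^ 2 + inner ℝ (∑' k, q k) (x - w) + 2 * 0)) := by
    have h8 : Tendsto (fun n : ℕ => δ / 8 ^ n) atTop (𝓝 0) :=
      tendsto_const_nhds.div_atTop (tendsto_pow_atTop_atTop_of_one_lt (by norm_num))
    exact (tendsto_const_nhds.add (hqsum.hasSum.tendsto_sum_nat.inner tendsto_const_nhds)).add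
      (h8.const_mul 2)
  rw [mul_zero, add_zero] at hlim
  refine ge_of_tendsto' hlim fun n => ?_
  have h1 : δ * (1 - 1 / 2 ^ n) * ‖x - w‖ ^ 2 ≤ δ * ‖x - w‖ ^ 2 := by
    gcongr
    exact mul_le_of_le_one_right hδ.le (sub_le_self _ (by positivity))
  linarith [hdiff n x, hwmin n x]

theorem contDiff_quadratic {H : Type*} [NormedAddCommGroup H] [InnerProductSpace ℝ H]
    (r s : ℝ) (a b p : H) :
    ContDiff ℝ 1 fun x : H => r * ‖x - a‖ ^ 2 + s * ‖x - b‖ ^ 2 + inner ℝ p (x - b) := by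
  have h (c : H) : ContDiff ℝ 1 fun x : H => x - c := contDiff_id.sub contDiff_const
  exact ((contDiff_const.mul ((h a).norm_sq ℝ)).add (contDiff_const.mul ((h b).norm_sq ℝ))).add
    (contDiff_const.inner ℝ (h b))

theorem fderiv_quadratic {H : Type*} [NormedAddCommGroup H] [InnerProductSpace ℝ H]
    (r s : ℝ) (a b p : H) :
    fderiv ℝ (fun x : H => r * ‖x - a‖ ^ 2 + s * ‖x - b‖ ^ 2 + inner ℝ p (x - b)) b
      = innerSL ℝ ((2 * r) • (b - a) + p) := by
  have h (c : H) : HasFDerivAt (fun x : H => x - c) (ContinuousLinearMap.id ℝ H) b :=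
    (hasFDerivAt_id b).sub_const c
  have := (((h a).norm_sq.const_mul r).add ((h b).norm_sq.const_mul s)).add
    ((innerSL ℝ p).hasFDerivAt.comp b (h b))
  refine (HasFDerivAt.congr_fderiv this ?_).fderiv
  ext y
  simp
  ring

/-- Perturbed minimization principle for the difference of two functions in a real Hilbert
space: given `u` bounded usc and `v` bounded lsc, for each `ε > 0` there are `x₀, y₀` and
`ζ ∈ D⁺u(x₀)`, `ξ ∈ D⁻v(y₀)` with `‖x₀ − y₀‖ < ε`, `‖ζ − ξ‖ < ε`, and
`v − u ≥ v(y₀) − u(x₀) − ε` globally. -/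
theorem perturbed_minimization_difference
    {H : Type*} [NormedAddCommGroup H] [InnerProductSpace ℝ H] [CompleteSpace H]
    (u v : H → ℝ)
    (hu : UpperSemicontinuous u) (hub : ∃ C : ℝ, ∀ x, |u x| ≤ C)
    (hv : LowerSemicontinuous v) (hvb : ∃ C : ℝ, ∀ x, |v x| ≤ C)
    (ε : ℝ) (hε : 0 < ε) :
    ∃ (x₀ y₀ : H) (ζ ξ : H →L[ℝ] ℝ),
      ζ ∈ superdiffR u x₀ ∧ ξ ∈ subdiffR v y₀ ∧
      ‖x₀ - y₀‖ < ε ∧ ‖ζ - ξ‖ < ε ∧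
      ∀ z : H, v y₀ - u x₀ - ε ≤ v z - u z := by
  obtain ⟨C, hC⟩ := hub
  obtain ⟨D, hD⟩ := hvb
  have hC0 : 0 ≤ C := (abs_nonneg _).trans (hC 0)
  have hD0 : 0 ≤ D := (abs_nonneg _).trans (hD 0)
  set r : ℝ := (2 * C + 2 * D + ε) / ε ^ 2 with hr
  have hr0 : 0 < r := by positivity
  let F : WithLp 2 (H × H) → ℝ := fun z => v z.snd + -u z.fst + r * ‖z.fst - z.snd‖ ^ 2
  have hfst : Continuous fun z : WithLp 2 (H × H) => z.fst := by fun_prop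
  have hsnd : Continuous fun z : WithLp 2 (H × H) => z.snd := by fun_prop
  have hu' : LowerSemicontinuous fun x => -u x := fun x y hy =>
    (hu x (-y) (by linarith)).mono fun _ h => by linarith
  have hF : LowerSemicontinuous F :=
    ((hv.comp hsnd).add (hu'.comp hfst)).add
      (Continuous.lowerSemicontinuous (by fun_prop))
  have hFb : BddBelow (Set.range F) := by
    refine ⟨-D - C, ?_⟩
    rintro _ ⟨z, rfl⟩
    have h0 : 0 ≤ r * ‖z.fst - z.snd‖ ^ 2 := by positivity
    have h1 := (abs_le.mp (hC z.fst)).2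
    have h2 := (abs_le.mp (hD z.snd)).1
    simp only [F]
    linarith
  obtain ⟨w, p, hp, hwmin, hsupp⟩ :=
    exists_quadratic_support F hF hFb (show 0 < ε / 32 by positivity)
  have hdiag : ∀ z, v w.snd - u w.fst + r * ‖w.fst - w.snd‖ ^ 2 ≤ v z - u z + ε / 16 := fun z => by
    have h : v w.snd + -u w.fst + r * ‖w.fst - w.snd‖ ^ 2 ≤
        v z + -u z + r * ‖z - z‖ ^ 2 + 2 * (ε / 32) := hwmin (WithLp.toLp 2 (z, z))
    rw [sub_self, norm_zero] at h
    linarith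
  have hsupp' : ∀ x y, v w.snd - u w.fst + r * ‖w.fst - w.snd‖ ^ 2 ≤
      v y - u x + r * ‖x - y‖ ^ 2 + ε / 32 * (‖x - w.fst‖ ^ 2 + ‖y - w.snd‖ ^ 2)
      + (inner ℝ p.fst (x - w.fst) + inner ℝ p.snd (y - w.snd)) := fun x y => by
    have := hsupp (WithLp.toLp 2 (x, y))
    rw [WithLp.prod_norm_sq_eq_of_L2, WithLp.prod_inner_apply] at this
    simp only [F, WithLp.sub_fst, WithLp.sub_snd] at this
    simp only [WithLp.ofLp_sub, Prod.fst_sub, Prod.snd_sub] at this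
    linarith!
  refine ⟨w.fst, w.snd, innerSL ℝ ((2 * r) • (w.fst - w.snd) + p.fst),
    -innerSL ℝ ((2 * r) • (w.snd - w.fst) + p.snd), ?_, ?_, ?_, ?_, fun z => ?_⟩
  · refine ⟨_, contDiff_quadratic r (ε / 32) w.snd w.fst p.fst, fderiv_quadratic .., ?_⟩
    refine Eventually.of_forall fun x => ?_
    have := hsupp' x w.snd
    simp only [sub_self, norm_zero, inner_zero_right] at this ⊢
    linarith
  · refine ⟨_, (contDiff_quadratic r (ε / 32) w.fst w.snd p.snd).neg, ?_, ?_⟩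
    · rw [fderiv_fun_neg, fderiv_quadratic]
    · refine Eventually.of_forall fun y => ?_
      have := hsupp' w.fst y
      rw [norm_sub_rev w.fst y, norm_sub_rev w.fst w.snd] at this
      simp only [sub_self, norm_zero, inner_zero_right] at this ⊢
      linarith
  · have h1 := hdiag 0
    have h2 := abs_le.mp (hC w.fst)
    have h3 := abs_le.mp (hD w.snd)
    have h4 := abs_le.mp (hC 0)
    have h5 := abs_le.mp (hD 0)
    have h6 : r * ε ^ 2 = 2 * C + 2 * D + ε := by rw [hr]; field_simp
    have h7 : r * ‖w.fst - w.snd‖ ^ 2 < r * ε ^ 2 := by linarith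
    exact lt_of_pow_lt_pow_left₀ 2 hε.le (lt_of_mul_lt_mul_left h7 hr0.le)
  · have h1 : innerSL ℝ ((2 * r) • (w.fst - w.snd) + p.fst)
        - -innerSL ℝ ((2 * r) • (w.snd - w.fst) + p.snd) = innerSL ℝ (p.fst + p.snd) := by
      rw [sub_neg_eq_add, ← map_add]
      congr 1
      module
    have hp2 : ‖p‖ ^ 2 = ‖p.fst‖ ^ 2 + ‖p.snd‖ ^ 2 := WithLp.prod_norm_sq_eq_of_L2 p
    have h2 : ‖p.fst‖ ≤ ‖p‖ := le_of_sq_le_sq (by rw [hp2]; nlinarith) (norm_nonneg p)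
    have h3 : ‖p.snd‖ ≤ ‖p‖ := le_of_sq_le_sq (by rw [hp2]; nlinarith) (norm_nonneg p)
    rw [h1, innerSL_apply_norm]
    linarith [norm_add_le p.fst p.snd]
  · have : 0 ≤ r * ‖w.fst - w.snd‖ ^ 2 := by positivity
    linarith [hdiag z]
end

section
/- Let H be a real Hilbert space and F : H × H* → ℝ a function which is uniformly continuous in the sense that for every ε > 0 there exists δ > 0 such that ‖x − y‖ ≤ δ and ‖ζ − ξ‖ ≤ δ imply |F(x,ζ) − F(y,ξ)| ≤ ε. Assume there is a constant A > 0 with −A ≤ F(x, 0) ≤ A for every x ∈ H. Then there exists a unique bounded continuous function u : H → ℝ which is a viscosity solution of the equation u + F(x, du) = 0, i.e. u(x) + F(x, ζ) ≤ 0 for every x ∈ H and every ζ ∈ D⁺u(x), and u(x) + F(x, ξ) ≥ 0 for every x ∈ H and every ξ ∈ D⁻u(x). -/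
open Filter Topology

section VariationalPrinciple

variable {E : Type*} [NormedAddCommGroup E] [InnerProductSpace ℝ E]

/-- A weighted sum of squared distances, with weights of total mass one, is up to a constant the
squared distance to the barycentre. -/
theorem exists_const_hasSum_sq_norm_sub {c : ℕ → ℝ} {x : ℕ → E} {a : E}
    (hc : HasSum c 1) (ha : HasSum (fun i => c i • x i) a)
    (hs : Summable fun i => c i * ‖x i‖ ^ 2) :
    ∃ K : ℝ, ∀ y : E, HasSum (fun i => c i * ‖y - x i‖ ^ 2) (‖y - a‖ ^ 2 + K) := by
  obtain ⟨s, hs⟩ := hs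
  refine ⟨s - ‖a‖ ^ 2, fun y => ?_⟩
  have h1 : HasSum (fun i => inner ℝ y (c i • x i)) (inner ℝ y a) := ha.mapL (innerSL ℝ y)
  have h2 : (fun i => c i * ‖y - x i‖ ^ 2) = fun i =>
      c i * ‖y‖ ^ 2 - 2 * inner ℝ y (c i • x i) + c i * ‖x i‖ ^ 2 := by
    funext i
    rw [norm_sub_sq_real, inner_smul_right]
    ring
  have h3 : ‖y - a‖ ^ 2 + (s - ‖a‖ ^ 2) = 1 * ‖y‖ ^ 2 - 2 * inner ℝ y a + s := by
    rw [norm_sub_sq_real]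
    ring
  rw [h2, h3]
  exact ((hc.mul_right (‖y‖ ^ 2)).sub (h1.mul_left 2)).add hs

/-- A smooth variational principle of Borwein–Preiss type: an upper semicontinuous function bounded
above on a closed set attains its maximum there after subtraction of `‖· - a‖ ^ 2`, at a point
close to `a`. -/
theorem exists_max_sub_sq_norm [CompleteSpace E] {f : E → ℝ} {S : Set E} {M δ : ℝ} {z : E}
    (hf : UpperSemicontinuous f) (hS : IsClosed S) (hM : ∀ x ∈ S, f x ≤ M) (hz : z ∈ S)
    (hδ : 0 < δ) :
    ∃ p ∈ S, ∃ a : E, ‖p - a‖ ≤ δ ∧ f z ≤ f p ∧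
      ∀ x ∈ S, f x - ‖x - a‖ ^ 2 ≤ f p - ‖p - a‖ ^ 2 := by
  have hpick : ∀ (g : E → ℝ) (x : E) (η : ℝ), ∃ y, (∀ w ∈ S, g w ≤ M) → x ∈ S → 0 < η →
      y ∈ S ∧ g x ≤ g y ∧ ∀ w ∈ S, g w ≤ g y + η := by
    intro g x η
    by_cases h : (∀ w ∈ S, g w ≤ M) ∧ x ∈ S ∧ 0 < η
    swap
    · exact ⟨x, fun h1 h2 h3 => absurd ⟨h1, h2, h3⟩ h⟩
    obtain ⟨hb, hx, hη⟩ := h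
    have hbdd : BddAbove (g '' S) := ⟨M, by rintro _ ⟨w, hw, rfl⟩; exact hb w hw⟩
    obtain ⟨_, ⟨y, hy, rfl⟩, hlt⟩ :=
      exists_lt_of_lt_csSup (Set.Nonempty.image g ⟨x, hx⟩) (sub_lt_self (sSup (g '' S)) hη)
    have hle : ∀ w ∈ S, g w ≤ g y + η := fun w hw => by
      linarith [le_csSup hbdd (Set.mem_image_of_mem g hw)]
    rcases le_total (g x) (g y) with h | h
    · exact ⟨y, fun _ _ _ => ⟨hy, h, hle⟩⟩
    · exact ⟨x, fun _ _ _ => ⟨hx, le_rfl, fun w hw => (hle w hw).trans (by linarith)⟩⟩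
  choose pick hpick using hpick
  let c : ℕ → ℝ := fun n => 1 / 2 / 2 ^ n
  let η : ℕ → ℝ := fun n => c n * (δ / 2 / 2 ^ n) ^ 2
  have hcpos : ∀ n, 0 < c n := fun n => by positivity
  have hηpos : ∀ n, 0 < η n := fun n => by positivity
  let st : ℕ → (E → ℝ) × E := fun n => Nat.rec (f, pick f z (η 0))
    (fun k s => (fun y => s.1 y - c k * ‖y - s.2‖ ^ 2,
      pick (fun y => s.1 y - c k * ‖y - s.2‖ ^ 2) s.2 (η (k + 1)))) n
  let g : ℕ → E → ℝ := fun n => (st n).1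
  let x : ℕ → E := fun n => (st n).2
  have hg0 : g 0 = f := rfl
  have hgs : ∀ n y, g (n + 1) y = g n y - c n * ‖y - x n‖ ^ 2 := fun n y => rfl
  have hx0 : x 0 = pick (g 0) z (η 0) := rfl
  have hxs : ∀ n, x (n + 1) = pick (g (n + 1)) (x n) (η (n + 1)) := fun n => rfl
  clear_value g x
  have hganti : ∀ y, Antitone fun n => g n y := fun y => antitone_nat_of_succ_le fun n => by
    rw [hgs]
    have := hcpos n
    linarith [show 0 ≤ c n * ‖y - x n‖ ^ 2 by positivity]
  have hgM : ∀ n, ∀ w ∈ S, g n w ≤ M := fun n w hw =>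
    (hganti w (Nat.zero_le n)).trans ((congrFun hg0 w).trans_le (hM w hw))
  have hxS : ∀ n, x n ∈ S := by
    intro n
    induction n with
    | zero => rw [hx0]; exact (hpick _ _ _ (hgM 0) hz (hηpos 0)).1
    | succ n ih => rw [hxs]; exact (hpick _ _ _ (hgM _) ih (hηpos _)).1
  have hnear : ∀ n, ∀ w ∈ S, g n w ≤ g n (x n) + η n := by
    intro n
    cases n with
    | zero => rw [hx0]; exact (hpick _ _ _ (hgM 0) hz (hηpos 0)).2.2
    | succ n => rw [hxs]; exact (hpick _ _ _ (hgM _) (hxS n) (hηpos _)).2.2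
  have hz0 : f z ≤ g 0 (x 0) := by
    rw [hx0, ← hg0]; exact (hpick _ _ _ (hgM 0) hz (hηpos 0)).2.1
  have hstep : ∀ n, g n (x n) ≤ g (n + 1) (x (n + 1)) := by
    intro n
    have h := (hpick _ _ _ (hgM (n + 1)) (hxS n) (hηpos (n + 1))).2.1
    rw [← hxs, hgs n (x n)] at h
    simpa using h
  have hmono : Monotone fun n => g n (x n) := monotone_nat_of_le_succ hstep
  have hdist : ∀ n, dist (x n) (x (n + 1)) ≤ δ / 2 / 2 ^ n := by
    intro n
    have h1 := hstep n
    have h2 := hnear n (x (n + 1)) (hxS _)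
    rw [hgs] at h1
    have h3 : c n * ‖x (n + 1) - x n‖ ^ 2 ≤ c n * (δ / 2 / 2 ^ n) ^ 2 := by
      change _ ≤ η n
      linarith
    rw [dist_comm, dist_eq_norm]
    exact le_of_sq_le_sq (le_of_mul_le_mul_left h3 (hcpos n)) (by positivity)
  obtain ⟨p, hp⟩ := cauchySeq_tendsto_of_complete (cauchySeq_of_le_geometric_two hdist)
  have hxp : ∀ n, ‖p - x n‖ ≤ δ := fun n => by
    rw [← dist_eq_norm, dist_comm]
    refine (dist_le_of_le_geometric_two_of_tendsto hdist hp n).trans ?_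
    exact div_le_self hδ.le (one_le_pow₀ one_le_two)
  have hcsum : HasSum c 1 := hasSum_geometric_two' 1
  have hxb : ∀ n, ‖x n‖ ≤ ‖p‖ + δ := fun n => by
    have h := norm_sub_le p (p - x n)
    rw [sub_sub_cancel] at h
    linarith [hxp n]
  have hsx : Summable fun i => c i • x i := by
    refine Summable.of_norm_bounded (hcsum.summable.mul_right (‖p‖ + δ)) fun i => ?_
    rw [norm_smul, Real.norm_of_nonneg (hcpos i).le]
    exact mul_le_mul_of_nonneg_left (hxb i) (hcpos i).le
  have hsx2 : Summable fun i => c i * ‖x i‖ ^ 2 := by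
    refine Summable.of_nonneg_of_le (fun i => mul_nonneg (hcpos i).le (by positivity))
      (fun i => ?_) (hcsum.summable.mul_right ((‖p‖ + δ) ^ 2))
    exact mul_le_mul_of_nonneg_left (pow_le_pow_left₀ (norm_nonneg _) (hxb i) 2) (hcpos i).le
  obtain ⟨a, ha⟩ := hsx
  obtain ⟨K, hK⟩ := exists_const_hasSum_sq_norm_sub hcsum ha hsx2
  have hgsum : ∀ n y, g n y = f y - ∑ i ∈ Finset.range n, c i * ‖y - x i‖ ^ 2 := by
    intro n y
    induction n with
    | zero => simp [hg0]
    | succ n ih => rw [hgs, ih, Finset.sum_range_succ]; ring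
  have hglim : ∀ y, Tendsto (fun n => g n y) atTop (𝓝 (f y - (‖y - a‖ ^ 2 + K))) := fun y => by
    simp only [hgsum]
    exact tendsto_const_nhds.sub (hK y).tendsto_sum_nat
  have husc : ∀ m, UpperSemicontinuous (g m) := fun m => by
    have : g m = fun y => f y + -∑ i ∈ Finset.range m, c i * ‖y - x i‖ ^ 2 :=
      funext fun y => by rw [hgsum, sub_eq_add_neg]
    rw [this]
    exact hf.add (Continuous.upperSemicontinuous (by fun_prop))
  have hη0 : Tendsto η atTop (𝓝 0) := by
    refine squeeze_zero (fun n => (hηpos n).le) (fun n => ?_)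
      (by simpa using hcsum.summable.tendsto_atTop_zero.mul_const ((δ / 2) ^ 2))
    refine mul_le_mul_of_nonneg_left (pow_le_pow_left₀ (by positivity) ?_ 2) (hcpos n).le
    exact div_le_self (by positivity) (one_le_pow₀ one_le_two)
  have hlim : ∀ (m : ℕ) (t : ℝ) (s : ℕ → ℝ), Tendsto s atTop (𝓝 0) →
      (∀ n, m ≤ n → t ≤ g n (x n) + s n) → t ≤ g m p := by
    intro m t s hs h
    by_contra! hlt
    obtain ⟨r, hr1, hr2⟩ := exists_between hlt
    have h1 : ∀ᶠ n in atTop, g m (x n) < r := hp.eventually (husc m p r hr1)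
    have h2 : ∀ᶠ n in atTop, s n < t - r := hs.eventually (gt_mem_nhds (by linarith))
    obtain ⟨n, h1, h2, h3⟩ := (h1.and (h2.and (eventually_ge_atTop m))).exists
    have h4 : g n (x n) ≤ g m (x n) := hganti (x n) h3
    linarith [h n h3]
  refine ⟨p, hS.mem_of_tendsto hp (Eventually.of_forall hxS), a, ?_, ?_, ?_⟩
  · have h : HasSum (fun i => c i • (p - x i)) (p - a) := by
      simpa [smul_sub] using (hcsum.smul_const p).sub ha
    have h2 := h.norm_le_of_bounded (hcsum.mul_right δ) fun i => by
      rw [norm_smul, Real.norm_of_nonneg (hcpos i).le]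
      exact mul_le_mul_of_nonneg_left (hxp i) (hcpos i).le
    simpa using h2
  · have := hlim 0 (f z) (fun _ => 0) tendsto_const_nhds fun n hn => by
      simpa using hz0.trans (hmono hn)
    rwa [hg0] at this
  · intro y hy
    have h1 : ∀ n, f y - (‖y - a‖ ^ 2 + K) ≤ g n y := fun n =>
      (hganti y).le_of_tendsto (hglim y) n
    have h2 : f y - (‖y - a‖ ^ 2 + K) ≤ f p - (‖p - a‖ ^ 2 + K) :=
      ge_of_tendsto' (hglim p) fun m =>
        hlim m _ η hη0 fun n _ => (h1 n).trans (hnear n y hy)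
    linarith

end VariationalPrinciple

section UpperEnvelope

variable {X : Type*} [TopologicalSpace X]

/-- The upper semicontinuous envelope of the pointwise supremum of a family of functions. -/
noncomputable def upperEnvelope (W : Set (X → ℝ)) (x : X) : ℝ :=
  sInf {c : ℝ | ∀ᶠ y in 𝓝 x, ∀ w ∈ W, w y ≤ c}

variable {W : Set (X → ℝ)} {M : ℝ} {x : X} {c : ℝ}

theorem le_upperEnvelope (hM : ∀ w ∈ W, ∀ y, w y ≤ M) {w : X → ℝ} (hw : w ∈ W) (x : X) :
    w x ≤ upperEnvelope W x :=
  le_csInf ⟨M, Eventually.of_forall fun y v hv => hM v hv y⟩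
    fun _ hc => hc.self_of_nhds w hw

theorem upperEnvelope_le (hW : W.Nonempty) (h : ∀ᶠ y in 𝓝 x, ∀ w ∈ W, w y ≤ c) :
    upperEnvelope W x ≤ c := by
  obtain ⟨w, hw⟩ := hW
  exact csInf_le ⟨w x, fun _ hb => hb.self_of_nhds w hw⟩ h

theorem frequently_of_lt_upperEnvelope (hW : W.Nonempty) (h : c < upperEnvelope W x) :
    ∃ᶠ y in 𝓝 x, ∃ w ∈ W, c < w y := by
  intro hn
  refine h.not_ge (upperEnvelope_le hW ?_)
  filter_upwards [hn] with y hy w hw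
  by_contra! hlt
  exact hy ⟨w, hw, hlt⟩

theorem upperSemicontinuous_upperEnvelope (hM : ∀ w ∈ W, ∀ y, w y ≤ M) (hW : W.Nonempty) :
    UpperSemicontinuous (upperEnvelope W) := by
  intro x c hc
  obtain ⟨b, hb, hbc⟩ := exists_lt_of_csInf_lt
    ⟨M, Eventually.of_forall fun y v hv => hM v hv y⟩ hc
  filter_upwards [eventually_eventually_nhds.2 hb] with y hy
  exact (upperEnvelope_le hW hy).trans_lt hbc

end UpperEnvelope

section HamiltonJacobi

variable {H : Type*} [NormedAddCommGroup H] [InnerProductSpace ℝ H]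

theorem hasFDerivAt_sq_norm_sub (a x : H) :
    HasFDerivAt (fun y : H => ‖y - a‖ ^ 2) (innerSL ℝ ((2 : ℝ) • (x - a))) x := by
  have h := ((hasFDerivAt_id (𝕜 := ℝ) x).sub_const a).norm_sq
  refine h.congr_fderiv ?_
  ext v
  simp [two_smul]

theorem contDiff_sq_norm_sub (a : H) : ContDiff ℝ 1 fun y : H => ‖y - a‖ ^ 2 :=
  (contDiff_id.sub contDiff_const).norm_sq ℝ

/-- Viscosity subsolutions of `u + F(x, du) = 0`. -/
def IsViscositySub (F : H → (H →L[ℝ] ℝ) → ℝ) (u : H → ℝ) : Prop :=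
  ∀ x : H, ∀ ζ ∈ superdiffR u x, u x + F x ζ ≤ 0

/-- Viscosity supersolutions of `u + F(x, du) = 0`. -/
def IsViscositySuper (F : H → (H →L[ℝ] ℝ) → ℝ) (u : H → ℝ) : Prop :=
  ∀ x : H, ∀ ξ ∈ subdiffR u x, 0 ≤ u x + F x ξ

/-- Uniform continuity of the Hamiltonian, jointly in both variables. -/
def IsUniformHamiltonian (F : H → (H →L[ℝ] ℝ) → ℝ) : Prop :=
  ∀ ε > (0 : ℝ), ∃ δ > (0 : ℝ), ∀ (x y : H) (ζ ξ : H →L[ℝ] ℝ),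
    ‖x - y‖ ≤ δ → ‖ζ - ξ‖ ≤ δ → |F x ζ - F y ξ| ≤ ε

variable {F : H → (H →L[ℝ] ℝ) → ℝ}

/-- The elements of the superdifferential of a `C¹` function reduce to its derivative. -/
theorem eq_fderiv_of_mem_superdiffR {f : H → ℝ} {p : H} {ζ ξ : H →L[ℝ] ℝ}
    (hf : HasFDerivAt f ξ p) (h : ζ ∈ superdiffR f p) : ζ = ξ := by
  obtain ⟨φ, hφ, rfl, hmax⟩ := h
  have hφ' := (hφ.differentiable one_ne_zero p).hasFDerivAt
  exact (sub_eq_zero.1 (hmax.hasFDerivAt_eq_zero (hf.sub hφ'))).symm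

theorem superdiffR_subset_of_le {f g : H → ℝ} {p : H} (h : ∀ᶠ x in 𝓝 p, f x ≤ g x)
    (hp : f p = g p) : superdiffR g p ⊆ superdiffR f p := by
  rintro ζ ⟨φ, hφ, hζ, hmax⟩
  refine ⟨φ, hφ, hζ, ?_⟩
  filter_upwards [h, hmax] with x h1 h2
  linarith

theorem isViscositySub_const {A : ℝ} (h : ∀ x, F x 0 ≤ A) :
    IsViscositySub F fun _ => -A := by
  intro x ζ hζ
  rw [eq_fderiv_of_mem_superdiffR (hasFDerivAt_const (-A) x) hζ]
  linarith [h x]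

theorem isViscositySuper_const {A : ℝ} (h : ∀ x, -A ≤ F x 0) :
    IsViscositySuper F fun _ => A := by
  rintro x _ ⟨φ, hφ, rfl, hmin⟩
  have hφ' := (hφ.differentiable one_ne_zero x).hasFDerivAt
  have := hmin.hasFDerivAt_eq_zero ((hasFDerivAt_const A x).sub hφ')
  rw [zero_sub, neg_eq_zero] at this
  rw [this]
  linarith [h x]

/-- The comparison principle for bounded semicontinuous sub- and supersolutions. -/
theorem IsViscositySub.le_of_isViscositySuper [CompleteSpace H] (hF : IsUniformHamiltonian F)
    {u v : H → ℝ} {C D : ℝ}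
    (hu : IsViscositySub F u) (hu' : UpperSemicontinuous u) (huC : ∀ x, u x ≤ C)
    (hv : IsViscositySuper F v) (hv' : LowerSemicontinuous v) (hvD : ∀ x, D ≤ v x) (z : H) :
    u z ≤ v z := by
  by_contra! hlt
  set θ := u z - v z with hθ
  have hθ0 : 0 < θ := sub_pos.2 hlt
  obtain ⟨δ, hδ, hFδ⟩ := hF (θ / 2) (by positivity)
  have hCD : 0 < C - D := by linarith [huC z, hvD z]
  set k : ℝ := (C - D) / δ ^ 2 with hk
  have hk0 : 0 < k := by positivity
  let f : WithLp 2 (H × H) → ℝ := fun p => u p.fst + -v p.snd + -(k * ‖p.fst - p.snd‖ ^ 2)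
  have hf : UpperSemicontinuous f := by
    have hfst : Continuous fun p : WithLp 2 (H × H) => p.fst := by fun_prop
    have hsnd : Continuous fun p : WithLp 2 (H × H) => p.snd := by fun_prop
    refine UpperSemicontinuous.add (UpperSemicontinuous.add ?_ ?_) ?_
    · exact fun p c hc => hfst.continuousAt.eventually (hu' p.fst c hc)
    · exact fun p c hc => hsnd.continuousAt.eventually (hv'.neg p.snd c hc)
    · exact Continuous.upperSemicontinuous (by fun_prop)
  obtain ⟨p, -, a, hpa, hzp, hmax⟩ := exists_max_sub_sq_norm (S := Set.univ) (M := C - D)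
    (z := WithLp.toLp 2 (z, z)) (δ := δ / 4) hf isClosed_univ
    (fun p _ => by
      have : 0 ≤ k * ‖p.fst - p.snd‖ ^ 2 := by positivity
      change u p.fst + -v p.snd + -(k * ‖p.fst - p.snd‖ ^ 2) ≤ C - D
      linarith [huC p.fst, hvD p.snd]) (Set.mem_univ _) (by positivity)
  obtain ⟨⟨x, y⟩⟩ := p
  obtain ⟨⟨a, b⟩⟩ := a
  have hzp : θ ≤ u x - v y - k * ‖x - y‖ ^ 2 := by
    simpa [f, ← sub_eq_add_neg, hθ] using hzp
  have hmax : ∀ x' y', u x' - v y' - k * ‖x' - y'‖ ^ 2 - (‖x' - a‖ ^ 2 + ‖y' - b‖ ^ 2) ≤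
      u x - v y - k * ‖x - y‖ ^ 2 - (‖x - a‖ ^ 2 + ‖y - b‖ ^ 2) := fun x' y' => by
    simpa [f, ← sub_eq_add_neg, WithLp.prod_norm_sq_eq_of_L2] using
      hmax (WithLp.toLp 2 (x', y')) (Set.mem_univ _)
  have hab : ‖x - a‖ ^ 2 + ‖y - b‖ ^ 2 ≤ (δ / 4) ^ 2 := by
    simpa [WithLp.prod_norm_sq_eq_of_L2] using pow_le_pow_left₀ (norm_nonneg _) hpa 2
  have hxa : ‖x - a‖ ≤ δ / 4 :=
    le_of_sq_le_sq (by linarith [sq_nonneg ‖y - b‖]) (by positivity)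
  have hyb : ‖y - b‖ ≤ δ / 4 :=
    le_of_sq_le_sq (by linarith [sq_nonneg ‖x - a‖]) (by positivity)
  have hxy : ‖x - y‖ ≤ δ := by
    refine le_of_sq_le_sq (le_of_mul_le_mul_left ?_ hk0) hδ.le
    rw [hk, div_mul_cancel₀ _ (by positivity), ← hk]
    linarith [huC x, hvD y]
  have hsub := hu x (k • innerSL ℝ ((2 : ℝ) • (x - y)) + innerSL ℝ ((2 : ℝ) • (x - a)))
    ⟨fun w => k * ‖w - y‖ ^ 2 + ‖w - a‖ ^ 2,
      (contDiff_const.mul (contDiff_sq_norm_sub y)).add (contDiff_sq_norm_sub a),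
      (((hasFDerivAt_sq_norm_sub y x).const_mul k).add (hasFDerivAt_sq_norm_sub a x)).fderiv,
      Eventually.of_forall fun w => by linarith [hmax w y]⟩
  have hsup := hv y (-(k • innerSL ℝ ((2 : ℝ) • (y - x)) + innerSL ℝ ((2 : ℝ) • (y - b))))
    ⟨fun w => -(k * ‖w - x‖ ^ 2 + ‖w - b‖ ^ 2),
      ((contDiff_const.mul (contDiff_sq_norm_sub x)).add (contDiff_sq_norm_sub b)).neg,
      (((hasFDerivAt_sq_norm_sub x y).const_mul k).add (hasFDerivAt_sq_norm_sub b y)).neg.fderiv,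
      Eventually.of_forall fun w => by
        have := hmax x w
        rw [norm_sub_rev x w, norm_sub_rev x y] at this
        linarith⟩
  have hgrad : ‖(k • innerSL ℝ ((2 : ℝ) • (x - y)) + innerSL ℝ ((2 : ℝ) • (x - a))) -
      (-(k • innerSL ℝ ((2 : ℝ) • (y - x)) + innerSL ℝ ((2 : ℝ) • (y - b))))‖ ≤ δ := by
    have h1 : (k • innerSL ℝ ((2 : ℝ) • (x - y)) + innerSL ℝ ((2 : ℝ) • (x - a))) -
        (-(k • innerSL ℝ ((2 : ℝ) • (y - x)) + innerSL ℝ ((2 : ℝ) • (y - b)))) =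
        innerSL ℝ ((2 : ℝ) • ((x - a) + (y - b))) := by
      rw [← neg_sub x y]
      simp only [smul_neg, smul_add, map_neg, map_add]
      abel
    rw [h1, innerSL_apply_norm, norm_smul, Real.norm_ofNat]
    linarith [norm_add_le (x - a) (y - b)]
  have hFxy := (abs_le.1 (hFδ x y _ _ hxy hgrad)).1
  have : 0 ≤ k * ‖x - y‖ ^ 2 := by positivity
  linarith

/-- The upper envelope of a family of subsolutions is a subsolution. -/
theorem isViscositySub_upperEnvelope [CompleteSpace H] (hF : IsUniformHamiltonian F)
    {W : Set (H → ℝ)} {M : ℝ} (hM : ∀ w ∈ W, ∀ y, w y ≤ M) (hne : W.Nonempty)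
    (husc : ∀ w ∈ W, UpperSemicontinuous w) (hW : ∀ w ∈ W, IsViscositySub F w) :
    IsViscositySub F (upperEnvelope W) := by
  rintro x₀ _ ⟨φ, hφ, rfl, hmax⟩
  set U := upperEnvelope W with hU
  refine le_of_forall_pos_le_add fun ε' hε' => ?_
  obtain ⟨ε, hε, rfl⟩ : ∃ ε > 0, ε' = 3 * ε := ⟨ε' / 3, by positivity, by ring⟩
  obtain ⟨δ, hδ, hFδ⟩ := hF ε hε
  have hφ0 : ∀ᶠ x in 𝓝 x₀, ‖φ x - φ x₀‖ < ε :=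
    hφ.continuous.continuousAt.eventually (eventually_norm_sub_lt _ hε)
  have hφ1 : ∀ᶠ x in 𝓝 x₀, ‖fderiv ℝ φ x - fderiv ℝ φ x₀‖ < δ / 4 :=
    (hφ.continuous_fderiv one_ne_zero).continuousAt.eventually
      (eventually_norm_sub_lt _ (by positivity))
  obtain ⟨R, hR, hball⟩ := Metric.nhds_basis_closedBall.eventually_iff.1
    (hmax.and (hφ0.and hφ1))
  set r := min R (δ / 8) with hr
  have hr0 : 0 < r := by positivity
  set τ := min ε (r ^ 2) with hτ
  have hτ0 : 0 < τ := by positivity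
  have hz : ∀ᶠ z in 𝓝 x₀, ‖z - x₀‖ < r ∧ φ z - φ x₀ + ‖z - x₀‖ ^ 2 < τ / 2 := by
    refine (eventually_norm_sub_lt x₀ hr0).and ?_
    have hcont : Continuous fun z => φ z - φ x₀ + ‖z - x₀‖ ^ 2 := by
      have := hφ.continuous
      fun_prop
    exact (hcont.tendsto x₀).eventually_lt_const (by simpa using half_pos hτ0)
  obtain ⟨z, ⟨w, hw, hwz⟩, hzr, hzφ⟩ := ((frequently_of_lt_upperEnvelope hne
    (sub_lt_self (U x₀) (half_pos hτ0))).and_eventually hz).exists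
  obtain ⟨p, hp, a, hpa, hzp, hpmax⟩ := exists_max_sub_sq_norm
    (f := fun y => w y + -(φ y + ‖y - x₀‖ ^ 2)) (S := Metric.closedBall x₀ r)
    (M := M - φ x₀ + ε) (z := z) (δ := δ / 8)
    ((husc w hw).add (Continuous.upperSemicontinuous (by
      have := hφ.continuous
      fun_prop))) Metric.isClosed_closedBall
    (fun y hy => by
      have h1 := (hball (Metric.closedBall_subset_closedBall (min_le_left _ _) hy)).2.1
      rw [Real.norm_eq_abs, abs_lt] at h1
      linarith [hM w hw y, sq_nonneg ‖y - x₀‖, h1.1])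
    (by rw [mem_closedBall_iff_norm]; exact hzr.le) (by positivity)
  obtain ⟨hp1, hp2, hp3⟩ := hball (Metric.closedBall_subset_closedBall (min_le_left _ _) hp)
  have hwp := le_upperEnvelope hM hw p
  rw [Real.norm_eq_abs, abs_lt] at hp2
  have hpr : ‖p - x₀‖ < r := by
    refine lt_of_pow_lt_pow_left₀ 2 hr0.le ?_
    have := min_le_right ε (r ^ 2)
    linarith
  have hloc : ∀ᶠ y in 𝓝 p, y ∈ Metric.closedBall x₀ r := by
    filter_upwards [Metric.isOpen_ball.mem_nhds (mem_ball_iff_norm.2 hpr)] with y hy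
    exact Metric.ball_subset_closedBall hy
  have hsub := hW w hw p (fderiv ℝ φ p + innerSL ℝ ((2 : ℝ) • (p - x₀)) +
      innerSL ℝ ((2 : ℝ) • (p - a)))
    ⟨fun y => φ y + ‖y - x₀‖ ^ 2 + ‖y - a‖ ^ 2,
      (hφ.add (contDiff_sq_norm_sub x₀)).add (contDiff_sq_norm_sub a),
      (((hφ.differentiable one_ne_zero p).hasFDerivAt.add
        (hasFDerivAt_sq_norm_sub x₀ p)).add (hasFDerivAt_sq_norm_sub a p)).fderiv,
      hloc.mono fun y hy => by linarith [hpmax y hy]⟩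
  have hgrad : ‖fderiv ℝ φ p + innerSL ℝ ((2 : ℝ) • (p - x₀)) +
      innerSL ℝ ((2 : ℝ) • (p - a)) - fderiv ℝ φ x₀‖ ≤ δ := by
    have h1 : fderiv ℝ φ p + innerSL ℝ ((2 : ℝ) • (p - x₀)) +
        innerSL ℝ ((2 : ℝ) • (p - a)) - fderiv ℝ φ x₀ =
        (fderiv ℝ φ p - fderiv ℝ φ x₀) + innerSL ℝ ((2 : ℝ) • (p - x₀)) +
        innerSL ℝ ((2 : ℝ) • (p - a)) := by abel
    rw [h1]
    refine (norm_add₃_le).trans ?_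
    rw [innerSL_apply_norm, innerSL_apply_norm, norm_smul, norm_smul, Real.norm_ofNat]
    linarith [min_le_right R (δ / 8)]
  have hFp := (abs_le.1 (hFδ p x₀ _ _
    (by linarith [min_le_right R (δ / 8)]) hgrad)).1
  linarith [min_le_left ε (r ^ 2), sq_nonneg ‖p - x₀‖]

/-- The Perron bump construction: if the lower envelope of a subsolution fails to be a supersolution,
then the subsolution is not maximal. -/
theorem isViscositySuper_neg_upperEnvelope_neg (hF : IsUniformHamiltonian F)
    {U : H → ℝ} {B C : ℝ} (hU : IsViscositySub F U) (husc : UpperSemicontinuous U)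
    (hUB : ∀ x, B ≤ U x) (hUC : ∀ x, U x ≤ C)
    (hmax : ∀ w : H → ℝ, UpperSemicontinuous w → (∃ D, ∀ x, w x ≤ D) → IsViscositySub F w →
      ∀ x, w x ≤ U x) :
    IsViscositySuper F (-upperEnvelope {-U}) := by
  set V : H → ℝ := -upperEnvelope {-U} with hV
  have hVU : ∀ x, V x ≤ U x := fun x => by
    have := le_upperEnvelope (W := {-U}) (M := -B) (by simpa using hUB) rfl x
    simpa [hV] using neg_le_neg this
  have hleV : ∀ x c, (∀ᶠ y in 𝓝 x, c ≤ U y) → c ≤ V x := fun x c h => by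
    have := upperEnvelope_le (W := {-U}) (x := x) (c := -c) (Set.singleton_nonempty _)
      (by simpa using h)
    simpa [hV] using neg_le_neg this
  rintro x₀ _ ⟨φ, hφ, rfl, hmin⟩
  by_contra! hneg
  obtain ⟨ε, hε, hεeq⟩ : ∃ ε > 0, V x₀ + F x₀ (fderiv ℝ φ x₀) = -(3 * ε) :=
    ⟨-(V x₀ + F x₀ (fderiv ℝ φ x₀)) / 3, by linarith, by ring⟩
  obtain ⟨δ, hδ, hFδ⟩ := hF ε hε
  have hφ0 : ∀ᶠ x in 𝓝 x₀, ‖φ x - φ x₀‖ < ε :=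
    hφ.continuous.continuousAt.eventually (eventually_norm_sub_lt _ hε)
  have hφ1 : ∀ᶠ x in 𝓝 x₀, ‖fderiv ℝ φ x - fderiv ℝ φ x₀‖ < δ / 2 :=
    (hφ.continuous_fderiv one_ne_zero).continuousAt.eventually
      (eventually_norm_sub_lt _ (by positivity))
  obtain ⟨R, hR, hball⟩ := Metric.nhds_basis_ball.eventually_iff.1
    (hmin.and (hφ0.and hφ1))
  set r := min R (δ / 4) with hr
  have hr0 : 0 < r := by positivity
  set s := min ε (r ^ 2 / 2) with hs
  have hs0 : 0 < s := by positivity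
  have hsr : s < r ^ 2 := (min_le_right _ _).trans_lt (half_lt_self (by positivity))
  set ψ : H → ℝ := fun x => φ x - ‖x - x₀‖ ^ 2 + (V x₀ - φ x₀ + s) with hψ
  have hψcont : Continuous ψ := by
    have := hφ.continuous
    fun_prop
  have hψ' : ∀ x, HasFDerivAt ψ (fderiv ℝ φ x - innerSL ℝ ((2 : ℝ) • (x - x₀))) x := fun x =>
    ((hφ.differentiable one_ne_zero x).hasFDerivAt.sub
      (hasFDerivAt_sq_norm_sub x₀ x)).add_const _
  have hψsub : ∀ x, ‖x - x₀‖ < r →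
      ψ x + F x (fderiv ℝ φ x - innerSL ℝ ((2 : ℝ) • (x - x₀))) ≤ 0 := by
    intro x hx
    obtain ⟨-, h2, h3⟩ := hball (mem_ball_iff_norm.2 (hx.trans_le (min_le_left _ _)))
    rw [Real.norm_eq_abs, abs_lt] at h2
    have hxδ := hx.trans_le (min_le_right R (δ / 4))
    have hgrad : ‖fderiv ℝ φ x - innerSL ℝ ((2 : ℝ) • (x - x₀)) - fderiv ℝ φ x₀‖ ≤ δ := by
      rw [sub_right_comm]
      refine (norm_sub_le _ _).trans ?_
      rw [innerSL_apply_norm, norm_smul, Real.norm_ofNat]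
      linarith
    have h4 := (abs_le.1 (hFδ x x₀ _ _ (by linarith) hgrad)).2
    have h5 : ψ x = φ x - ‖x - x₀‖ ^ 2 + (V x₀ - φ x₀ + s) := rfl
    linarith [min_le_left ε (r ^ 2 / 2), sq_nonneg ‖x - x₀‖]
  have hψU : ∀ x, ‖x - x₀‖ < r → s ≤ ‖x - x₀‖ ^ 2 → ψ x ≤ U x := by
    intro x hx hsx
    have h1 := (hball (mem_ball_iff_norm.2 (hx.trans_le (min_le_left _ _)))).1
    have h5 : ψ x = φ x - ‖x - x₀‖ ^ 2 + (V x₀ - φ x₀ + s) := rfl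
    linarith [hVU x]
  set w : H → ℝ := fun x => if ‖x - x₀‖ < r then max (U x) (ψ x) else U x with hw
  have hUw : ∀ x, U x ≤ w x := fun x => by
    simp only [hw]
    split_ifs
    · exact le_max_left _ _
    · exact le_rfl
  have hψw : ∀ x, ‖x - x₀‖ < r → ψ x ≤ w x := fun x hx => by
    simp only [hw, if_pos hx]
    exact le_max_right _ _
  have hwcases : ∀ x, w x = U x ∨ (‖x - x₀‖ < r ∧ w x = ψ x) := fun x => by
    simp only [hw]
    split_ifs with hx
    · exact (max_choice (U x) (ψ x)).imp id fun h => ⟨hx, h⟩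
    · exact Or.inl rfl
  have hopen : IsOpen {x : H | ‖x - x₀‖ < r} := isOpen_lt (by fun_prop) continuous_const
  have hwusc : UpperSemicontinuous w := by
    intro x c hc
    by_cases hx : ‖x - x₀‖ < r
    · have h1 := husc x c ((hUw x).trans_lt hc)
      have h2 := hψcont.upperSemicontinuous x c ((hψw x hx).trans_lt hc)
      filter_upwards [h1, h2] with y hy1 hy2
      rcases hwcases y with h | ⟨-, h⟩ <;> simpa only [h]
    · have h1 := husc x c ((hUw x).trans_lt hc)
      have h2 : ∀ᶠ y in 𝓝 x, s < ‖y - x₀‖ ^ 2 := by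
        have hcont : Continuous fun y => ‖y - x₀‖ ^ 2 := by fun_prop
        exact (hcont.tendsto x).eventually_const_lt
          (hsr.trans_le (pow_le_pow_left₀ hr0.le (not_lt.1 hx) 2))
      filter_upwards [h1, h2] with y hy1 hy2
      rcases hwcases y with h | ⟨hy, h⟩
      · simpa only [h]
      · simpa only [h] using (hψU y hy hy2.le).trans_lt hy1
  have hwbdd : ∀ x, w x ≤ max C (V x₀ + 2 * ε) := fun x => by
    rcases hwcases x with h | ⟨hx, h⟩
    · exact h.trans_le ((hUC x).trans (le_max_left _ _))
    · refine h.trans_le (le_trans ?_ (le_max_right _ _))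
      have h2 := (hball (mem_ball_iff_norm.2 (hx.trans_le (min_le_left _ _)))).2.1
      rw [Real.norm_eq_abs, abs_lt] at h2
      have h5 : ψ x = φ x - ‖x - x₀‖ ^ 2 + (V x₀ - φ x₀ + s) := rfl
      linarith [min_le_left ε (r ^ 2 / 2), sq_nonneg ‖x - x₀‖]
  have hwsub : IsViscositySub F w := by
    intro x ζ hζ
    rcases hwcases x with h | ⟨hx, h⟩
    · rw [h]
      exact hU x ζ (superdiffR_subset_of_le (Eventually.of_forall hUw) h.symm hζ)
    · have hle : ∀ᶠ y in 𝓝 x, ψ y ≤ w y := by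
        filter_upwards [hopen.mem_nhds hx] with y hy using hψw y hy
      rw [h, eq_fderiv_of_mem_superdiffR (hψ' x) (superdiffR_subset_of_le hle h.symm hζ)]
      exact hψsub x hx
  have hwU := hmax w hwusc ⟨_, hwbdd⟩ hwsub
  have hψx₀ : V x₀ + s / 2 < ψ x₀ := by
    simp only [hψ, sub_self, norm_zero]
    linarith
  have := hleV x₀ (V x₀ + s / 2) (by
    filter_upwards [(hψcont.tendsto x₀).eventually_const_lt hψx₀,
      eventually_norm_sub_lt x₀ hr0] with y hy1 hy2
    exact hy1.le.trans ((hψw y hy2).trans (hwU y)))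
  linarith

end HamiltonJacobi

/-- Existence and uniqueness of a bounded viscosity solution of `u + F(x, du) = 0` in a real
Hilbert space, for `F` uniformly continuous with `−A ≤ F(x,0) ≤ A`. -/
theorem hamilton_jacobi_existence_uniqueness
    {H : Type*} [NormedAddCommGroup H] [InnerProductSpace ℝ H] [CompleteSpace H]
    (F : H → (H →L[ℝ] ℝ) → ℝ)
    (hF : ∀ ε > (0 : ℝ), ∃ δ > (0 : ℝ), ∀ (x y : H) (ζ ξ : H →L[ℝ] ℝ),
      ‖x - y‖ ≤ δ → ‖ζ - ξ‖ ≤ δ → |F x ζ - F y ξ| ≤ ε)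
    (A : ℝ) (hA : 0 < A) (hFA : ∀ x : H, -A ≤ F x 0 ∧ F x 0 ≤ A) :
    ∃! u : H → ℝ,
      Continuous u ∧ (∃ C : ℝ, ∀ x, |u x| ≤ C) ∧
      (∀ x : H, ∀ ζ ∈ superdiffR u x, u x + F x ζ ≤ 0) ∧
      (∀ x : H, ∀ ξ ∈ subdiffR u x, 0 ≤ u x + F x ξ) := by
  have hF' : IsUniformHamiltonian F := hF
  let W : Set (H → ℝ) :=
    {w | UpperSemicontinuous w ∧ (∃ D, ∀ x, w x ≤ D) ∧ IsViscositySub F w}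
  have hWA : ∀ w ∈ W, ∀ x, w x ≤ A := fun w ⟨h1, ⟨D, h2⟩, h3⟩ =>
    h3.le_of_isViscositySuper hF' h1 h2 (isViscositySuper_const fun x => (hFA x).1)
      continuous_const.lowerSemicontinuous (D := A) fun _ => le_rfl
  have hconst : (fun _ => -A) ∈ W := ⟨continuous_const.upperSemicontinuous,
    ⟨-A, fun _ => le_rfl⟩, isViscositySub_const fun x => (hFA x).2⟩
  have hne : W.Nonempty := ⟨_, hconst⟩
  set U := upperEnvelope W
  have hUsub : IsViscositySub F U :=
    isViscositySub_upperEnvelope hF' hWA hne (fun _ h => h.1) fun _ h => h.2.2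
  have hUusc : UpperSemicontinuous U := upperSemicontinuous_upperEnvelope hWA hne
  have hUA : ∀ x, U x ≤ A := fun x =>
    upperEnvelope_le hne (Eventually.of_forall fun y w hw => hWA w hw y)
  have hUlow : ∀ x, -A ≤ U x := le_upperEnvelope hWA hconst
  have hVsup : IsViscositySuper F (-upperEnvelope {-U}) :=
    isViscositySuper_neg_upperEnvelope_neg hF' hUsub hUusc hUlow hUA
      fun w h1 h2 h3 => le_upperEnvelope hWA (show w ∈ W from ⟨h1, h2, h3⟩)
  have hnegU : ∀ w ∈ ({-U} : Set (H → ℝ)), ∀ y, w y ≤ A := by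
    rintro _ rfl y
    exact neg_le.1 (hUlow y)
  have hVlsc : LowerSemicontinuous (-upperEnvelope {-U}) :=
    (upperSemicontinuous_upperEnvelope hnegU (Set.singleton_nonempty _)).neg
  have hVU : ∀ x, (-upperEnvelope {-U}) x ≤ U x := fun x =>
    neg_le.1 (le_upperEnvelope hnegU rfl x)
  have hVlow : ∀ x, -A ≤ (-upperEnvelope {-U}) x := fun x =>
    neg_le_neg (upperEnvelope_le (Set.singleton_nonempty _)
      (Eventually.of_forall fun y w hw => hnegU w hw y))
  have hUV : U = -upperEnvelope {-U} := funext fun x => le_antisymm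
    (hUsub.le_of_isViscositySuper hF' hUusc hUA hVsup hVlsc hVlow x) (hVU x)
  rw [← hUV] at hVsup hVlsc
  have hUcont : Continuous U := continuous_iff_lower_upperSemicontinuous.2 ⟨hVlsc, hUusc⟩
  refine ⟨U, ⟨hUcont, ⟨A, fun x => abs_le.2 ⟨hUlow x, hUA x⟩⟩, hUsub, hVsup⟩, ?_⟩
  rintro v ⟨hvc, ⟨C, hC⟩, hvsub, hvsup⟩
  exact funext fun x => le_antisymm
    (IsViscositySub.le_of_isViscositySuper hF' hvsub hvc.upperSemicontinuous
      (fun y => (abs_le.1 (hC y)).2) hVsup hVlsc hUlow x)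
    (hUsub.le_of_isViscositySuper hF' hUusc hUA hvsup hvc.lowerSemicontinuous
      (fun y => (abs_le.1 (hC y)).1) x)
end

section
/- Let H be a real Hilbert space and F : ℝ × H × H* → ℝ a function for which there exists a constant K > 0 such that F(t, x, ζ) > 0 whenever t ∈ ℝ, x ∈ H, ζ ∈ H* and ‖ζ‖ ≥ K. Let u : H → ℝ be an upper semicontinuous function satisfying F(u(x), x, ζ) ≤ 0 for every x ∈ H and every ζ ∈ D⁺u(x) (a viscosity subsolution of F(u, x, du) = 0). Then: (1) u is K-Lipschitz, i.e. |u(x) − u(y)| ≤ K‖x − y‖ for all x, y ∈ H; and (2) u is Fréchet differentiable on a dense subset of H. -/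
open Filter Topology

section VariationalPrinciple

noncomputable def historySeq {α : Type*} [Nonempty α] (S : ℕ → (ℕ → α) → α → Prop) : ℕ → α
  | n => Classical.epsilon
      (S n fun k => if _ : k < n then historySeq S k else Classical.arbitrary α)

/-- Dependent choice in which each step may refer to all previous terms. -/
theorem exists_seq_of_history {α : Type*} [Nonempty α] (S : ℕ → (ℕ → α) → α → Prop)
    (hS : ∀ n f g a, (∀ k < n, f k = g k) → S n f a → S n g a) :
    ∃ z : ℕ → α, ∀ n, (∃ a, S n z a) → S n z (z n) := by
  refine ⟨historySeq S, fun n ⟨a, ha⟩ => ?_⟩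
  have h := Classical.epsilon_spec (p := S n fun k => if _ : k < n then historySeq S k
    else Classical.arbitrary α) ⟨a, hS n _ _ a (fun k hk => by simp [hk]) ha⟩
  rw [historySeq]
  exact hS n _ _ _ (fun k hk => by simp [hk]) h

section Penalization

variable {α H : Type*} [NormedAddCommGroup H]

/-- The value `Ψ` penalized by weighted squared distances to the first `n` terms of `z`. -/
noncomputable def penalized (π : α → H) (Ψ : α → ℝ) (z : ℕ → α) (n : ℕ) (w : α) : ℝ :=
  Ψ w - ∑ j ∈ Finset.range n, (1 / 2 : ℝ) ^ j * ‖π w - π (z j)‖ ^ 2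

/-- `w` is an admissible competitor at step `n` with value `a`. -/
def Admissible (π : α → H) (Ψ : α → ℝ) (R : ℕ → α → α → ℝ → Prop) (z : ℕ → α) (n : ℕ)
    (w : α) (a : ℝ) : Prop :=
  ∀ k < n, penalized π Ψ z k (z k) ≤ a ∧ R k (z k) w (a - penalized π Ψ z k (z k))

variable {π : α → H} {Ψ : α → ℝ} {R : ℕ → α → α → ℝ → Prop}

theorem penalized_succ (z : ℕ → α) (n : ℕ) (w : α) : penalized π Ψ z (n + 1) w =
    penalized π Ψ z n w - (1 / 2 : ℝ) ^ n * ‖π w - π (z n)‖ ^ 2 := by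
  simp only [penalized, Finset.sum_range_succ]; ring

theorem penalized_antitone (z : ℕ → α) (w : α) : Antitone fun n => penalized π Ψ z n w := by
  refine antitone_nat_of_succ_le fun n => ?_
  rw [penalized_succ]
  have : 0 ≤ (1 / 2 : ℝ) ^ n * ‖π w - π (z n)‖ ^ 2 := by positivity
  linarith

theorem penalized_congr {z z' : ℕ → α} {n : ℕ} (h : ∀ k < n, z k = z' k) {m : ℕ} (hm : m ≤ n)
    (w : α) : penalized π Ψ z m w = penalized π Ψ z' m w := by
  unfold penalized
  congr 1
  refine Finset.sum_congr rfl fun j hj => ?_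
  rw [h j ((Finset.mem_range.1 hj).trans_le hm)]

theorem Admissible.mono (hR : ∀ k z w a b, a ≤ b → R k z w a → R k z w b) {z : ℕ → α}
    {m n : ℕ} (hmn : m ≤ n) {w : α} {a b : ℝ} (hab : a ≤ b) (h : Admissible π Ψ R z n w a) :
    Admissible π Ψ R z m w b := fun k hk =>
  ⟨(h k (hk.trans_le hmn)).1.trans hab,
    hR _ _ _ _ _ (by linarith) (h k (hk.trans_le hmn)).2⟩

theorem Admissible.congr {z z' : ℕ → α} {n : ℕ} (h : ∀ k < n, z k = z' k) {w : α} {a : ℝ}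
    (hw : Admissible π Ψ R z n w a) : Admissible π Ψ R z' n w a := fun k hk => by
  have := hw k hk
  rwa [penalized_congr h hk.le, h k hk] at this

theorem exists_penalized_seq
    (hR0 : ∀ k z, R k z z 0) (z₀ : α) (h₀ : ∀ w, Ψ w ≤ Ψ z₀ + 1) :
    ∃ z : ℕ → α, z 0 = z₀ ∧ ∀ n, Admissible π Ψ R z n (z n) (penalized π Ψ z n (z n)) ∧
      ∀ w, Admissible π Ψ R z n w (penalized π Ψ z n w) →
        penalized π Ψ z n w ≤ penalized π Ψ z n (z n) + (1 / 8) ^ n := by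
  have : Nonempty α := ⟨z₀⟩
  let S : ℕ → (ℕ → α) → α → Prop := fun n z a =>
    Admissible π Ψ R z n a (penalized π Ψ z n a) ∧
      (∀ w, Admissible π Ψ R z n w (penalized π Ψ z n w) →
        penalized π Ψ z n w ≤ penalized π Ψ z n a + (1 / 8) ^ n) ∧ (n = 0 → a = z₀)
  obtain ⟨z, hz⟩ := exists_seq_of_history S (by
    rintro n f g a h ⟨h1, h2, h3⟩
    refine ⟨?_, fun w hw => ?_, h3⟩
    · rw [← penalized_congr h le_rfl]; exact h1.congr h
    · rw [← penalized_congr h le_rfl, ← penalized_congr h le_rfl]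
      refine h2 w ?_
      rw [penalized_congr h le_rfl]
      exact hw.congr fun k hk => (h k hk).symm)
  have key : ∀ n, S n z (z n) := by
    intro n
    refine hz n ?_
    induction n with
    | zero => exact ⟨z₀, fun k hk => absurd hk (by simp), fun w _ => by
        simpa [penalized] using h₀ w, fun _ => rfl⟩
    | succ n ih =>
      have hn := hz n ih
      have hval : penalized π Ψ z (n + 1) (z n) = penalized π Ψ z n (z n) := by
        simp [penalized_succ]
      have hne : Admissible π Ψ R z (n + 1) (z n) (penalized π Ψ z (n + 1) (z n)) := by
        intro k hk
        rcases Nat.lt_succ_iff_lt_or_eq.1 hk with hk | rfl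
        · rw [hval]; exact hn.1 k hk
        · rw [hval, sub_self]; exact ⟨le_rfl, hR0 _ _⟩
      set A : Set ℝ := {a | ∃ w, Admissible π Ψ R z (n + 1) w (penalized π Ψ z (n + 1) w) ∧
        penalized π Ψ z (n + 1) w = a}
      have hA : A.Nonempty := ⟨_, z n, hne, rfl⟩
      have hAb : BddAbove A := by
        refine ⟨Ψ z₀ + 1, ?_⟩
        rintro _ ⟨w, -, rfl⟩
        have := penalized_antitone (π := π) (Ψ := Ψ) z w (Nat.zero_le (n + 1))
        simp only [penalized, Finset.range_zero, Finset.sum_empty, sub_zero] at this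
        exact this.trans (h₀ w)
      obtain ⟨_, ⟨w, hw, rfl⟩, hlt⟩ := exists_lt_of_lt_csSup hA
        (show sSup A - (1 / 8) ^ (n + 1) < sSup A by
          have : (0 : ℝ) < (1 / 8) ^ (n + 1) := by positivity
          linarith)
      refine ⟨w, hw, fun v hv => ?_, by simp⟩
      have := le_csSup hAb ⟨v, hv, rfl⟩
      linarith
  exact ⟨z, (key 0).2.2 rfl, fun n => ⟨(key n).1, (key n).2.1⟩⟩

end Penalization

section Limit

variable {H : Type*} [NormedAddCommGroup H] [InnerProductSpace ℝ H] [CompleteSpace H]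

theorem exists_hasSum_penalty {c : ℕ → H} {e : H} (hc : ∀ j, ‖e - c j‖ ≤ (1 / 2) ^ j) :
    ∃ (q : H) (S : ℝ), ‖q‖ ≤ 4 ∧ ∀ v, HasSum (fun j => (1 / 2 : ℝ) ^ j * ‖v - c j‖ ^ 2)
      (S + inner ℝ q (v - e) + 2 * ‖v - e‖ ^ 2) := by
  have hg : HasSum (fun j : ℕ => (1 / 2 : ℝ) ^ j) 2 := hasSum_geometric_two
  have hb : ∀ j, ‖((1 / 2 : ℝ) ^ j * 2) • (e - c j)‖ ≤ (1 / 2) ^ j * 2 := fun j => by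
    rw [norm_smul, Real.norm_of_nonneg (by positivity)]
    exact mul_le_of_le_one_right (by positivity)
      ((hc j).trans (pow_le_one₀ (by norm_num) (by norm_num)))
  have hq : Summable fun j : ℕ => ((1 / 2 : ℝ) ^ j * 2) • (e - c j) :=
    .of_norm_bounded (hg.summable.mul_right 2) hb
  have hS : Summable fun j : ℕ => (1 / 2 : ℝ) ^ j * ‖e - c j‖ ^ 2 := by
    refine .of_nonneg_of_le (fun j => by positivity) (fun j => ?_) hg.summable
    refine mul_le_of_le_one_right (by positivity) (pow_le_one₀ (norm_nonneg _) ?_)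
    exact (hc j).trans (pow_le_one₀ (by norm_num) (by norm_num))
  refine ⟨∑' j : ℕ, ((1 / 2 : ℝ) ^ j * 2) • (e - c j),
    ∑' j : ℕ, (1 / 2 : ℝ) ^ j * ‖e - c j‖ ^ 2, (tsum_of_norm_bounded (hg.mul_right 2) hb).trans (by norm_num), fun v => ?_⟩
  have h1 := (hS.hasSum.add (((innerSL ℝ (v - e)).hasSum hq.hasSum))).add
    (hg.mul_right (‖v - e‖ ^ 2))
  convert h1 using 1
  · ext j
    rw [show v - c j = (e - c j) + (v - e) by abel, norm_add_sq_real]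
    simp only [innerSL_apply_apply, inner_smul_right]
    rw [real_inner_comm]; ring
  · rw [innerSL_apply_apply, real_inner_comm]

variable {α : Type*} {π : α → H} {Ψ : α → ℝ} {R : ℕ → α → α → ℝ → Prop}

/-- A variational principle with quadratic penalization and side conditions `R`. -/
theorem exists_penalized_limit (hR : ∀ k z w a b, a ≤ b → R k z w a → R k z w b)
    (hR0 : ∀ k z, R k z z 0) (z₀ : α) (h₀ : ∀ w, Ψ w ≤ Ψ z₀ + 1) :
    ∃ (z : ℕ → α) (e q : H) (V : ℕ → ℝ) (L S : ℝ), z 0 = z₀ ∧ V 0 = Ψ z₀ ∧ Monotone V ∧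
      Tendsto V atTop (𝓝 L) ∧ L ≤ Ψ z₀ + 1 ∧ ‖q‖ ≤ 4 ∧ (∀ k, ‖e - π (z k)‖ ≤ (1 / 2) ^ k) ∧
      (∀ k, |Ψ (z k) - V k - S| ≤ 4 * (1 / 2) ^ k) ∧
      (∀ k n, k < n → R k (z k) (z n) (V n - V k)) ∧
      (∀ v, 0 ≤ S + inner ℝ q (v - e) + 2 * ‖v - e‖ ^ 2) ∧
      ∀ w n, (∀ k < n, V k ≤ Ψ w - (S + inner ℝ q (π w - e) + 2 * ‖π w - e‖ ^ 2) ∧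
        R k (z k) w (Ψ w - (S + inner ℝ q (π w - e) + 2 * ‖π w - e‖ ^ 2) - V k)) →
        Ψ w - (S + inner ℝ q (π w - e) + 2 * ‖π w - e‖ ^ 2) ≤ L + (1 / 8) ^ n := by
  obtain ⟨z, hz0, hz⟩ := exists_penalized_seq (π := π) hR0 z₀ h₀
  set V : ℕ → ℝ := fun n => penalized π Ψ z n (z n) with hV
  have hanti := penalized_antitone (π := π) (Ψ := Ψ) z
  have hadm : ∀ {k n}, k ≤ n → Admissible π Ψ R z k (z n) (penalized π Ψ z k (z n)) :=
    fun {k n} h => (hz n).1.mono hR h (hanti _ h)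
  have hVm : Monotone V := monotone_nat_of_le_succ fun n => ((hz (n + 1)).1 n (by simp)).1
  have hVb : ∀ n, V n ≤ Ψ z₀ + 1 := fun n => by
    have := hanti (z n) (Nat.zero_le n)
    simp only [penalized, Finset.range_zero, Finset.sum_empty, sub_zero] at this
    exact this.trans (h₀ _)
  have hL := tendsto_atTop_ciSup hVm ⟨_, Set.forall_mem_range.2 hVb⟩
  set L := ⨆ n, V n
  have hVL : ∀ n, V n ≤ L := hVm.ge_of_tendsto hL
  have hpi : ∀ {k n}, k ≤ n → ‖π (z n) - π (z k)‖ ≤ (1 / 2) ^ k := by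
    intro k n hkn
    rcases hkn.eq_or_lt with rfl | hkn
    · simp
    have h1 := (hz n).1 k hkn |>.1
    have h2 := hanti (z n) (Nat.succ_le_of_lt hkn)
    have h3 := (hz k).2 (z n) (hadm hkn.le)
    simp only [Nat.succ_eq_add_one, penalized_succ] at h2
    have h4 : (1 / 2 : ℝ) ^ k * ‖π (z n) - π (z k)‖ ^ 2 ≤ (1 / 2) ^ k * ((1 / 2) ^ k) ^ 2 := by
      have : ((1 : ℝ) / 8) ^ k = (1 / 2) ^ k * ((1 / 2) ^ k) ^ 2 := by
        rw [← pow_mul, mul_comm k 2, pow_mul, ← mul_pow]; norm_num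
      linarith
    exact le_of_sq_le_sq (le_of_mul_le_mul_left h4 (by positivity)) (by positivity)
  have hcau : CauchySeq fun n => π (z n) := by
    refine cauchySeq_of_le_geometric (1 / 2) 1 (by norm_num) fun n => ?_
    rw [dist_comm, dist_eq_norm, one_mul]
    exact hpi n.le_succ
  obtain ⟨e, he⟩ := cauchySeq_tendsto_of_complete hcau
  have hek : ∀ k, ‖e - π (z k)‖ ≤ (1 / 2) ^ k := fun k =>
    le_of_tendsto (he.sub_const _).norm (eventually_atTop.2 ⟨k, fun n hn => hpi hn⟩)
  obtain ⟨q, S, hq, hsum⟩ := exists_hasSum_penalty hek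
  have hnn : ∀ v, 0 ≤ S + inner ℝ q (v - e) + 2 * ‖v - e‖ ^ 2 := fun v =>
    (hsum v).nonneg fun j => by positivity
  have hle : ∀ w n, Ψ w - (S + inner ℝ q (π w - e) + 2 * ‖π w - e‖ ^ 2) ≤
      penalized π Ψ z n w := fun w n => by
    have := sum_le_hasSum (Finset.range n) (fun j _ => by positivity) (hsum (π w))
    unfold penalized; linarith
  refine ⟨z, e, q, V, L, S, hz0, by simp [hV, penalized, hz0], hVm, hL, ciSup_le hVb, hq, hek,
    fun k => ?_, fun k n hkn => ((hz n).1 k hkn).2, hnn, fun w n h => ?_⟩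
  · have hS : HasSum (fun j => (1 / 2 : ℝ) ^ j * ‖e - π (z j)‖ ^ 2) S := by
      simpa using hsum e
    have hfin : HasSum (fun j => if j ∈ Finset.range k then
        (1 / 2 : ℝ) ^ j * ‖π (z k) - π (z j)‖ ^ 2 else 0) (Ψ (z k) - V k) := by
      have := hasSum_sum_of_ne_finset_zero (L := SummationFilter.unconditional ℕ) (s := Finset.range k) (f := fun j =>
        if j ∈ Finset.range k then (1 / 2 : ℝ) ^ j * ‖π (z k) - π (z j)‖ ^ 2 else 0)
        (fun j hj => by simp only [hj, if_false])
      convert this using 1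
      rw [Finset.sum_ite_mem, Finset.inter_self]
      simp [hV, penalized]
    have hd := hfin.sub hS
    have hg : HasSum (fun j : ℕ => (1 / 2 : ℝ) ^ j * (2 * (1 / 2) ^ k)) (2 * (2 * (1 / 2) ^ k)) :=
      hasSum_geometric_two.mul_right _
    rw [← hd.tsum_eq, ← Real.norm_eq_abs]
    refine (tsum_of_norm_bounded hg fun j => ?_).trans (by linarith)
    have hj1 : ((1 : ℝ) / 2) ^ j ≤ 1 := pow_le_one₀ (by norm_num) (by norm_num)
    rw [Real.norm_eq_abs]
    by_cases hj : j < k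
    · rw [if_pos (by simpa using hj), ← mul_sub, abs_mul, abs_of_nonneg (by positivity)]
      gcongr
      have h1 := hek j
      have h2 := hpi hj.le
      have h3 := hek k
      have h4 : |‖π (z k) - π (z j)‖ - ‖e - π (z j)‖| ≤ (1 / 2) ^ k := by
        refine (abs_norm_sub_norm_le _ _).trans ?_
        rw [sub_sub_sub_cancel_right, norm_sub_rev]; exact h3
      rw [sq_sub_sq, abs_mul, abs_of_nonneg (by positivity)]
      gcongr
      linarith
    · rw [if_neg (by simpa using hj), zero_sub, abs_neg, abs_of_nonneg (by positivity)]
      gcongr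
      have h1 := hek j
      have h2 : ((1 : ℝ) / 2) ^ j ≤ (1 / 2) ^ k :=
        pow_le_pow_of_le_one (by norm_num) (by norm_num) (not_lt.1 hj)
      have := norm_nonneg (e - π (z j))
      nlinarith
  · have h1 : Admissible π Ψ R z n w (penalized π Ψ z n w) :=
      Admissible.mono hR le_rfl (hle w n) h
    linarith [(hz n).2 w h1, hle w n, hVL n]

end Limit

end VariationalPrinciple

section SteepChords

open MeasureTheory Set

/-- Weak type (1,1) estimate for the set of points with a steep chord. -/
theorem volume_steep_le {θ : ℝ → ℝ} {Λ : NNReal} (hθ : LipschitzWith Λ θ) {a b l : ℝ}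
    (hab : a < b) (hl : 0 < l) :
    volume {τ ∈ Icc a b | ∃ s ∈ Icc a b, l * |s - τ| < |θ s - θ τ|} ≤
      ENNReal.ofReal (8 / l * ∫ x in a..b, |deriv θ x|) := by
  set B := {τ ∈ Icc a b | ∃ s ∈ Icc a b, l * |s - τ| < |θ s - θ τ|} with hB
  have hex : ∀ τ : ℝ, ∃ s, τ ∈ B → s ∈ Icc a b ∧ l * |s - τ| < |θ s - θ τ| := fun τ => by
    by_cases h : τ ∈ B
    · obtain ⟨s, hs⟩ := h.2; exact ⟨s, fun _ => hs⟩
    · exact ⟨0, fun h' => absurd h' h⟩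
  choose s hs using hex
  have hpos : ∀ τ ∈ B, 0 < |s τ - τ| := fun τ hτ => by
    refine abs_pos.2 fun h => ?_
    have := (hs τ hτ).2
    rw [sub_eq_zero.1 h] at this
    simp at this
  have hle : ∀ τ ∈ B, |s τ - τ| ≤ b - a := fun τ hτ => by
    have h1 := (hs τ hτ).1; have h2 := hτ.1
    rw [abs_le]; constructor <;> linarith [h1.1, h1.2, h2.1, h2.2]
  obtain ⟨u, huB, hdisj, hcov⟩ := Vitali.exists_disjoint_subfamily_covering_enlargement_closedBall
    B (fun τ => τ) (fun τ => |s τ - τ|) (b - a) hle 4 (by norm_num)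
  have hint : IntervalIntegrable (fun x => |deriv θ x|) volume a b :=
    ((hθ.lipschitzOnWith (s := uIcc a b)).absolutelyContinuousOnInterval).intervalIntegrable_deriv.abs
  have huc : u.Countable := by
    refine hdisj.countable_of_nonempty_interior fun τ hτ => ?_
    rw [interior_closedBall _ (hpos τ (huB hτ)).ne']
    exact ⟨τ, Metric.mem_ball_self (hpos τ (huB hτ))⟩
  have hint' : IntegrableOn (fun x => |deriv θ x|) (Icc a b) := by
    rwa [intervalIntegrable_iff_integrableOn_Icc_of_le hab.le] at hint
  have hone : ∀ τ ∈ u, volume (Metric.closedBall τ (4 * |s τ - τ|)) ≤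
      ENNReal.ofReal (8 / l) * ∫⁻ x in Metric.closedBall τ |s τ - τ| ∩ Icc a b,
        ENNReal.ofReal |deriv θ x| := by
    intro τ hτ
    have hτB := huB hτ
    have hsub : uIcc τ (s τ) ⊆ Metric.closedBall τ |s τ - τ| ∩ Icc a b := by
      refine subset_inter ?_ (uIcc_subset_Icc hτB.1 (hs τ hτB).1)
      intro x hx
      rw [Metric.mem_closedBall, Real.dist_eq]
      exact abs_sub_left_of_mem_uIcc hx
    have hac := (hθ.lipschitzOnWith (s := uIcc τ (s τ))).absolutelyContinuousOnInterval
    have h1 : |θ (s τ) - θ τ| ≤ ∫ x in Metric.closedBall τ |s τ - τ| ∩ Icc a b, |deriv θ x| := by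
      rw [← hac.integral_deriv_eq_sub, ← Real.norm_eq_abs]
      refine (intervalIntegral.norm_integral_le_integral_norm_uIoc).trans ?_
      refine setIntegral_mono_set (hint'.mono_set inter_subset_right)
        (ae_of_all _ fun x => abs_nonneg _) (uIoc_subset_uIcc.trans hsub).eventuallyLE
    rw [← ofReal_integral_eq_lintegral_ofReal (hint'.mono_set inter_subset_right)
      (ae_of_all _ fun x => abs_nonneg _), ← ENNReal.ofReal_mul (by positivity),
      Real.volume_closedBall]
    refine ENNReal.ofReal_le_ofReal ?_
    have h2 := (hs τ hτB).2
    rw [div_mul_eq_mul_div, le_div_iff₀ hl]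
    linarith
  calc volume B ≤ volume (⋃ τ ∈ u, Metric.closedBall τ (4 * |s τ - τ|)) := by
        refine measure_mono fun τ hτ => ?_
        obtain ⟨σ, hσ, hsub⟩ := hcov τ hτ
        exact mem_biUnion hσ (hsub (Metric.mem_closedBall_self (abs_nonneg _)))
    _ ≤ ∑' τ : u, volume (Metric.closedBall (τ : ℝ) (4 * |s τ - τ|)) :=
        measure_biUnion_le _ huc _
    _ ≤ ∑' τ : u, ENNReal.ofReal (8 / l) * ∫⁻ x in Metric.closedBall (τ : ℝ) |s τ - τ| ∩ Icc a b,
        ENNReal.ofReal |deriv θ x| := ENNReal.tsum_le_tsum fun τ => hone τ τ.2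
    _ = ENNReal.ofReal (8 / l) * ∫⁻ x in ⋃ τ ∈ u, Metric.closedBall (τ : ℝ) |s τ - τ| ∩ Icc a b,
        ENNReal.ofReal |deriv θ x| := by
        rw [ENNReal.tsum_mul_left, lintegral_biUnion huc
          (fun τ _ => Metric.isClosed_closedBall.measurableSet.inter measurableSet_Icc)
          (hdisj.mono fun τ => inter_subset_left)]
    _ ≤ ENNReal.ofReal (8 / l) * ∫⁻ x in Icc a b, ENNReal.ofReal |deriv θ x| := by
        gcongr
        exact iUnion₂_subset fun τ _ => inter_subset_right
    _ = _ := by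
        rw [ENNReal.ofReal_mul (by positivity), intervalIntegral.integral_of_le hab.le,
          ← integral_Icc_eq_integral_Ioc, ofReal_integral_eq_lintegral_ofReal hint'
          (ae_of_all _ fun x => abs_nonneg _)]

/-- A Lipschitz function with a big increment has a point of steep slope whose chords are all
controlled by the square root of that slope. -/
theorem exists_deriv_ge_chord_le {θ : ℝ → ℝ} (hθ : LipschitzWith 4 θ) {a b c d γ : ℝ}
    (hab : a < b) (hγ : 0 < γ) (hc : c ∈ Icc a b) (hd : d ∈ Icc a b) (hcd : c ≤ d)
    (hinc : 4 * γ * (b - a) ≤ θ d - θ c) (hend : -(4 * γ * (b - a)) ≤ θ b - θ a)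
    {P : ℝ → Prop} (hP : ∀ᵐ τ, P τ) :
    ∃ τ ∈ Icc (a + γ / 8 * (b - a)) (b - γ / 8 * (b - a)), P τ ∧ γ ≤ deriv θ τ ∧
      ∀ s ∈ Icc a b, |θ s - θ τ| ≤ 480 * √(deriv θ τ) * |s - τ| := by
  by_contra! hcon
  have hac : ∀ x y, AbsolutelyContinuousOnInterval θ x y := fun x y =>
    (hθ.lipschitzOnWith (s := uIcc x y)).absolutelyContinuousOnInterval
  have hd4 : ∀ x, |deriv θ x| ≤ 4 := fun x => norm_deriv_le_of_lipschitz hθ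
  have hi : ∀ x y, IntervalIntegrable (deriv θ) volume x y := fun x y =>
    (hac x y).intervalIntegrable_deriv
  have hip : ∀ k x y, IntervalIntegrable (fun t => max (deriv θ t - k) 0) volume x y :=
    fun k x y => ⟨((hi x y).1.sub (integrable_const k)).pos_part,
      ((hi x y).2.sub (integrable_const k)).pos_part⟩
  set m := ∫ x in a..b, max (deriv θ x - 0) 0 with hm
  have hm1 : 4 * γ * (b - a) ≤ m := by
    refine hinc.trans ?_
    rw [← (hac c d).integral_deriv_eq_sub]
    refine (intervalIntegral.integral_mono_on hcd (hi c d) (hip 0 c d)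
      (fun x _ => by simp)).trans ?_
    exact intervalIntegral.integral_mono_interval hc.1 hcd hd.2
      (ae_of_all _ fun x => le_max_right _ _) (hip 0 a b)
  have hab' : 0 < b - a := sub_pos.2 hab
  have hm0 : 0 < m := lt_of_lt_of_le (by positivity) hm1
  have habs : ∫ x in a..b, |deriv θ x| ≤ 3 * m := by
    have : ∫ x in a..b, |deriv θ x| = 2 * m - (θ b - θ a) := by
      rw [← (hac a b).integral_deriv_eq_sub, hm, ← intervalIntegral.integral_const_mul,
        ← intervalIntegral.integral_sub ((hip 0 a b).const_mul 2) (hi a b)]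
      refine intervalIntegral.integral_congr fun x _ => ?_
      simp only [sub_zero]
      rcases le_total 0 (deriv θ x) with h | h
      · rw [abs_of_nonneg h, max_eq_left h]; ring
      · rw [abs_of_nonpos h, max_eq_right h]; ring
    linarith
  set B : ℝ := 24 * m / 480 with hB
  set N : ℝ := γ / 4 * (b - a) with hN
  have hlevel : ∀ t ∈ Ioi (0 : ℝ), (volume.restrict (Icc a b))
      {x | t < max (deriv θ x - γ) 0} ≤
      (Ioc 0 4).indicator (fun t => ENNReal.ofReal (B * t ^ (-(1 / 2) : ℝ) + N)) t := by
    intro t ht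
    have ht : 0 < t := ht
    have hset : {x | t < max (deriv θ x - γ) 0} = {x | t + γ < deriv θ x} := by
      ext x
      simp only [mem_ofPred_eq, lt_max_iff, ht.not_gt, or_false, lt_sub_iff_add_lt]
    rw [hset]
    by_cases h4 : t ≤ 4
    · rw [indicator_of_mem (show t ∈ Ioc (0 : ℝ) 4 from ⟨ht, h4⟩)]
      have hl : 0 < 480 * √t := by positivity
      have hsub : {x | t + γ < deriv θ x} ∩ Icc a b ⊆
          ({τ ∈ Icc a b | ∃ s ∈ Icc a b, 480 * √t * |s - τ| < |θ s - θ τ|} ∪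
            (Icc a (a + γ / 8 * (b - a)) ∪ Icc (b - γ / 8 * (b - a)) b)) ∪ {x | ¬ P x} := by
        rintro x ⟨hx, hxab⟩
        simp only [mem_ofPred_eq] at hx
        by_cases hPx : P x
        · left
          by_cases h1 : x ≤ a + γ / 8 * (b - a)
          · exact Or.inr (Or.inl ⟨hxab.1, h1⟩)
          by_cases h2 : b - γ / 8 * (b - a) ≤ x
          · exact Or.inr (Or.inr ⟨h2, hxab.2⟩)
          left
          obtain ⟨s, hs, hlt⟩ := hcon x ⟨(not_le.1 h1).le, (not_le.1 h2).le⟩ hPx (by linarith)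
          refine ⟨hxab, s, hs, lt_of_le_of_lt ?_ hlt⟩
          gcongr
          linarith
        · exact Or.inr hPx
      have hMset : MeasurableSet {x | t + γ < deriv θ x} :=
        measurableSet_lt measurable_const (measurable_deriv θ)
      rw [Measure.restrict_apply hMset]
      refine (measure_mono hsub).trans ((measure_union_le _ _).trans ?_)
      rw [show volume {x | ¬ P x} = 0 from hP, add_zero]
      refine (measure_union_le _ _).trans ?_
      rw [ENNReal.ofReal_add (by positivity) (by positivity)]
      gcongr
      · refine (volume_steep_le hθ hab hl).trans (ENNReal.ofReal_le_ofReal ?_)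
        rw [Real.rpow_neg ht.le, ← Real.sqrt_eq_rpow, hB]
        calc 8 / (480 * √t) * ∫ x in a..b, |deriv θ x| ≤ 8 / (480 * √t) * (3 * m) := by gcongr
          _ = _ := by field_simp; norm_num
      · refine (measure_union_le _ _).trans ?_
        rw [Real.volume_Icc, Real.volume_Icc, ← ENNReal.ofReal_add
          (by ring_nf; nlinarith) (by ring_nf; nlinarith)]
        exact ENNReal.ofReal_le_ofReal (by rw [hN]; linarith)
    · have : {x | t + γ < deriv θ x} = ∅ := by
        refine eq_empty_of_forall_notMem fun x hx => ?_
        have := (abs_le.1 (hd4 x)).2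
        simp only [mem_ofPred_eq] at hx
        linarith
      rw [this]; simp
  have hlc := lintegral_eq_lintegral_meas_lt (volume.restrict (Icc a b))
    (f := fun x => max (deriv θ x - γ) 0) (ae_of_all _ fun x => le_max_right _ _)
    (((measurable_deriv θ).sub_const γ).max measurable_const).aemeasurable
  have hii : IntervalIntegrable (fun t : ℝ => B * t ^ (-(1 / 2) : ℝ) + N) volume 0 4 :=
    ((intervalIntegral.intervalIntegrable_rpow' (by norm_num)).const_mul B).add
      intervalIntegrable_const
  have hnn : 0 ≤ᵐ[volume.restrict (Ioc (0 : ℝ) 4)] fun t : ℝ => B * t ^ (-(1 / 2) : ℝ) + N := by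
    filter_upwards [ae_restrict_mem measurableSet_Ioc] with t ht
    have := Real.rpow_nonneg ht.1.le (-(1 / 2))
    have : 0 ≤ B := by positivity
    have : 0 ≤ N := by positivity
    simp only [Pi.zero_apply]; positivity
  have hig : Integrable (fun x => max (deriv θ x - γ) 0) (volume.restrict (Icc a b)) :=
    (intervalIntegrable_iff_integrableOn_Icc_of_le hab.le).1 (hip γ a b)
  have hig0 : 0 ≤ᵐ[volume.restrict (Icc a b)] fun x => max (deriv θ x - γ) 0 :=
    ae_of_all _ fun x => le_max_right _ _
  have hupper : ENNReal.ofReal (∫ x in a..b, max (deriv θ x - γ) 0) ≤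
      ENNReal.ofReal (∫ t in (0 : ℝ)..4, (B * t ^ (-(1 / 2) : ℝ) + N)) := by
    rw [intervalIntegral.integral_of_le hab.le, ← integral_Icc_eq_integral_Ioc,
      intervalIntegral.integral_of_le (by norm_num),
      ofReal_integral_eq_lintegral_ofReal hig hig0, hlc,
      ofReal_integral_eq_lintegral_ofReal hii.1 hnn]
    refine (setLIntegral_mono_ae' measurableSet_Ioi (ae_of_all _ hlevel)).trans ?_
    rw [lintegral_indicator measurableSet_Ioc, Measure.restrict_restrict measurableSet_Ioc]
    exact lintegral_mono_set inter_subset_left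
  have hval : ∫ t in (0 : ℝ)..4, (B * t ^ (-(1 / 2) : ℝ) + N) = 4 * B + 4 * N := by
    rw [intervalIntegral.integral_add
      ((intervalIntegral.intervalIntegrable_rpow' (by norm_num)).const_mul B)
      intervalIntegrable_const, intervalIntegral.integral_const_mul,
      integral_rpow (Or.inl (by norm_num))]
    have : (4 : ℝ) ^ ((1 : ℝ) / 2) = 2 := by
      rw [← Real.sqrt_eq_rpow, show (4 : ℝ) = 2 ^ 2 by norm_num, Real.sqrt_sq (by norm_num)]
    rw [show (-(1 / 2) + 1 : ℝ) = 1 / 2 by norm_num, this]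
    norm_num; ring
  have hlower : m - γ * (b - a) ≤ ∫ x in a..b, max (deriv θ x - γ) 0 := by
    have : m - γ * (b - a) = ∫ x in a..b, (max (deriv θ x - 0) 0 - γ) := by
      rw [intervalIntegral.integral_sub (hip 0 a b) intervalIntegrable_const,
        intervalIntegral.integral_const, smul_eq_mul]
      ring
    rw [this]
    refine intervalIntegral.integral_mono_on hab.le
      ((hip 0 a b).sub intervalIntegrable_const) (hip γ a b) fun x _ => ?_
    rw [sub_zero]
    rcases le_total 0 (deriv θ x) with h | h
    · rw [max_eq_left h]; exact le_max_left _ _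
    · rw [max_eq_right h]; exact le_trans (by linarith) (le_max_right _ _)
  have hBN : 0 ≤ 4 * B + 4 * N := by positivity
  rw [hval, ENNReal.ofReal_le_ofReal_iff hBN] at hupper
  rw [hB, hN] at hupper
  linarith

end SteepChords

section Differentiability

theorem third_mul_le_sqrt_add_sub {a g : ℝ} (ha : 0 ≤ a) (ha1 : a ≤ 1) (hg : 0 ≤ g) (hg1 : g ≤ 1) :
    g / 3 ≤ √(a + g) - √a := by
  have h1 : √(a + g) ≤ 3 / 2 := Real.sqrt_le_iff.2 ⟨by norm_num, by linarith⟩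
  have h2 : √a ≤ √(a + g) := Real.sqrt_le_sqrt (by linarith)
  have h3 := Real.sq_sqrt ha
  have h4 := Real.sq_sqrt (add_nonneg ha hg)
  nlinarith [Real.sqrt_nonneg a]



theorem LipschitzWith.abs_sub_le_norm {H : Type*} [NormedAddCommGroup H] {f : H → ℝ} (hf : LipschitzWith 1 f) (x y : H) :
    |f x - f y| ≤ ‖x - y‖ := by
  simpa [Real.dist_eq, dist_eq_norm] using hf.dist_le_mul x y

variable {H : Type*} [NormedAddCommGroup H] [InnerProductSpace ℝ H]

theorem HasLineDerivAt.eventually_abs_sub_le {f : H → ℝ} {p : ℝ} {x e : H}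
    (h : HasLineDerivAt ℝ f p x e) {c : ℝ} (hc : 0 < c) :
    ∀ᶠ t : ℝ in 𝓝 0, |f (x + t • e) - f x - t * p| ≤ c * |t| := by
  have := (hasLineDerivAt_iff_isLittleO_nhds_zero.1 h).def hc
  simpa [Real.norm_eq_abs] using this

/-- Approximate maximisation of directional derivatives, in the spirit of Preiss. -/
theorem exists_extremal_lineDeriv [CompleteSpace H] {f : H → ℝ} (hf : LipschitzWith 1 f) (x₀ : H)
    {r : ℝ} (hr : 0 < r) :
    ∃ (x e q : H) (p : ℝ), ‖x - x₀‖ ≤ 2 * r ∧ ‖e‖ ≤ 1 ∧ ‖q‖ ≤ 6 ∧ HasLineDerivAt ℝ f p x e ∧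
      ∀ g₀ > 0, ∀ᶠ Δ in 𝓝[>] (0 : ℝ), ∀ᶠ y in 𝓝 x, ∀ h g, g₀ ≤ g →
        HasLineDerivAt ℝ f (p + inner ℝ q h + 3 * ‖h‖ ^ 2 + g) y (e + h) →
        ∃ s, |s| ≤ Δ ∧ 500 * √g * |s| < |f (y + s • e) - f y - s * p| := by
  let α := {w : H × H × ℝ // HasLineDerivAt ℝ f w.2.2 w.1 w.2.1}
  let R : ℕ → α → α → ℝ → Prop := fun k z w g =>
    ‖w.1.1 - z.1.1‖ ≤ r * (1 / 2) ^ k * (1 + g) ∧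
      ∀ t : ℝ, |f (w.1.1 + t • z.1.2.1) - f w.1.1 - (f (z.1.1 + t • z.1.2.1) - f z.1.1)| ≤
        (500 * √g + 10 * (1 / 2) ^ k) * |t|
  have hΨ1 : ∀ w : α, w.1.2.2 - ‖w.1.2.1‖ ^ 2 ≤ 1 := fun w => by
    have := w.2.le_of_lipschitz hf
    rw [Real.norm_eq_abs, NNReal.coe_one, one_mul] at this
    nlinarith [le_abs_self w.1.2.2, sq_nonneg (‖w.1.2.1‖ - 1 / 2)]
  obtain ⟨z, e, q, V, L, S, hz0, hV0, hVm, hVL, hL1, hq, he, hS, hRz, hnn, hmax⟩ :=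
    exists_penalized_limit (π := fun w : α => w.1.2.1) (Ψ := fun w : α => w.1.2.2 - ‖w.1.2.1‖ ^ 2)
      (R := R)
      (fun k z w a b hab h => ⟨h.1.trans (by gcongr), fun t => (h.2 t).trans (by gcongr)⟩)
      (fun k z => ⟨by simp only [sub_self, norm_zero]; positivity, fun t => by
        simp only [sub_self, abs_zero]; positivity⟩)
      ⟨(x₀, 0, 0), by simpa using (hasLineDerivAt_zero (𝕜 := ℝ) (f := f) (x := x₀))⟩
      (fun w => (hΨ1 w).trans (by simp))
  have hz01 : (z 0).1 = (x₀, 0, 0) := by rw [hz0]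
  simp only [norm_zero, ne_eq, OfNat.ofNat_ne_zero, not_false_eq_true, zero_pow, sub_zero,
    zero_add] at hV0 hL1
  have hVle : ∀ k, V k ≤ L := hVm.ge_of_tendsto hVL
  have hV0' : ∀ k, 0 ≤ V k := fun k => hV0 ▸ hVm (Nat.zero_le k)
  have hpow : Tendsto (fun k : ℕ => ((1 : ℝ) / 2) ^ k) atTop (𝓝 0) :=
    tendsto_pow_atTop_nhds_zero_of_lt_one (by norm_num) (by norm_num)
  have ha : ∀ k, 0 ≤ L - V k ∧ L - V k ≤ 1 := fun k =>
    ⟨sub_nonneg.2 (hVle k), by linarith [hV0' k]⟩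
  have he1 : ‖e‖ ≤ 1 := by simpa [hz01] using he 0
  have hxn : ∀ k n, k < n → ‖(z n).1.1 - (z k).1.1‖ ≤ r * (1 / 2) ^ k * (1 + (L - V k)) :=
    fun k n h => (hRz k n h).1.trans (by gcongr; exact hVle n)
  obtain ⟨x, hx⟩ : ∃ x, Tendsto (fun n => (z n).1.1) atTop (𝓝 x) := by
    refine cauchySeq_tendsto_of_complete (cauchySeq_of_le_geometric (1 / 2) (r * 2)
      (by norm_num) fun n => ?_)
    rw [dist_comm, dist_eq_norm]
    refine (hxn n (n + 1) n.lt_succ_self).trans ?_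
    rw [mul_right_comm]
    have := (ha n).2
    gcongr
    linarith
  have hxk : ∀ k, ‖x - (z k).1.1‖ ≤ r * (1 / 2) ^ k * (1 + (L - V k)) := fun k =>
    le_of_tendsto ((hx.sub_const _).norm) ((eventually_gt_atTop k).mono fun n hn => hxn k n hn)
  have hinc : ∀ k (t : ℝ), |f (x + t • (z k).1.2.1) - f x -
      (f ((z k).1.1 + t • (z k).1.2.1) - f (z k).1.1)| ≤
      (500 * √(L - V k) + 10 * (1 / 2) ^ k) * |t| := fun k t => by
    refine le_of_tendsto (x := atTop) (f := fun n => |f ((z n).1.1 + t • (z k).1.2.1) - f (z n).1.1 -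
      (f ((z k).1.1 + t • (z k).1.2.1) - f (z k).1.1)|) ?_ ?_
    · exact ((((hf.continuous.tendsto _).comp (hx.add_const _)).sub
        ((hf.continuous.tendsto _).comp hx)).sub_const _).abs
    · filter_upwards [eventually_gt_atTop k] with n hn
      refine ((hRz k n hn).2 t).trans ?_
      gcongr
      exact hVle n
  set p := L + S + ‖e‖ ^ 2 with hp
  have hpk : ∀ k, |p - (z k).1.2.2| ≤ (L - V k) + 7 * (1 / 2) ^ k := fun k => by
    have h1 := abs_le.1 (hS k)
    have h2 := he k
    have h3 := norm_sub_norm_le e (z k).1.2.1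
    have h4 := norm_sub_norm_le (z k).1.2.1 e
    rw [norm_sub_rev] at h4
    have h5 : ((1 : ℝ) / 2) ^ k ≤ 1 := pow_le_one₀ (by norm_num) (by norm_num)
    have h6 := norm_nonneg e
    have h7 := norm_nonneg (z k).1.2.1
    have h9 : |‖e‖ ^ 2 - ‖(z k).1.2.1‖ ^ 2| ≤ 3 * (1 / 2) ^ k := by
      rw [show ‖e‖ ^ 2 - ‖(z k).1.2.1‖ ^ 2 = (‖e‖ + ‖(z k).1.2.1‖) * (‖e‖ - ‖(z k).1.2.1‖) by ring,
        abs_mul, abs_of_nonneg (by positivity)]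
      have : |‖e‖ - ‖(z k).1.2.1‖| ≤ (1 / 2) ^ k := abs_le.2 ⟨by linarith, by linarith⟩
      gcongr
      linarith
    have h10 := abs_le.1 h9
    have := (ha k).1
    rw [hp, abs_le]
    constructor <;> linarith [h1.1, h1.2, h10.1, h10.2]
  have hshift : ∀ k y (t : ℝ), |f (y + t • e) - f (y + t • (z k).1.2.1)| ≤ (1 / 2) ^ k * |t| := by
    intro k y t
    refine (hf.abs_sub_le_norm _ _).trans ?_
    rw [add_sub_add_left_eq_sub, ← smul_sub, norm_smul, Real.norm_eq_abs, mul_comm]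
    gcongr
    exact he k
  have hxp : HasLineDerivAt ℝ f p x e := by
    rw [hasLineDerivAt_iff_isLittleO_nhds_zero, Asymptotics.isLittleO_iff]
    intro c hc
    have hlim : Tendsto (fun k => 500 * √(L - V k) + (L - V k) + 19 * (1 / 2) ^ k) atTop
        (𝓝 0) := by
      have h1 : Tendsto (fun k => L - V k) atTop (𝓝 0) := by
        simpa using (tendsto_const_nhds (x := L)).sub hVL
      simpa using ((h1.sqrt.const_mul 500).add h1).add (hpow.const_mul 19)
    obtain ⟨k, hk⟩ := ((tendsto_order.1 hlim).2 c hc).exists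
    filter_upwards [(z k).2.eventually_abs_sub_le (c := (1 / 2) ^ k) (by positivity)] with t ht
    rw [smul_eq_mul, Real.norm_eq_abs, Real.norm_eq_abs]
    have h1 := hinc k t
    have h2 := hshift k x t
    have h3 : |t * (p - (z k).1.2.2)| ≤ |t| * ((L - V k) + 7 * (1 / 2) ^ k) := by
      rw [abs_mul]; gcongr; exact hpk k
    have h4 : (500 * √(L - V k) + (L - V k) + 19 * (1 / 2) ^ k) * |t| ≤ c * |t| := by gcongr
    rw [abs_le] at *
    constructor <;> linarith [h1.1, h1.2, h2.1, h2.2, h3.1, h3.2, ht.1, ht.2]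
  refine ⟨x, e, q + (2 : ℝ) • e, p, ?_, he1, ?_, hxp, ?_⟩
  · have := hxk 0
    simp only [hz01, pow_zero, mul_one] at this
    refine this.trans ?_
    have := (ha 0).2
    rw [mul_comm 2]
    gcongr
    linarith
  · refine (norm_add_le _ _).trans ?_
    rw [norm_smul, Real.norm_ofNat]
    linarith
  intro g₀ hg₀
  obtain ⟨n, hn⟩ := exists_pow_lt_of_lt_one hg₀ (show (1 / 8 : ℝ) < 1 by norm_num)
  have hev : ∀ᶠ Δ in 𝓝[>] (0 : ℝ), ∀ k < n, ∀ t : ℝ, |t| ≤ Δ →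
      |f ((z k).1.1 + t • (z k).1.2.1) - f (z k).1.1 - t * (z k).1.2.2| ≤ (1 / 2) ^ k * |t| := by
    refine (eventually_all_finite (Set.finite_lt_nat n)).2 fun k _ => ?_
    obtain ⟨δ, hδ, h⟩ := Metric.eventually_nhds_iff.1
      ((z k).2.eventually_abs_sub_le (c := (1 / 2) ^ k) (by positivity))
    filter_upwards [Ioo_mem_nhdsGT hδ] with Δ hΔ t ht
    exact h (by simpa [Real.dist_eq] using ht.trans_lt hΔ.2)
  filter_upwards [hev, self_mem_nhdsWithin] with Δ hΔ hΔ0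
  have hΔ0 : 0 < Δ := hΔ0
  filter_upwards [Metric.ball_mem_nhds x (show 0 < Δ * g₀ by positivity),
    Metric.ball_mem_nhds x (show 0 < r * (1 / 2) ^ n * g₀ by positivity)] with y hy1 hy2 h g hg hw
  rw [Metric.mem_ball, dist_eq_norm] at hy1 hy2
  by_contra! hcon
  have hval : (p + inner ℝ (q + (2 : ℝ) • e) h + 3 * ‖h‖ ^ 2 + g) - ‖e + h‖ ^ 2 -
      (S + inner ℝ q (e + h - e) + 2 * ‖e + h - e‖ ^ 2) = L + g := by
    rw [add_sub_cancel_left, norm_add_sq_real, inner_add_left, inner_smul_left, hp]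
    simp only [RCLike.conj_to_real]
    ring
  have hg1 : g ≤ 1 := by
    have h1 := hnn (e + h)
    have h2 := hΨ1 ⟨(y, e + h, _), hw⟩
    simp only at h2
    linarith [hVle 0, hV0' 0]
  have hg0 : 0 ≤ g := hg₀.le.trans hg
  have hfin := hmax ⟨(y, e + h, _), hw⟩ n fun k hk => by
    simp only [hval]
    obtain ⟨ha0, ha1⟩ := ha k
    have hka : L + g - V k = (L - V k) + g := by ring
    refine ⟨by linarith, ?_, fun t => ?_⟩
    · simp only [hka]
      have h1 : r * (1 / 2) ^ n * g₀ ≤ r * (1 / 2) ^ k * g := by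
        gcongr ?_ * ?_ * ?_
        exact pow_le_pow_of_le_one (by norm_num) (by norm_num) hk.le
      have h2 := norm_sub_le_norm_sub_add_norm_sub y x (z k).1.1
      have h3 := hxk k
      linarith
    · simp only [hka]
      rcases le_or_gt |t| Δ with ht | ht
      · have h1 := hshift k y t
        have h2 := hcon t ht
        have h3 : |t * (p - (z k).1.2.2)| ≤ |t| * ((L - V k) + 7 * (1 / 2) ^ k) := by
          rw [abs_mul]; gcongr; exact hpk k
        have h4 := hΔ k hk t ht
        have h5 := third_mul_le_sqrt_add_sub hg0 hg1 ha0 ha1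
        have h6 : (500 * √g + (L - V k) + 9 * (1 / 2) ^ k) * |t| ≤
            (500 * √((L - V k) + g) + 10 * (1 / 2) ^ k) * |t| := by
          have : (0 : ℝ) < (1 / 2) ^ k := by positivity
          rw [add_comm g] at h5
          gcongr ?_ * _
          linarith
        rw [abs_le] at h1 h2 h3 h4 ⊢
        constructor <;> linarith [h1.1, h1.2, h2.1, h2.2, h3.1, h3.2, h4.1, h4.2]
      · have h1 := hinc k t
        have h2 := hf.abs_sub_le_norm (y + t • (z k).1.2.1) (x + t • (z k).1.2.1)
        rw [add_sub_add_right_eq_sub] at h2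
        have h3 := hf.abs_sub_le_norm y x
        have h5 := third_mul_le_sqrt_add_sub ha0 ha1 hg0 hg1
        have h7 : Δ * g₀ ≤ |t| * g := by gcongr
        have h8 := mul_le_mul_of_nonneg_right h5 (abs_nonneg t)
        rw [abs_le] at h1 h2 h3 ⊢
        have h9 := abs_nonneg t
        have h10 : 0 ≤ g * |t| := by positivity
        constructor <;> linarith [h1.1, h1.2, h2.1, h2.2, h3.1, h3.2]
  simp only [hval] at hfin
  linarith

theorem abs_tent_sub_le {f : H → ℝ} (hf : LipschitzWith 1 f) (x e h : H) (t s s' : ℝ) :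
    |f (x + s' • e + (t - |s'|) • h) - f (x + s' • e + (t - |s|) • h)| ≤ ‖h‖ * |s' - s| := by
  refine (hf.abs_sub_le_norm _ _).trans ?_
  rw [add_sub_add_left_eq_sub, ← sub_smul, norm_smul, mul_comm, Real.norm_eq_abs,
    sub_sub_sub_cancel_left, abs_sub_comm s' s]
  exact mul_le_mul_of_nonneg_left (abs_abs_sub_abs_le s s') (norm_nonneg h)

theorem lipschitzWith_tent {f : H → ℝ} (hf : LipschitzWith 1 f) {x e h : H} {p η t I m : ℝ}
    (he : ‖e‖ ≤ 1) (hp : |p| ≤ 1) (hη : η ≤ 1 / 12) (hh : ‖h‖ ≤ η) (hI : |I| ≤ 6 * η) (hm : |m| ≤ η) :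
    LipschitzWith 4 fun s => f (x + s • e + (t - |s|) • h) - f x - s * p - I * (t - |s|) -
      m * (s + t) := by
  refine LipschitzWith.of_dist_le_mul fun s' s => ?_
  rw [Real.dist_eq, Real.dist_eq]
  push_cast
  have h1 : _ ≤ 1 / 12 * |s' - s| := (abs_tent_sub_le hf x e h t s s').trans (by gcongr; linarith)
  have h2 : |f (x + s' • e + (t - |s|) • h) - f (x + s • e + (t - |s|) • h)| ≤ |s' - s| * 1 := by
    refine (hf.abs_sub_le_norm _ _).trans ?_
    rw [add_sub_add_right_eq_sub, add_sub_add_left_eq_sub, ← sub_smul, norm_smul,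
      Real.norm_eq_abs]
    gcongr
  have h4 : |(s' - s) * p| ≤ |s' - s| * 1 := by rw [abs_mul]; gcongr
  have h5 : |I * (|s| - |s'|)| ≤ 6 * (1 / 12) * |s' - s| := by
    rw [abs_mul, abs_sub_comm s' s]
    exact mul_le_mul (by linarith) (abs_abs_sub_abs_le s s') (abs_nonneg _) (by norm_num)
  have h6 : |m * (s' - s)| ≤ 1 / 12 * |s' - s| := by
    rw [abs_mul]; gcongr; linarith
  rw [abs_le] at h1 h2 h4 h5 h6 ⊢
  constructor <;> linarith [abs_nonneg (s' - s), h1.1, h1.2, h2.1, h2.2, h4.1, h4.2, h5.1,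
    h5.2, h6.1, h6.2]

/-- Chord bounds on a short segment extend to a longer one along which `f` is almost linear. -/
theorem abs_chord_le_of_le {f : H → ℝ} (hf : LipschitzWith 1 f) {x e h : H} {p η t Δ τ G : ℝ}
    (hη : 0 < η) (hη1 : η ≤ 1 / 12) (hh : ‖h‖ = η) (hG : η ≤ G)
    (hρ : ∀ s, |s| ≤ Δ + t → |f (x + s • e) - f x - s * p| ≤ η ^ 3 / 16 * |s|) (hΔ : 0 < Δ)
    (hτt : |τ| ≤ t - η ^ 2 / 4 * t) (ht : 0 < t)
    (hsub : ∀ s, |τ + s| ≤ t → |f (x + τ • e + (t - |τ|) • h + s • e) -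
      f (x + τ • e + (t - |τ|) • h) - s * p| ≤ 490 * G * |s|) (s : ℝ) (hs : |s| ≤ Δ) :
    |f (x + τ • e + (t - |τ|) • h + s • e) - f (x + τ • e + (t - |τ|) • h) - s * p| ≤
      500 * G * |s| := by
  have hτt' : |τ| ≤ t := hτt.trans (by linarith [show 0 ≤ η ^ 2 / 4 * t by positivity])
  have hmove : ∀ (s : ℝ), |f (x + s • e + (t - |τ|) • h) - f (x + s • e)| ≤ (t - |τ|) * η := by
    intro s
    refine (hf.abs_sub_le_norm _ _).trans ?_
    rw [add_sub_cancel_left, norm_smul, hh, Real.norm_eq_abs,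
      abs_of_nonneg (sub_nonneg.2 hτt')]
  set y := x + τ • e + (t - |τ|) • h with hy
  rcases le_or_gt |τ + s| t with hin | hout
  · refine (hsub s hin).trans ?_
    have : 0 ≤ G := hη.le.trans hG
    gcongr
    norm_num
  obtain ⟨E, hE, hEs, hEt⟩ : ∃ E, |E| = t ∧ |E - τ| ≤ |s| ∧ t - |τ| ≤ |E - τ| := by
    rcases lt_abs.1 hout with h | h
    · refine ⟨t, abs_of_pos ht, ?_, ?_⟩
      · rw [abs_of_nonneg (by linarith [le_abs_self τ])]
        linarith [le_abs_self s]
      · have := le_abs_self (t - τ)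
        linarith [le_abs_self τ]
    · refine ⟨-t, by rw [abs_neg, abs_of_pos ht], ?_, ?_⟩
      · rw [abs_of_nonpos (by linarith [neg_abs_le τ])]
        linarith [neg_abs_le s]
      · have := neg_abs_le (-t - τ)
        linarith [neg_abs_le τ]
  have h1 := hsub (E - τ) (by rw [add_sub_cancel, hE])
  have hG0 : 0 ≤ G := hη.le.trans hG
  have h2 : 490 * G * |E - τ| ≤ 490 * G * |s| := by gcongr
  have hd : (t - |τ|) * η ≤ |s| * η := by gcongr; linarith
  have h3 := hmove (τ + s)
  have h4 := hmove E
  have h5 := hρ (τ + s) ((abs_add_le _ _).trans (by linarith))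
  have h6 := hρ E (by rw [hE]; linarith)
  have h7 : η ^ 3 / 16 * |τ + s| ≤ η ^ 3 / 16 * (t + |s|) := by
    gcongr; exact (abs_add_le _ _).trans (by linarith)
  have h8 : η ^ 3 / 16 * (2 * t + |s|) ≤ η * |s| := by
    have : η ^ 2 / 4 * t ≤ |s| := by linarith
    have h9 := mul_le_mul_of_nonneg_left this hη.le
    have h10 : η ^ 3 * |s| ≤ η * |s| := by gcongr; nlinarith
    nlinarith [mul_nonneg hη.le (abs_nonneg s)]
  have h9 : η * |s| ≤ G * |s| := by gcongr
  have e1 : y + s • e = x + (τ + s) • e + (t - |τ|) • h := by rw [hy]; module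
  have e2 : y + (E - τ) • e = x + E • e + (t - |τ|) • h := by rw [hy]; module
  rw [e2] at h1
  rw [e1]
  rw [hE] at h6
  rw [abs_le] at h1 h3 h4 h5 h6 ⊢
  constructor <;> linarith [abs_nonneg s, h1.1, h1.2, h3.1, h3.2, h4.1, h4.2, h5.1, h5.2,
    h6.1, h6.2]

theorem exists_steep_lineDeriv {f : H → ℝ} (hf : LipschitzWith 1 f) {x e q h : H} {p η t Δ : ℝ}
    (he : ‖e‖ ≤ 1) (hq : ‖q‖ ≤ 6) (hp : |p| ≤ 1) (hη : 0 < η) (hη1 : η ≤ 1 / 12) (ht : 0 < t)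
    (hh : ‖h‖ = η)
    (hρ : ∀ s, |s| ≤ Δ + t → |f (x + s • e) - f x - s * p| ≤ η ^ 3 / 16 * |s|) (hΔ : 0 < Δ)
    (hbad : 12 * η ^ 2 * t < |f (x + t • h) - f x - t * inner ℝ q h|) :
    ∃ y, ‖y - x‖ ≤ t ∧ ∃ h' g, η ^ 2 ≤ g ∧
      HasLineDerivAt ℝ f (p + inner ℝ q h' + 3 * ‖h'‖ ^ 2 + g) y (e + h') ∧
      ∀ s, |s| ≤ Δ → |f (y + s • e) - f y - s * p| ≤ 500 * √g * |s| := by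
  set I := (inner ℝ q h : ℝ) with hI
  have hIle : |I| ≤ 6 * η := (abs_real_inner_le_norm q h).trans (by rw [hh]; gcongr)
  have hη2 : η ^ 2 ≤ η / 12 := by nlinarith
  set θ : ℝ → ℝ := fun s => f (x + s • e + (t - |s|) • h) - f x - s * p - I * (t - |s|) -
    3 * η ^ 2 * (s + t) with hθ
  have habs : ∀ s s' : ℝ, |I * (t - |s'|) - I * (t - |s|)| ≤ 6 * η * |s' - s| := by
    intro s s'
    rw [← mul_sub, abs_mul, sub_sub_sub_cancel_left, abs_sub_comm s' s]
    exact mul_le_mul hIle (abs_abs_sub_abs_le s s') (abs_nonneg _) (by positivity)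
  have hlip : LipschitzWith 4 θ := lipschitzWith_tent hf he hp hη1 hh.le hIle
    (by rw [abs_of_nonneg (by positivity)]; linarith)
  have hκ : η ^ 3 / 16 * t ≤ η ^ 2 * t := by gcongr; nlinarith [sq_nonneg η]
  have hm : θ (-t) = f (x + (-t) • e) - f x - (-t) * p := by
    simp only [hθ, abs_neg, abs_of_pos ht, sub_self, zero_smul, add_zero]; ring
  have hpl : θ t = f (x + t • e) - f x - t * p - 6 * η ^ 2 * t := by
    simp only [hθ, abs_of_pos ht, sub_self, zero_smul, add_zero]; ring
  have h0 : θ 0 = f (x + t • h) - f x - t * I - 3 * η ^ 2 * t := by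
    simp only [hθ, abs_zero, sub_zero, zero_smul, add_zero]; ring
  have hρm := abs_le.1 (hρ (-t) (by rw [abs_neg, abs_of_pos ht]; linarith))
  have hρp := abs_le.1 (hρ t (by rw [abs_of_pos ht]; linarith))
  rw [abs_neg, ← hm] at hρm
  rw [abs_of_pos ht] at hρm hρp
  obtain ⟨c, d, hc, hd, hcd, hinc⟩ : ∃ c d, c ∈ Set.Icc (-t) t ∧ d ∈ Set.Icc (-t) t ∧ c ≤ d ∧
      4 * η ^ 2 * (t - (-t)) ≤ θ d - θ c := by
    rcases lt_abs.1 hbad with h | h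
    · exact ⟨-t, 0, ⟨le_rfl, by linarith⟩, ⟨by linarith, ht.le⟩, by linarith,
        by linarith [hρm.1, hρm.2]⟩
    · exact ⟨0, t, ⟨by linarith, ht.le⟩, ⟨by linarith, le_rfl⟩, ht.le,
        by linarith [hρp.1, hρp.2]⟩
  obtain ⟨τ, hτ, ⟨hτ0, hτd⟩, hg, hch⟩ := exists_deriv_ge_chord_le hlip (a := -t) (b := t)
    (by linarith) (by positivity : 0 < η ^ 2) hc hd hcd hinc
    (by linarith [hρm.1, hρm.2, hρp.1, hρp.2]) (P := fun τ => τ ≠ 0 ∧ DifferentiableAt ℝ θ τ)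
    ((MeasureTheory.Measure.ae_ne _ 0).and hlip.ae_differentiableAt)
  set g := deriv θ τ with hgdef
  have hτt : |τ| ≤ t - η ^ 2 / 4 * t := abs_le.2 ⟨by linarith [hτ.1], by linarith [hτ.2]⟩
  have hτt' : |τ| ≤ t := hτt.trans (by linarith [show 0 ≤ η ^ 2 / 4 * t by positivity])
  have hηg : η ≤ √g := Real.le_sqrt_of_sq_le hg
  set y := x + τ • e + (t - |τ|) • h with hy
  have hysub : ∀ s, |τ + s| ≤ t → |f (y + s • e) - f y - s * p| ≤ 490 * √g * |s| := by
    intro s hs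
    have h1 := hch (τ + s) (abs_le.1 hs)
    have h2 := abs_tent_sub_le hf x e h t τ (τ + s)
    have h3 := habs τ (τ + s)
    rw [add_sub_cancel_left] at h1 h2 h3
    rw [hh] at h2
    have h4 : |3 * η ^ 2 * s| ≤ 3 * (η / 12) * |s| := by
      rw [abs_mul, abs_of_nonneg (by positivity)]; gcongr
    have h5 : η * |s| ≤ √g * |s| := by gcongr
    have h6 : y + s • e = x + (τ + s) • e + (t - |τ|) • h := by rw [hy]; module
    rw [h6]
    simp only [hθ] at h1
    rw [abs_le] at h1 h2 h3 h4 ⊢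
    constructor <;> linarith [abs_nonneg s, h1.1, h1.2, h2.1, h2.2, h3.1, h3.2, h4.1, h4.2]
  obtain ⟨σ, hσ, hσev⟩ : ∃ σ : ℝ, |σ| = 1 ∧ ∀ᶠ s in 𝓝 τ, |s| = σ * s := by
    rcases hτ0.lt_or_gt with h | h
    · exact ⟨-1, by simp, by
        filter_upwards [Iio_mem_nhds h] with s hs; rw [abs_of_neg hs]; ring⟩
    · exact ⟨1, by simp, by
        filter_upwards [Ioi_mem_nhds h] with s hs; rw [abs_of_pos hs]; ring⟩
  refine ⟨y, ?_, (-σ) • h, g, hg, ?_, ?_⟩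
  · rw [hy, add_assoc, add_sub_cancel_left]
    refine (norm_add_le _ _).trans ?_
    rw [norm_smul, norm_smul, hh, Real.norm_eq_abs, Real.norm_eq_abs,
      abs_of_nonneg (sub_nonneg.2 hτt')]
    have h1 : |τ| * ‖e‖ ≤ |τ| * 1 := by gcongr
    have h2 : (t - |τ|) * η ≤ (t - |τ|) * 1 :=
      mul_le_mul_of_nonneg_left (by linarith) (sub_nonneg.2 hτt')
    linarith
  · rw [norm_smul, norm_neg, Real.norm_eq_abs, hσ, one_mul, hh, inner_smul_right, ← hI]
    have h1 : HasDerivAt (fun s => θ s + f x + s * p + I * (t - σ * s) + 3 * η ^ 2 * (s + t))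
        (g + 1 * p + I * (-(σ * 1)) + 3 * η ^ 2 * 1) τ :=
      (((hτd.hasDerivAt.add_const (f x)).add ((hasDerivAt_id τ).mul_const p)).add
        ((((hasDerivAt_id τ).const_mul σ).const_sub t).const_mul I)).add
        (((hasDerivAt_id τ).add_const t).const_mul (3 * η ^ 2))
    have h2 : HasDerivAt (fun s => f (x + s • e + (t - σ * s) • h))
        (p + -σ * I + 3 * η ^ 2 + g) τ := by
      refine (h1.congr_deriv (by ring)).congr_of_eventuallyEq ?_
      filter_upwards [hσev] with s hs
      simp only [hθ, hs]
      ring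
    rw [← add_zero τ] at h2
    have h3 := h2.comp_const_add τ 0
    refine h3.congr_of_eventuallyEq (Eventually.of_forall fun r => ?_)
    simp only [hy, hσev.self_of_nhds]
    congr 1
    module
  · exact abs_chord_le_of_le hf hη hη1 hh hηg hρ hΔ hτt ht hysub

theorem LipschitzWith.exists_differentiableAt_near [CompleteSpace H] {f : H → ℝ}
    (hf : LipschitzWith 1 f) (x₀ : H) {r : ℝ} (hr : 0 < r) :
    ∃ x, ‖x - x₀‖ ≤ 2 * r ∧ DifferentiableAt ℝ f x := by
  obtain ⟨x, e, q, p, hx, he, hq, hxp, hext⟩ := exists_extremal_lineDeriv hf x₀ hr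
  refine ⟨x, hx, (innerSL ℝ q : H →L[ℝ] ℝ), ?_⟩
  have hp : |p| ≤ 1 := by
    have := hxp.le_of_lipschitz hf
    rw [Real.norm_eq_abs, NNReal.coe_one, one_mul] at this
    exact this.trans he
  rw [hasFDerivAt_iff_isLittleO_nhds_zero, Asymptotics.isLittleO_iff]
  intro ε hε
  set η := min ε 1 / 12 with hη
  have hη0 : 0 < η := by positivity
  have hη1 : η ≤ 1 / 12 := by rw [hη]; gcongr; exact min_le_right _ _
  have hηε : 12 * η ≤ ε := by rw [hη]; linarith [min_le_left ε 1]
  obtain ⟨δ, hδ, hρ⟩ := Metric.eventually_nhds_iff.1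
    (hxp.eventually_abs_sub_le (c := η ^ 3 / 16) (by positivity))
  obtain ⟨Δ, hΔ, hΔ0, hΔδ⟩ := ((hext (η ^ 2) (by positivity)).and
    (Ioo_mem_nhdsGT (show 0 < δ / 2 by positivity))).exists
  obtain ⟨δ', hδ', hy⟩ := Metric.eventually_nhds_iff.1 hΔ
  filter_upwards [Metric.ball_mem_nhds (0 : H) (show 0 < η * min (δ / 2) δ' by positivity)]
    with v hv
  rw [mem_ball_zero_iff] at hv
  by_contra! hbad
  have hv0 : v ≠ 0 := by rintro rfl; simp at hbad
  have hvn : 0 < ‖v‖ := norm_pos_iff.2 hv0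
  set t := ‖v‖ / η with ht
  have ht0 : 0 < t := by positivity
  have htlt : t < min (δ / 2) δ' := by rwa [ht, div_lt_iff₀' hη0]
  have htv : t • ((η / ‖v‖) • v) = v := by
    rw [smul_smul, ht, div_mul_div_cancel₀ hη0.ne', div_self hvn.ne', one_smul]
  obtain ⟨y, hyt, h', g, hg, hw, hcon⟩ := exists_steep_lineDeriv hf (x := x) (e := e) (q := q)
    (h := (η / ‖v‖) • v) (p := p) (Δ := Δ) he hq hp hη0 hη1 ht0
    (by rw [norm_smul, Real.norm_of_nonneg (by positivity), div_mul_cancel₀ _ hvn.ne'])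
    (fun s hs => hρ (by
      rw [Real.dist_eq, sub_zero]; linarith [htlt.trans_le (min_le_left _ _)])) hΔ0 (by
      rw [← real_inner_smul_right, htv]
      refine lt_of_le_of_lt ?_ hbad
      have : 12 * η ^ 2 * t = 12 * η * ‖v‖ := by rw [ht]; field_simp
      rw [this]
      gcongr)
  obtain ⟨s, hs, hlt⟩ := hy (y := y)
    (by rw [dist_eq_norm]; exact hyt.trans_lt (htlt.trans_le (min_le_right _ _))) h' g hg hw
  exact absurd (hcon s hs) (not_le.2 hlt)

/-- A real-valued Lipschitz function on a Hilbert space is differentiable on a dense set. -/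
theorem LipschitzWith.dense_differentiableAt [CompleteSpace H] {f : H → ℝ} {K : NNReal}
    (hf : LipschitzWith K f) : Dense {x | DifferentiableAt ℝ f x} := by
  have hK : (0 : ℝ) < K + 1 := by positivity
  have hf1 : LipschitzWith 1 fun x => ((K : ℝ) + 1)⁻¹ * f x := by
    refine LipschitzWith.of_dist_le_mul fun x y => ?_
    have := hf.dist_le_mul x y
    rw [Real.dist_eq] at *
    rw [← mul_sub, abs_mul, abs_of_pos (inv_pos.2 hK), NNReal.coe_one, one_mul,
      inv_mul_le_iff₀ hK]
    linarith [dist_nonneg (x := x) (y := y)]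
  refine Metric.dense_iff.2 fun x₀ r hr => ?_
  obtain ⟨x, hx, hd⟩ := hf1.exists_differentiableAt_near x₀ (show 0 < r / 3 by positivity)
  refine ⟨x, by rw [Metric.mem_ball, dist_eq_norm]; linarith, ?_⟩
  refine (hd.const_mul ((K : ℝ) + 1)).congr_of_eventuallyEq (Eventually.of_forall fun y => ?_)
  simp only
  rw [mul_inv_cancel_left₀ hK.ne']

end Differentiability

section Subsolutions

variable {H : Type*} [NormedAddCommGroup H] [InnerProductSpace ℝ H] [CompleteSpace H]

/-- A smooth variational principle with quadratic perturbations on closed balls. -/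
theorem exists_quadratic_perturbed_max {g : H → ℝ} (hg : UpperSemicontinuous g) {y : H}
    {ρ M c : ℝ} (hM : ∀ x ∈ Metric.closedBall y ρ, g x ≤ M) (hc : 0 < c) {x₁ : H}
    (hx₁ : x₁ ∈ Metric.closedBall y ρ) :
    ∃ e ∈ Metric.closedBall y ρ, ∃ q : H, ‖q‖ ≤ 4 ∧ g x₁ - c ≤ g e ∧
      ∀ x ∈ Metric.closedBall y ρ, g x - c * (inner ℝ q (x - e) + 2 * ‖x - e‖ ^ 2) ≤ g e := by
  have hbdd : BddAbove (g '' Metric.closedBall y ρ) :=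
    ⟨M, Set.forall_mem_image.2 hM⟩
  obtain ⟨_, ⟨z₀, hz₀, rfl⟩, hlt⟩ := exists_lt_of_lt_csSup (⟨_, Set.mem_image_of_mem g hx₁⟩)
    (sub_lt_self (sSup (g '' Metric.closedBall y ρ)) hc)
  have hle : ∀ x ∈ Metric.closedBall y ρ, g x ≤ g z₀ + c := fun x hx =>
    (le_csSup hbdd (Set.mem_image_of_mem g hx)).trans (by linarith)
  obtain ⟨z, e, q, V, L, S, hz0, hV0, hVm, hVL, -, hq, he, hS, -, hnn, hmax⟩ :=
    exists_penalized_limit (α := Metric.closedBall y ρ) (π := Subtype.val)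
      (Ψ := fun w => g w / c) (R := fun _ _ _ _ => True) (fun _ _ _ _ _ _ _ => trivial)
      (fun _ _ => trivial) ⟨z₀, hz₀⟩ (fun w => by
        rw [div_add_one hc.ne']; gcongr; exact hle w w.2)
  have hVle : ∀ k, V k ≤ L := hVm.ge_of_tendsto hVL
  have hpow : Tendsto (fun k : ℕ => ((1 : ℝ) / 2) ^ k) atTop (𝓝 0) :=
    tendsto_pow_atTop_nhds_zero_of_lt_one (by norm_num) (by norm_num)
  have hze : Tendsto (fun k => (z k : H)) atTop (𝓝 e) := by
    refine tendsto_iff_norm_sub_tendsto_zero.2 (squeeze_zero (fun _ => norm_nonneg _) ?_ hpow)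
    intro k
    rw [norm_sub_rev]
    exact he k
  have heb : e ∈ Metric.closedBall y ρ :=
    Metric.isClosed_closedBall.mem_of_tendsto hze (Eventually.of_forall fun k => (z k).2)
  have hΨ : Tendsto (fun k => g (z k) / c) atTop (𝓝 (L + S)) := by
    have h0 : Tendsto (fun k => g (z k) / c - V k - S) atTop (𝓝 0) :=
      squeeze_zero_norm (fun k => hS k) (by simpa using hpow.const_mul 4)
    have := (h0.add hVL).add_const S
    rw [zero_add] at this
    refine this.congr fun k => ?_
    ring
  have hgz : Tendsto (fun k => g (z k)) atTop (𝓝 (c * (L + S))) :=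
    (hΨ.const_mul c).congr fun k => mul_div_cancel₀ _ hc.ne'
  have hge : c * (L + S) ≤ g e := by
    by_contra! hcon
    obtain ⟨m, h1, h2⟩ := exists_between hcon
    obtain ⟨k, hk1, hk2⟩ := ((hze.eventually (hg e m h1)).and
      (hgz.eventually_const_lt h2)).exists
    exact lt_asymm hk1 hk2
  have hmaxL : ∀ x ∈ Metric.closedBall y ρ,
      g x / c - (S + inner ℝ q (x - e) + 2 * ‖x - e‖ ^ 2) ≤ L := by
    intro x hx
    by_contra! hcon
    refine hcon.not_ge (le_of_tendsto_of_tendsto' tendsto_const_nhds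
      (by simpa using (tendsto_const_nhds (x := L)).add (tendsto_pow_atTop_nhds_zero_of_lt_one
        (r := (1 / 8 : ℝ)) (by norm_num) (by norm_num))) fun n => hmax ⟨x, hx⟩ n fun k _ => ?_)
    exact ⟨(hVle k).trans hcon.le, trivial⟩
  refine ⟨e, heb, q, hq, ?_, fun x hx => ?_⟩
  · have h1 := hnn e
    simp only [sub_self, inner_zero_right, norm_zero] at h1
    have h2 : g z₀ / c ≤ L := by simpa [← hV0] using hVle 0
    rw [div_le_iff₀' hc] at h2
    have h3 := hle x₁ hx₁
    nlinarith
  · have h1 := hmaxL x hx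
    have h2 : g x ≤ c * (L + (S + inner ℝ q (x - e) + 2 * ‖x - e‖ ^ 2)) := by
      rw [← div_le_iff₀' hc]; linarith
    linarith

/-- A local cone bound for functions whose supergradients are bounded. -/
theorem le_add_cone_of_superdiffR {u : H → ℝ} (hu : UpperSemicontinuous u) {K K' ρ M N : ℝ}
    (hK : 0 < K) (hsup : ∀ x, ∀ ζ ∈ superdiffR u x, ‖ζ‖ < K) (hKK' : K < K') {y : H}
    (hM : ∀ x ∈ Metric.closedBall y ρ, u x ≤ M) (hN₀ : 0 ≤ N) (hN : M - u y + 1 ≤ N * ρ ^ 2)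
    {x₁ : H} (hx₁ : x₁ ∈ Metric.closedBall y ρ) :
    u x₁ ≤ u y + K' * ‖x₁ - y‖ + N * ‖x₁ - y‖ ^ 2 := by
  by_contra! hcon
  set v := u x₁ - (u y + K' * ‖x₁ - y‖ + N * ‖x₁ - y‖ ^ 2) with hv
  have hv0 : 0 < v := sub_pos.2 hcon
  have hK' : 0 < K' := hK.trans hKK'
  obtain ⟨d, hd, hnear⟩ := Metric.eventually_nhds_iff.1
    (hu y (u y + v / 4) (by linarith))
  obtain ⟨s, hs, hs1, hs2⟩ : ∃ s > 0, K' * s ≤ v / 4 ∧ K' * s ≤ (K' - K) / 2 * d := by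
    refine ⟨min (v / 4) ((K' - K) / 2 * d) / K', ?_, ?_, ?_⟩
    · have : 0 < (K' - K) / 2 * d := mul_pos (by linarith) hd
      positivity
    · rw [mul_div_cancel₀ _ hK'.ne']; exact min_le_left _ _
    · rw [mul_div_cancel₀ _ hK'.ne']; exact min_le_right _ _
  set c := min (v / 4) ((K' - K) / 8) with hc
  have hc0 : 0 < c := lt_min (by linarith) (by linarith)
  set φ : H → ℝ := fun x => u y + K' * √(‖x - y‖ ^ 2 + s ^ 2) + N * ‖x - y‖ ^ 2 with hφ
  have hpos : ∀ x, 0 < ‖x - y‖ ^ 2 + s ^ 2 := fun x => by positivity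
  have hnsq : ∀ a : H, ContDiff ℝ 1 fun x : H => ‖x - a‖ ^ 2 := fun a =>
    (contDiff_id.sub contDiff_const).norm_sq ℝ
  have hφc : ContDiff ℝ 1 φ :=
    (contDiff_const.add (contDiff_const.mul
      (((hnsq y).add contDiff_const).sqrt fun x => (hpos x).ne'))).add
      (contDiff_const.mul (hnsq y))
  have hφge : ∀ x, u y + K' * ‖x - y‖ + N * ‖x - y‖ ^ 2 ≤ φ x := fun x => by
    have : ‖x - y‖ ≤ √(‖x - y‖ ^ 2 + s ^ 2) := Real.le_sqrt_of_sq_le (by nlinarith)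
    simp only [hφ]
    gcongr
  have hφle : φ x₁ ≤ u y + K' * ‖x₁ - y‖ + N * ‖x₁ - y‖ ^ 2 + v / 4 := by
    have : √(‖x₁ - y‖ ^ 2 + s ^ 2) ≤ ‖x₁ - y‖ + s :=
      Real.sqrt_le_iff.2 ⟨by positivity, by nlinarith [norm_nonneg (x₁ - y)]⟩
    have := mul_le_mul_of_nonneg_left this hK'.le
    simp only [hφ]
    linarith
  obtain ⟨e, he, q, hq, hge, hmax⟩ := exists_quadratic_perturbed_max (g := fun x => u x - φ x)
    (by
      simp only [sub_eq_add_neg]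
      exact hu.add hφc.continuous.neg.upperSemicontinuous) (M := M - u y) (fun x hx => by
      have h1 := hM x hx
      have h2 := hφge x
      have : 0 ≤ K' * ‖x - y‖ + N * ‖x - y‖ ^ 2 := by positivity
      linarith) hc0 hx₁
  have hcv : c ≤ v / 4 := min_le_left _ _
  have hepos : v / 2 ≤ u e - φ e := by linarith
  have hφe := hφge e
  rw [mem_closedBall_iff_norm] at he
  have hde : d ≤ ‖e - y‖ := by
    by_contra! h
    have h1 := hnear (y := e) (by rwa [dist_eq_norm])
    have : 0 ≤ K' * ‖e - y‖ + N * ‖e - y‖ ^ 2 := by positivity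
    linarith
  have hlt : ‖e - y‖ < ρ := by
    refine lt_of_le_of_ne he fun h => ?_
    have h1 := hM e (mem_closedBall_iff_norm.2 he)
    rw [h] at hφe
    have : 0 ≤ K' * ρ := by rw [← h]; positivity
    linarith
  have hsuper := hsup e _ ⟨fun x => φ x + c * (inner ℝ q (x - e) + 2 * ‖x - e‖ ^ 2),
    hφc.add (contDiff_const.mul ((contDiff_const.inner ℝ (contDiff_id.sub contDiff_const)).add
      (contDiff_const.mul (hnsq e)))), rfl, by
      filter_upwards [Metric.isOpen_ball.mem_nhds (mem_ball_iff_norm.2 hlt)] with x hx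
      have := hmax x (Metric.ball_subset_closedBall hx)
      simp only [sub_self, inner_zero_right, norm_zero]
      linarith⟩
  set w := e - y with hw
  have hid : ∀ a : H, HasFDerivAt (fun x => x - a) (ContinuousLinearMap.id ℝ H) e := fun a =>
    (hasFDerivAt_id e).sub_const a
  obtain ⟨ζ, hζ, hζw⟩ : ∃ ζ : H →L[ℝ] ℝ,
      HasFDerivAt (fun x => φ x + c * (inner ℝ q (x - e) + 2 * ‖x - e‖ ^ 2)) ζ e ∧
      ζ w = K' * (‖w‖ ^ 2 / √(‖w‖ ^ 2 + s ^ 2)) + 2 * N * ‖w‖ ^ 2 + c * inner ℝ q w := by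
    refine ⟨_, (((((hid y).norm_sq.add_const (s ^ 2)).sqrt (hpos e).ne').const_mul K').const_add
      (u y)).add ((hid y).norm_sq.const_mul N) |>.add
      ((((hasFDerivAt_const q e).inner ℝ (hid e)).add
        ((hid e).norm_sq.const_mul 2)).const_mul c), ?_⟩
    simp [← hw]
    field_simp
  rw [hζ.fderiv] at hsuper
  have hw0 : 0 < ‖w‖ := hd.trans_le hde
  have hζle : ζ w < K * ‖w‖ := by
    refine (le_abs_self _).trans_lt ((ζ.le_opNorm w).trans_lt ?_)
    gcongr
  have hsqrt : ‖w‖ - s ≤ ‖w‖ ^ 2 / √(‖w‖ ^ 2 + s ^ 2) := by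
    rw [le_div_iff₀ (Real.sqrt_pos.2 (hpos e))]
    have h1 : √(‖w‖ ^ 2 + s ^ 2) ≤ ‖w‖ + s := Real.sqrt_le_iff.2 ⟨by positivity, by nlinarith⟩
    have h2 := Real.sqrt_nonneg (‖w‖ ^ 2 + s ^ 2)
    rcases le_total s ‖w‖ with h | h
    · nlinarith
    · nlinarith [sq_nonneg ‖w‖]
  have h1 := mul_le_mul_of_nonneg_left hsqrt hK'.le
  have h2 : -(4 * ‖w‖) ≤ inner ℝ q w :=
    (neg_le_neg (by gcongr)).trans (neg_le_of_abs_le (abs_real_inner_le_norm q w))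
  have h3 := mul_le_mul_of_nonneg_left h2 hc0.le
  have h4 : c * ‖w‖ ≤ (K' - K) / 8 * ‖w‖ := by gcongr; exact min_le_right _ _
  have h5 : (K' - K) / 2 * d ≤ (K' - K) / 2 * ‖w‖ := by gcongr
  have h6 : 0 ≤ 2 * N * ‖w‖ ^ 2 := by positivity
  linarith

/-- An upper semicontinuous function with bounded supergradients is continuous. -/
theorem continuous_of_superdiffR {u : H → ℝ} (hu : UpperSemicontinuous u) {K : ℝ}
    (hK : 0 < K) (hsup : ∀ x, ∀ ζ ∈ superdiffR u x, ‖ζ‖ < K) : Continuous u := by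
  refine continuous_iff_lower_upperSemicontinuous.2 ⟨fun x₀ m hm => ?_, hu⟩
  obtain ⟨R, hR, hub⟩ := Metric.eventually_nhds_iff.1 (hu x₀ (u x₀ + 1) (by linarith))
  have hlim : Tendsto (fun y => (K + 1) * ‖x₀ - y‖ +
      (u x₀ + 2 - m) / (R / 2) ^ 2 * ‖x₀ - y‖ ^ 2) (𝓝 x₀) (𝓝 0) := by
    have : Continuous fun y => (K + 1) * ‖x₀ - y‖ +
      (u x₀ + 2 - m) / (R / 2) ^ 2 * ‖x₀ - y‖ ^ 2 := by fun_prop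
    simpa using this.tendsto x₀
  filter_upwards [hlim.eventually_lt_const (show 0 < u x₀ - m by linarith),
    Metric.ball_mem_nhds x₀ (half_pos hR)] with y hy hyR
  rw [Metric.mem_ball] at hyR
  by_contra! hle
  have hcone := le_add_cone_of_superdiffR hu hK hsup (lt_add_one K) (y := y) (ρ := R / 2)
    (M := u x₀ + 1) (N := (u x₀ + 2 - u y) / (R / 2) ^ 2)
    (fun x hx => (hub ((dist_triangle x y x₀).trans_lt (by
      linarith [Metric.mem_closedBall.1 hx]))).le)
    (div_nonneg (by linarith) (by positivity))
    (by rw [div_mul_cancel₀ _ (by positivity)]; linarith)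
    (Metric.mem_closedBall.2 (by rw [dist_comm]; exact hyR.le))
  rw [dist_comm, dist_eq_norm] at hyR
  have hκ : ‖x₀ - y‖ ^ 2 / (R / 2) ^ 2 ≤ 1 := div_le_one_of_le₀ (by gcongr) (by positivity)
  rw [div_mul_eq_mul_div, mul_div_assoc] at hy hcone
  nlinarith

/-- An upper semicontinuous function with supergradients bounded by `K` is `K`-Lipschitz. -/
theorem sub_le_mul_norm_of_superdiffR {u : H → ℝ} (hu : UpperSemicontinuous u) {K : ℝ}
    (hK : 0 < K) (hsup : ∀ x, ∀ ζ ∈ superdiffR u x, ‖ζ‖ < K) (a b : H) :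
    u b - u a ≤ K * ‖b - a‖ := by
  have hcont := continuous_of_superdiffR hu hK hsup
  have key : ∀ K' > K, u b - u a ≤ K' * ‖b - a‖ := by
    intro K' hK'
    set γ : ℝ → H := fun s => a + s • (b - a) with hγ
    have hγc : Continuous γ := by fun_prop
    have := image_le_of_liminf_slope_right_le_deriv_boundary (f := u ∘ γ) (a := 0) (b := 1)
      (B := fun s => u a + K' * ‖b - a‖ * s) (B' := fun _ => K' * ‖b - a‖)
      (hcont.comp hγc).continuousOn (by simp [hγ]) (by fun_prop)
      (fun s _ => by
        simpa using (((hasDerivAt_id s).const_mul (K' * ‖b - a‖)).const_add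
          (u a)).hasDerivWithinAt)
      (fun s _ r hr => ?_) (Set.right_mem_Icc.2 zero_le_one)
    · simp only [hγ, Function.comp, one_smul, add_sub_cancel, mul_one] at this
      linarith
    refine Eventually.frequently ?_
    obtain ⟨R, hR, hub⟩ := Metric.eventually_nhds_iff.1
      (hu (γ s) (u (γ s) + 1) (by linarith))
    have hlim : Tendsto (fun z => K' * ‖b - a‖ + 2 / (R / 2) ^ 2 * ‖b - a‖ ^ 2 * (z - s))
        (𝓝[>] s) (𝓝 (K' * ‖b - a‖)) := by
      have : Continuous fun z => K' * ‖b - a‖ + 2 / (R / 2) ^ 2 * ‖b - a‖ ^ 2 * (z - s) := by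
        fun_prop
      simpa using (this.tendsto s).mono_left nhdsWithin_le_nhds
    filter_upwards [hlim.eventually_lt_const hr, self_mem_nhdsWithin,
      nhdsWithin_le_nhds (hγc.tendsto s (Metric.closedBall_mem_nhds _ (half_pos hR)))]
      with z hz hzs hzR
    have hzs : 0 < z - s := sub_pos.2 hzs
    have h1 := le_add_cone_of_superdiffR hu hK hsup hK' (y := γ s) (ρ := R / 2)
      (M := u (γ s) + 1) (N := 2 / (R / 2) ^ 2)
      (fun x hx => (hub ((Metric.mem_closedBall.1 hx).trans_lt (half_lt_self hR))).le)
      (by positivity) (by rw [div_mul_cancel₀ _ (by positivity)]; linarith) hzR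
    have h2 : ‖γ z - γ s‖ = (z - s) * ‖b - a‖ := by
      rw [hγ, add_sub_add_left_eq_sub, ← sub_smul, norm_smul, Real.norm_of_nonneg hzs.le]
    rw [h2] at h1
    rw [slope_def_field, div_lt_iff₀ hzs]
    refine lt_of_le_of_lt ?_ (mul_lt_mul_of_pos_right hz hzs)
    simp only [Function.comp]
    linarith
  refine ge_of_tendsto (x := 𝓝[>] K) (f := fun K' => K' * ‖b - a‖) ?_ ?_
  · exact ((continuous_id.mul continuous_const).tendsto K).mono_left nhdsWithin_le_nhds
  · filter_upwards [self_mem_nhdsWithin] with K' hK' using key K' hK'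

end Subsolutions

/-- Regularity of viscosity subsolutions of coercive Hamilton–Jacobi equations in a real
Hilbert space: if `F(t,x,ζ) > 0` whenever `‖ζ‖ ≥ K` and `u` is an usc viscosity subsolution
of `F(u, x, du) = 0`, then `u` is `K`-Lipschitz and Fréchet differentiable on a dense set. -/
theorem coercive_hamilton_jacobi_regularity
    {H : Type*} [NormedAddCommGroup H] [InnerProductSpace ℝ H] [CompleteSpace H]
    (F : ℝ → H → (H →L[ℝ] ℝ) → ℝ) (K : ℝ) (hK : 0 < K)
    (hcoerc : ∀ (t : ℝ) (x : H) (ζ : H →L[ℝ] ℝ), K ≤ ‖ζ‖ → 0 < F t x ζ)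
    (u : H → ℝ) (hu : UpperSemicontinuous u)
    (hsub : ∀ x : H, ∀ ζ ∈ superdiffR u x, F (u x) x ζ ≤ 0) :
    (∀ x y : H, |u x - u y| ≤ K * ‖x - y‖) ∧
    Dense {x : H | DifferentiableAt ℝ u x} := by
  have hsup : ∀ x, ∀ ζ ∈ superdiffR u x, ‖ζ‖ < K := fun x ζ hζ =>
    not_le.1 fun h => (hsub x ζ hζ).not_gt (hcoerc _ _ _ h)
  have hlip : ∀ x y : H, |u x - u y| ≤ K * ‖x - y‖ := fun x y => by
    refine abs_le.2 ⟨?_, sub_le_mul_norm_of_superdiffR hu hK hsup y x⟩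
    have := sub_le_mul_norm_of_superdiffR hu hK hsup x y
    rw [norm_sub_rev] at this
    linarith
  refine ⟨hlip, LipschitzWith.dense_differentiableAt (K := K.toNNReal) ?_⟩
  refine LipschitzWith.of_dist_le_mul fun x y => ?_
  rw [Real.dist_eq, dist_eq_norm, Real.coe_toNNReal _ hK.le]
  exact hlip x y
end
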